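/- There is an absolute constant C > 0 such that every rational number b/q ∈ (0,1) with b, q positive integers and gcd(b, q) = 1 admits a representation as a finite signed sum b/q = Σ_α ε_α · (b_α/q_α), where each ε_α ∈ {+1, −1}, each b_α/q_α ∈ (0,1) with gcd(b_α, q_α) = 1, and Σ_α S(b_α/q_α) ≤ C · log q. -/

import Mathlib

/-- Auxiliary continued fraction algorithm with fuel: for `x ∈ (0,1)`,
produces the list of partial quotients `[a₁, …, aₙ]` of `x = [0; a₁, …, aₙ]`. -/
def cfListAux : ℕ → ℚ → List ℕ
  | 0, _ => []
  | (n + 1), x => if x = 0 then [] else ⌊x⁻¹⌋.toNat :: cfListAux n (x⁻¹ - (⌊x⁻¹⌋ : ℚ))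

/-- The (canonical) list of partial quotients of a rational `x ∈ (0,1)`:
`x = [0; a₁, …, aₙ]` with each `aᵢ` a positive integer and `aₙ ≥ 2`.
The denominator of `x` is a valid fuel bound since denominators strictly decrease. -/
def cfList (x : ℚ) : List ℕ := cfListAux x.den x

/-- `S x` is the sum of the partial quotients of the rational `x ∈ (0,1)`. -/
def S (x : ℚ) : ℕ := (cfList x).sum

/-- `RA A` is the set of rationals in `(0,1)` all of whose partial quotients are `≤ A`. -/
def RA (A : ℕ) : Set ℚ := {x | 0 < x ∧ x < 1 ∧ ∀ a ∈ cfList x, a ≤ A}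

/-- `RepCost y n` : the rational `y` admits a representation as a finite signed sum
`y = Σ_α ε_α · x_α` with `ε_α ∈ {+1, -1}`, each `x_α = b_α/q_α ∈ (0,1)` in lowest terms,
and total partial-quotient cost `Σ_α S(x_α) = n`. -/
def RepCost (y : ℚ) (n : ℕ) : Prop :=
  ∃ (k : ℕ) (ε : Fin k → ℤ) (x : Fin k → ℚ),
    (∀ i, ε i = 1 ∨ ε i = -1) ∧ (∀ i, 0 < x i ∧ x i < 1) ∧
    y = ∑ i, (ε i : ℚ) * x i ∧ n = ∑ i, S (x i)

/-- `CostLE y t` : the minimal representation cost `Ĉ(y)` is at most `t`. -/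
def CostLE (y : ℚ) (t : ℝ) : Prop := ∃ n : ℕ, RepCost y n ∧ (n : ℝ) ≤ t

lemma den_inv_sub_floor_lt {x : ℚ} (h0 : 0 < x) (h1 : x < 1) :
    (x⁻¹ - (⌊x⁻¹⌋ : ℚ)).den < x.den := by
  have h : (x⁻¹ - (⌊x⁻¹⌋ : ℚ)).den = x.num.natAbs := by
    rw [Rat.sub_intCast_den, Rat.den_inv_of_ne_zero h0.ne']
  rw [h]
  have h2 : x.num < x.den := by
    exact Rat.num_lt_denom_iff.mpr h1
  have := Rat.num_pos.mpr h0
  omega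

lemma cfListAux_fuel : ∀ (n m : ℕ) (x : ℚ), 0 ≤ x → x < 1 → x.den ≤ n → x.den ≤ m →
    cfListAux n x = cfListAux m x := by
  intro n
  induction n with
  | zero => intro m x _ _ h _; exact absurd x.den_pos (by omega)
  | succ n ih =>
    intro m x h0 h1 hn hm
    obtain _ | m := m
    · exact absurd x.den_pos (by omega)
    unfold cfListAux
    split_ifs with hx
    · rfl
    · have hx0 : 0 < x := lt_of_le_of_ne h0 (Ne.symm hx)
      have := den_inv_sub_floor_lt hx0 h1
      rw [ih m (x⁻¹ - ⌊x⁻¹⌋) (by linarith [Int.floor_le x⁻¹])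
        (by linarith [Int.lt_floor_add_one x⁻¹]) (by omega) (by omega)]

lemma S_zero : S 0 = 0 := by simp [S, cfList, cfListAux]

lemma S_eq_floor_add {x : ℚ} (h0 : 0 < x) (h1 : x < 1) :
    S x = ⌊x⁻¹⌋.toNat + S (Int.fract x⁻¹) := by
  have hlt := den_inv_sub_floor_lt h0 h1
  unfold S cfList
  obtain ⟨n, hn⟩ : ∃ n, x.den = n + 1 := ⟨x.den - 1, by have := x.den_pos; omega⟩
  rw [hn]
  conv_lhs => unfold cfListAux
  rw [if_neg h0.ne', List.sum_cons]
  congr 2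
  exact cfListAux_fuel _ _ _ (by linarith [Int.floor_le x⁻¹])
        (by linarith [Int.lt_floor_add_one x⁻¹]) (by omega) le_rfl

lemma S_one_sub_of_lt_half {x : ℚ} (h0 : 0 < x) (h1 : x < 1 / 2) : S (1 - x) = S x := by
  have hx1 : (0 : ℚ) < 1 - x := by linarith
  have hfl : ⌊(1 - x)⁻¹⌋ = 1 := by
    rw [Int.floor_eq_iff]
    constructor
    · push_cast
      rw [one_le_inv₀ hx1]; linarith
    · push_cast
      rw [inv_lt_comm₀ hx1 (by norm_num)]; norm_num; linarith
  have hfr : Int.fract (1 - x)⁻¹ = (x⁻¹ - 1)⁻¹ := by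
    unfold Int.fract
    rw [hfl]
    have : x⁻¹ - 1 = (1 - x) / x := by field_simp
    rw [this]
    push_cast
    field_simp
    ring
  have hxi : 2 < x⁻¹ := by rw [lt_inv_comm₀ (by norm_num) h0]; linarith
  rw [S_eq_floor_add hx1 (by linarith), hfl, hfr,
    S_eq_floor_add (x := (x⁻¹ - 1)⁻¹) (by apply inv_pos.mpr; linarith)
      (by apply inv_lt_one_of_one_lt₀; linarith), S_eq_floor_add h0 (by linarith), inv_inv]
  have h3 : ⌊x⁻¹ - 1⌋ = ⌊x⁻¹⌋ - 1 := by exact_mod_cast Int.floor_sub_one x⁻¹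
  have h4 : Int.fract (x⁻¹ - 1) = Int.fract x⁻¹ := by exact_mod_cast Int.fract_sub_one x⁻¹
  have h5 : 2 ≤ ⌊x⁻¹⌋ := by rw [Int.le_floor]; exact_mod_cast hxi.le
  rw [h3, h4]
  omega

lemma S_one_sub {x : ℚ} (h0 : 0 < x) (h1 : x < 1) : S (1 - x) = S x := by
  rcases lt_trichotomy x (1 / 2) with h | h | h
  · exact S_one_sub_of_lt_half h0 h
  · rw [h]; norm_num
  · have := S_one_sub_of_lt_half (x := 1 - x) (by linarith) (by linarith)
    rw [← this]; congr 1; ring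

lemma two_le_S {x : ℚ} (h0 : 0 < x) (h1 : x < 1) : 2 ≤ S x := by
  have key : ∀ y : ℚ, 0 < y → y ≤ 1 / 2 → 2 ≤ S y := by
    intro y hy0 hy1
    rw [S_eq_floor_add hy0 (by linarith)]
    have h5 : 2 ≤ ⌊y⁻¹⌋ := by
      rw [Int.le_floor]; push_cast; rw [le_inv_comm₀ (by norm_num) hy0]; linarith
    omega
  rcases le_total x (1 / 2) with h | h
  · exact key x h0 h
  · rw [← S_one_sub h0 h1]; exact key _ (by linarith) (by linarith)

/-- The sum of all partial quotients of `|x|`, the integer part included. -/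
def fullCost (x : ℚ) : ℕ := S (Int.fract |x|) + ⌊|x|⌋₊

lemma fullCost_neg (x : ℚ) : fullCost (-x) = fullCost x := by simp [fullCost]

lemma fullCost_of_mem {x : ℚ} (h0 : 0 ≤ x) (h1 : x < 1) : fullCost x = S x := by
  unfold fullCost
  rw [abs_of_nonneg h0, Int.fract_eq_self.mpr ⟨h0, h1⟩, Nat.floor_eq_zero.mpr h1, add_zero]

lemma fullCost_inv (x : ℚ) : fullCost x⁻¹ = fullCost x := by
  have key : ∀ y : ℚ, 0 < y → y < 1 → fullCost y⁻¹ = fullCost y := by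
    intro y h0 h1
    rw [fullCost_of_mem h0.le h1, S_eq_floor_add h0 h1]
    unfold fullCost
    rw [abs_of_pos (inv_pos.mpr h0), ← Int.floor_toNat, add_comm]
  have pos : ∀ y : ℚ, 0 < y → fullCost y⁻¹ = fullCost y := by
    intro y h0
    rcases lt_trichotomy y 1 with h | h | h
    · exact key y h0 h
    · rw [h]; norm_num
    · rw [← key y⁻¹ (inv_pos.mpr h0) (inv_lt_one_of_one_lt₀ h), inv_inv]
  rcases lt_trichotomy x 0 with h | h | h
  · rw [← fullCost_neg x, ← pos (-x) (by linarith), inv_neg, fullCost_neg]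
  · rw [h, inv_zero]
  · exact pos x h

lemma fullCost_add_one_of_nonneg {x : ℚ} (h : 0 ≤ x) : fullCost (x + 1) = fullCost x + 1 := by
  unfold fullCost
  rw [abs_of_nonneg h, abs_of_nonneg (by linarith), Int.fract_add_one, Nat.floor_add_one h]
  ring

lemma fullCost_add_one (x : ℚ) :
    fullCost (x + 1) ≤ fullCost x + 1 ∧ fullCost x ≤ fullCost (x + 1) + 1 := by
  rcases le_or_gt 0 x with h | h
  · rw [fullCost_add_one_of_nonneg h]; omega
  rcases le_or_gt x (-1) with h' | h'
  · have := fullCost_add_one_of_nonneg (x := -x - 1) (by linarith)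
    rw [sub_add_cancel, fullCost_neg, ← fullCost_neg (-x - 1)] at this
    have e : -(-x - 1) = x + 1 := by ring
    rw [e] at this
    omega
  · rw [← fullCost_neg x, fullCost_of_mem (x := x + 1) (by linarith) (by linarith),
      fullCost_of_mem (x := -x) (by linarith) (by linarith),
      ← S_one_sub (x := -x) (by linarith) (by linarith)]
    have e : 1 - -x = x + 1 := by ring
    rw [e]; omega

lemma S_fract_le_fullCost (x : ℚ) : S (Int.fract x) ≤ fullCost x := by
  rcases le_or_gt 0 x with h | h
  · unfold fullCost; rw [abs_of_nonneg h]; omega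
  · unfold fullCost
    rw [abs_of_neg h]
    by_cases hx : Int.fract x = 0
    · rw [hx, S_zero]; omega
    · rw [Int.fract_neg hx, S_one_sub (lt_of_le_of_ne (Int.fract_nonneg x) (Ne.symm hx))
        (Int.fract_lt_one x)]
      omega

/-- The modular group, acting on integer vectors. -/
abbrev SLTwo := Matrix.SpecialLinearGroup (Fin 2) ℤ

/-- The action of `SL(2, ℤ)` on integer vectors. -/
def act (g : SLTwo) (v : ℤ × ℤ) : ℤ × ℤ :=
  (g 0 0 * v.1 + g 0 1 * v.2, g 1 0 * v.1 + g 1 1 * v.2)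

lemma act_mul (g h : SLTwo) (v : ℤ × ℤ) : act (g * h) v = act g (act h v) := by
  simp only [act, Matrix.SpecialLinearGroup.coe_mul, Matrix.mul_apply, Fin.sum_univ_two]
  ext <;> simp only <;> ring

lemma act_one (v : ℤ × ℤ) : act 1 v = v := by
  simp [act]

lemma act_inv_act (g : SLTwo) (v : ℤ × ℤ) : act g⁻¹ (act g v) = v := by
  rw [← act_mul, inv_mul_cancel, act_one]

lemma act_act_inv (g : SLTwo) (v : ℤ × ℤ) : act g (act g⁻¹ v) = v := by
  rw [← act_mul, mul_inv_cancel, act_one]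

lemma act_injective (g : SLTwo) : Function.Injective (act g) := by
  intro v w h
  rw [← act_inv_act g v, h, act_inv_act]

lemma det_entries (g : SLTwo) : g 0 0 * g 1 1 - g 0 1 * g 1 0 = 1 := by
  rw [← Matrix.det_fin_two, g.det_coe]

lemma act_inv (g : SLTwo) (v : ℤ × ℤ) :
    act g⁻¹ v = (g 1 1 * v.1 - g 0 1 * v.2, -g 1 0 * v.1 + g 0 0 * v.2) := by
  simp only [act, Matrix.SpecialLinearGroup.coe_inv, Matrix.adjugate_fin_two]
  simp [sub_eq_add_neg]

/-- Continued fraction cost of the slope of an integer vector. -/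
def vecCost (v : ℤ × ℤ) : ℕ := fullCost ((v.1 : ℚ) / v.2)

lemma exists_act_vecCost_le (g : SLTwo) : ∃ L : ℕ, ∀ v,
    vecCost (act g v) ≤ vecCost v + L ∧ vecCost v ≤ vecCost (act g v) + L := by
  have hg : g ∈ Subgroup.closure {ModularGroup.S, ModularGroup.T} := by
    rw [SpecialLinearGroup.SL2Z_generators]; trivial
  induction hg using Subgroup.closure_induction with
  | mem x hx =>
    rcases hx with rfl | rfl
    · refine ⟨0, fun v => ?_⟩
      have : vecCost (act ModularGroup.S v) = vecCost v := by
        unfold vecCost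
        have : act ModularGroup.S v = (-v.2, v.1) := by simp [act, ModularGroup.S]
        rw [this, ← fullCost_inv, ← fullCost_neg]
        congr 1
        simp [neg_div]
      omega
    · refine ⟨1, fun v => ?_⟩
      have e : act ModularGroup.T v = (v.1 + v.2, v.2) := by simp [act, ModularGroup.T]
      unfold vecCost
      rw [e]
      by_cases h : v.2 = 0
      · simp [h]
      · have h' : (v.2 : ℚ) ≠ 0 := by exact_mod_cast h
        have : ((v.1 + v.2 : ℤ) : ℚ) / v.2 = v.1 / v.2 + 1 := by
          push_cast; field_simp
        simp only [this]
        have := fullCost_add_one ((v.1 : ℚ) / v.2)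
        omega
  | one => exact ⟨0, fun v => by rw [act_one]; simp⟩
  | mul x y _ _ hx hy =>
    obtain ⟨L, hL⟩ := hx
    obtain ⟨M, hM⟩ := hy
    refine ⟨L + M, fun v => ?_⟩
    rw [act_mul]
    have h1 := hL (act y v)
    have h2 := hM v
    omega
  | inv x _ hx =>
    obtain ⟨L, hL⟩ := hx
    refine ⟨L, fun v => ?_⟩
    have h1 := hL (act x⁻¹ v)
    rw [act_act_inv] at h1
    omega

lemma RepCost.zero : RepCost 0 0 := ⟨0, Fin.elim0, Fin.elim0, by simp⟩

lemma RepCost.add {y z : ℚ} {m n : ℕ} (hy : RepCost y m) (hz : RepCost z n) :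
    RepCost (y + z) (m + n) := by
  obtain ⟨k, e, x, he, hx, h1, h2⟩ := hy
  obtain ⟨k', e', x', he', hx', h1', h2'⟩ := hz
  refine ⟨k + k', Fin.append e e', Fin.append x x', ?_, ?_, ?_, ?_⟩
  · intro i
    induction i using Fin.addCases with
    | left i => simpa using he i
    | right i => simpa using he' i
  · intro i
    induction i using Fin.addCases with
    | left i => simpa using hx i
    | right i => simpa using hx' i
  · rw [Fin.sum_univ_add, h1, h1']; simp
  · rw [Fin.sum_univ_add, h2, h2']; simp

lemma RepCost.neg {y : ℚ} {m : ℕ} (hy : RepCost y m) : RepCost (-y) m := by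
  obtain ⟨k, e, x, he, hx, h1, h2⟩ := hy
  refine ⟨k, fun i => -e i, x, ?_, hx, ?_, h2⟩
  · intro i
    rcases he i with h | h <;> simp [h]
  · rw [h1]; simp

lemma RepCost.single {x : ℚ} (h0 : 0 < x) (h1 : x < 1) : RepCost x (S x) :=
  ⟨1, fun _ => 1, fun _ => x, by simp, by simp [h0, h1], by simp, by simp⟩

lemma RepCost.one : RepCost 1 4 := by
  have hS : S (1 / 2) = 2 := by
    rw [S_eq_floor_add (by norm_num) (by norm_num)]
    have : ((1 / 2 : ℚ))⁻¹ = ((2 : ℤ) : ℚ) := by norm_num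
    rw [this, Int.floor_intCast, Int.fract_intCast, S_zero]
    rfl
  have h := RepCost.single (x := 1 / 2) (by norm_num) (by norm_num)
  have := h.add h
  rw [hS] at this
  norm_num at this
  exact this

lemma RepCost.natCast (n : ℕ) : RepCost n (4 * n) := by
  induction n with
  | zero => simpa using RepCost.zero
  | succ n ih => simpa [mul_add] using ih.add RepCost.one

lemma RepCost.intCast (z : ℤ) : RepCost z (4 * z.natAbs) := by
  rcases Int.natAbs_eq z with h | h
  · have := RepCost.natCast z.natAbs
    have e : ((z.natAbs : ℕ) : ℚ) = z := by
      conv_rhs => rw [h]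
      simp
    rwa [e] at this
  · have := (RepCost.natCast z.natAbs).neg
    have e : -((z.natAbs : ℕ) : ℚ) = z := by
      conv_rhs => rw [h]
      simp
    rwa [e] at this

lemma RepCost.abs_le {y : ℚ} {n : ℕ} (h : RepCost y n) : 2 * |y| ≤ n := by
  obtain ⟨k, e, x, he, hx, h1, h2⟩ := h
  rw [h1, h2, Nat.cast_sum]
  calc 2 * |∑ i, (e i : ℚ) * x i| ≤ 2 * ∑ i, |(e i : ℚ) * x i| := by
        gcongr; exact Finset.abs_sum_le_sum_abs _ _
    _ = ∑ i, 2 * |(e i : ℚ) * x i| := by rw [Finset.mul_sum]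
    _ ≤ ∑ i, (S (x i) : ℚ) := by
        apply Finset.sum_le_sum
        intro i _
        have hS : (2 : ℚ) ≤ S (x i) := by exact_mod_cast two_le_S (hx i).1 (hx i).2
        have h3 : |(e i : ℚ) * x i| ≤ 1 := by
          rw [abs_mul, abs_of_pos (hx i).1]
          rcases he i with h | h <;> simp [h, (hx i).2.le]
        linarith

/-- `x` is, modulo one, a signed sum of fractions of total cost at most `t`. -/
def Cheap (t : ℝ) (x : ℚ) : Prop := ∃ (z : ℤ) (n : ℕ), RepCost (x + z) n ∧ (n : ℝ) ≤ t

lemma Cheap.mono {t t' : ℝ} {x : ℚ} (h : Cheap t x) (ht : t ≤ t') : Cheap t' x := by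
  obtain ⟨z, n, h1, h2⟩ := h
  exact ⟨z, n, h1, h2.trans ht⟩

lemma Cheap.add {t t' : ℝ} {x x' : ℚ} (h : Cheap t x) (h' : Cheap t' x') :
    Cheap (t + t') (x + x') := by
  obtain ⟨z, n, h1, h2⟩ := h
  obtain ⟨z', n', h1', h2'⟩ := h'
  refine ⟨z + z', n + n', ?_, by push_cast; linarith⟩
  have := h1.add h1'
  convert this using 1
  push_cast; ring

lemma Cheap.neg {t : ℝ} {x : ℚ} (h : Cheap t x) : Cheap t (-x) := by
  obtain ⟨z, n, h1, h2⟩ := h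
  refine ⟨-z, n, ?_, h2⟩
  convert h1.neg using 1
  push_cast; ring

lemma Cheap.add_int {t : ℝ} {x : ℚ} (h : Cheap t x) (k : ℤ) : Cheap t (x + k) := by
  obtain ⟨z, n, h1, h2⟩ := h
  refine ⟨z - k, n, ?_, h2⟩
  convert h1 using 1
  push_cast; ring

lemma cheap_S_fract (x : ℚ) : Cheap (S (Int.fract x)) x := by
  refine ⟨-⌊x⌋, S (Int.fract x), ?_, le_rfl⟩
  have e : x + ((-⌊x⌋ : ℤ) : ℚ) = Int.fract x := by
    unfold Int.fract; push_cast; ring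
  rw [e]
  by_cases h : Int.fract x = 0
  · rw [h, S_zero]; exact RepCost.zero
  · exact RepCost.single (lt_of_le_of_ne (Int.fract_nonneg x) (Ne.symm h)) (Int.fract_lt_one x)

lemma cheap_vecCost (v : ℤ × ℤ) : Cheap (vecCost v) ((v.1 : ℚ) / v.2) :=
  (cheap_S_fract _).mono (Nat.cast_le.mpr (S_fract_le_fullCost _))

lemma Cheap.exists_repCost {t : ℝ} {x : ℚ} (h : Cheap t x) (h0 : 0 < x) (h1 : x < 1) :
    ∃ n : ℕ, RepCost x n ∧ (n : ℝ) ≤ 3 * t + 4 := by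
  obtain ⟨z, n, hr, hn⟩ := h
  refine ⟨n + 4 * z.natAbs, ?_, ?_⟩
  · have := hr.add (RepCost.intCast (-z))
    simpa using this
  · have ha := hr.abs_le
    have hz : |(z : ℚ)| ≤ n / 2 + 1 := by
      have : (z : ℚ) = (x + z) - x := by ring
      calc |(z : ℚ)| = |(x + z) - x| := by rw [← this]
        _ ≤ |x + z| + |x| := abs_sub _ _
        _ ≤ n / 2 + 1 := by rw [abs_of_pos h0]; linarith
    have hz' : ((z.natAbs : ℕ) : ℝ) ≤ n / 2 + 1 := by
      have h2 : ((z.natAbs : ℕ) : ℚ) ≤ n / 2 + 1 := by rwa [Nat.cast_natAbs, Int.cast_abs]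
      have h3 : 2 * z.natAbs ≤ n + 2 := by
        have : (2 : ℚ) * (z.natAbs : ℕ) ≤ n + 2 := by linarith
        exact_mod_cast this
      have h4 : (2 : ℝ) * (z.natAbs : ℕ) ≤ n + 2 := by exact_mod_cast h3
      linarith
    push_cast
    linarith

/-- The main reduction: modulo two fractions with small denominators,
every fraction with a large prime power denominator has logarithmic cost. -/
def PrimePowerReduction : Prop :=
  ∃ (q₀ : ℕ) (L : ℝ), ∀ q : ℕ, IsPrimePow q → q₀ ≤ q → ∀ b : ℤ,
    ∃ (r₁ r₃ : ℕ) (s₁ s₃ : ℤ), 0 < r₁ ∧ 0 < r₃ ∧ (r₁ * r₃) ^ 4 ≤ q ^ 3 ∧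
      Cheap (L * Real.log q) ((b : ℚ) / q + (s₁ : ℚ) / r₁ + (s₃ : ℚ) / r₃)

lemma exists_cheap_bound_of_lt (q₀ : ℕ) : ∃ M : ℝ, ∀ q : ℕ, 0 < q → q < q₀ → ∀ b : ℤ,
    Cheap M ((b : ℚ) / q) := by
  refine ⟨∑ q ∈ Finset.range q₀, ∑ a ∈ Finset.range q, (S ((a : ℚ) / q) : ℝ), ?_⟩
  intro q hq hq0 b
  have hq' : (q : ℤ) ≠ 0 := by omega
  have hq'' : (q : ℚ) ≠ 0 := by positivity
  set a := (b % q).toNat with ha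
  have ha' : (a : ℤ) = b % q := by rw [ha, Int.toNat_of_nonneg (Int.emod_nonneg _ hq')]
  have haq : a < q := by
    have := Int.emod_lt_of_pos b (by omega : (0 : ℤ) < q)
    omega
  have e : (b : ℚ) / q = (a : ℚ) / q + ((b / q : ℤ) : ℚ) := by
    have := Int.emod_add_mul_ediv b q
    rw [← ha'] at this
    have h2 : (b : ℚ) = a + q * ((b / q : ℤ) : ℚ) := by exact_mod_cast this.symm
    rw [div_add' _ _ _ hq'']
    congr 1
    rw [h2]; ring
  rw [e]
  apply Cheap.add_int
  have hc := cheap_S_fract ((a : ℚ) / q)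
  rw [Int.fract_eq_self.mpr ⟨by positivity, by
    rw [div_lt_one (by positivity)]; exact_mod_cast haq⟩] at hc
  apply hc.mono
  calc (S ((a : ℚ) / q) : ℝ) ≤ ∑ a ∈ Finset.range q, (S ((a : ℚ) / q) : ℝ) :=
        Finset.single_le_sum (f := fun a : ℕ => (S ((a : ℚ) / q) : ℝ))
          (fun _ _ => by positivity) (Finset.mem_range.mpr haq)
    _ ≤ _ := Finset.single_le_sum
          (f := fun q : ℕ => ∑ a ∈ Finset.range q, (S ((a : ℚ) / q) : ℝ))
          (fun _ _ => by positivity) (Finset.mem_range.mpr hq0)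

lemma exists_coprime_factorization {q : ℕ} (hq : 1 < q) (h : ¬ IsPrimePow q) :
    ∃ a b : ℕ, 1 < a ∧ 1 < b ∧ Nat.Coprime a b ∧ q = a * b := by
  set p := q.minFac with hp
  have hpp : p.Prime := Nat.minFac_prime (by omega)
  obtain ⟨n, m, hm, hqm⟩ := Nat.exists_eq_pow_mul_and_not_dvd (n := q) (by omega) p hpp.ne_one
  have hn : n ≠ 0 := by
    rintro rfl
    rw [pow_zero, one_mul] at hqm
    exact hm (hqm ▸ Nat.minFac_dvd q)
  have hm1 : m ≠ 1 := by
    rintro rfl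
    apply h
    rw [hqm, mul_one]
    exact hpp.isPrimePow.pow hn
  have hm0 : m ≠ 0 := by rintro rfl; simp at hm
  exact ⟨p ^ n, m, Nat.one_lt_pow hn hpp.one_lt, by omega,
    Nat.Coprime.pow_left _ ((Nat.Prime.coprime_iff_not_dvd hpp).mpr hm), hqm⟩

lemma PrimePowerReduction.exists_cheap (h : PrimePowerReduction) :
    ∃ C : ℝ, 0 < C ∧ ∀ q : ℕ, 0 < q → ∀ b : ℤ, Cheap (C * Real.log q) ((b : ℚ) / q) := by
  obtain ⟨q₀, L, hmain⟩ := h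
  obtain ⟨M, hM⟩ := exists_cheap_bound_of_lt q₀
  set C : ℝ := 1 + 4 * |L| + |M| / Real.log 2 with hC
  have hlog2 : 0 < Real.log 2 := Real.log_pos (by norm_num)
  have hML : 0 ≤ |M| / Real.log 2 := by positivity
  have hC0 : 0 < C := by positivity
  refine ⟨C, hC0, ?_⟩
  intro q
  induction q using Nat.strong_induction_on with
  | _ q ih =>
  intro hq b
  rcases Nat.lt_or_ge 1 q with hq1 | hq1
  swap
  · have : q = 1 := by omega
    subst this
    have := cheap_S_fract (b : ℚ)
    rw [Int.fract_intCast, S_zero] at this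
    simpa using this
  have hqne : (q : ℚ) ≠ 0 := by positivity
  by_cases hpp : IsPrimePow q
  swap
  · obtain ⟨a, c, ha, hc, hac, rfl⟩ := exists_coprime_factorization hq1 hpp
    have hbez := Nat.gcd_eq_gcd_ab a c
    rw [hac] at hbez
    set x := a.gcdA c
    set y := a.gcdB c
    have ha' : (a : ℚ) ≠ 0 := by positivity
    have hc' : (c : ℚ) ≠ 0 := by positivity
    have e : (b : ℚ) / ((a * c : ℕ) : ℚ) = ((b * y : ℤ) : ℚ) / a + ((b * x : ℤ) : ℚ) / c := by
      have hb : (1 : ℚ) = a * x + c * y := by exact_mod_cast hbez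
      push_cast
      field_simp
      linear_combination (b : ℚ) * hb
    rw [e]
    have h1 := ih a (by nlinarith) (by omega) (b * y)
    have h2 := ih c (by nlinarith) (by omega) (b * x)
    apply (h1.add h2).mono
    push_cast
    rw [Real.log_mul (by positivity) (by positivity)]
    linarith
  have hlogq : Real.log 2 ≤ Real.log q := Real.log_le_log (by norm_num) (by exact_mod_cast hq1)
  rcases Nat.lt_or_ge q q₀ with hqs | hqs
  · apply (hM q hq hqs b).mono
    have h3 : |M| = |M| / Real.log 2 * Real.log 2 := by field_simp
    have h4 : |M| / Real.log 2 * Real.log 2 ≤ |M| / Real.log 2 * Real.log q := by gcongr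
    have h5 : |M| / Real.log 2 * Real.log q ≤ C * Real.log q := by
      gcongr
      rw [hC]
      linarith [abs_nonneg L]
    linarith [le_abs_self M]
  obtain ⟨r₁, r₃, s₁, s₃, hr₁, hr₃, hr, hcheap⟩ := hmain q hpp hqs b
  have hlt : r₁ * r₃ < q := by
    by_contra hcon
    push Not at hcon
    have : q ^ 4 ≤ q ^ 3 := (Nat.pow_le_pow_left hcon 4).trans hr
    have h5 : q ^ 3 < q ^ 4 := Nat.pow_lt_pow_right hq1 (by norm_num)
    omega
  have h1 := (ih r₁ (lt_of_le_of_lt (Nat.le_mul_of_pos_right _ hr₃) hlt) hr₁ s₁).neg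
  have h3 := (ih r₃ (lt_of_le_of_lt (Nat.le_mul_of_pos_left _ hr₁) hlt) hr₃ s₃).neg
  have e : (b : ℚ) / q = ((b : ℚ) / q + (s₁ : ℚ) / r₁ + (s₃ : ℚ) / r₃) + -((s₁ : ℚ) / r₁)
      + -((s₃ : ℚ) / r₃) := by ring
  rw [e]
  apply ((hcheap.add h1).add h3).mono
  have hlog : 4 * (Real.log r₁ + Real.log r₃) ≤ 3 * Real.log q := by
    rw [← Real.log_mul (by positivity) (by positivity)]
    have : ((r₁ * r₃ : ℝ)) ^ 4 ≤ (q : ℝ) ^ 3 := by exact_mod_cast hr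
    have := Real.log_le_log (by positivity) this
    rw [Real.log_pow, Real.log_pow] at this
    exact_mod_cast this
  have hL : 4 * (L * Real.log q) ≤ C * Real.log q := by
    rw [← mul_assoc]
    gcongr
    rw [hC]
    linarith [le_abs_self L]
  have := mul_le_mul_of_nonneg_left hlog hC0.le
  linarith

lemma PrimePowerReduction.statement (h : PrimePowerReduction) :
    ∃ C : ℝ, 0 < C ∧
      ∀ b q : ℕ, 0 < b → b < q → Nat.Coprime b q →
        ∃ n : ℕ, RepCost ((b : ℚ) / q) n ∧ (n : ℝ) ≤ C * Real.log q := by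
  obtain ⟨C, hC, hcheap⟩ := h.exists_cheap
  have hlog2 : 0 < Real.log 2 := Real.log_pos (by norm_num)
  refine ⟨3 * C + 4 / Real.log 2, by positivity, ?_⟩
  intro b q hb hbq _
  have hq : (0 : ℚ) < q := by exact_mod_cast (by omega : 0 < q)
  obtain ⟨n, hn, hle⟩ := (hcheap q (by omega) b).exists_repCost
    (x := ((b : ℤ) : ℚ) / q) (by positivity)
    (by rw [div_lt_one hq]; exact_mod_cast hbq)
  refine ⟨n, by simpa using hn, hle.trans ?_⟩
  have hlogq : Real.log 2 ≤ Real.log q := Real.log_le_log (by norm_num) (by exact_mod_cast (by omega : 2 ≤ q))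
  have h4 : (4 : ℝ) ≤ 4 / Real.log 2 * Real.log q := by
    calc (4 : ℝ) = 4 / Real.log 2 * Real.log 2 := by field_simp
      _ ≤ _ := by gcongr
  linarith

lemma card_not_coprime_le (N : ℕ) :
    ((((Finset.Icc 1 N) ×ˢ (Finset.Icc 1 N)).filter fun x : ℕ × ℕ => ¬ Nat.Coprime x.1 x.2).card : ℝ)
      ≤ 3 / 4 * (N : ℝ) ^ 2 := by
  have hsub : (((Finset.Icc 1 N) ×ˢ (Finset.Icc 1 N)).filter
      fun x : ℕ × ℕ => ¬ Nat.Coprime x.1 x.2) ⊆ (Finset.Icc 2 N).biUnion fun d =>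
        ((Finset.Icc 1 N).filter (d ∣ ·)) ×ˢ ((Finset.Icc 1 N).filter (d ∣ ·)) := by
    rintro ⟨a, b⟩ h
    simp only [Finset.mem_filter, Finset.mem_product, Finset.mem_Icc, Finset.mem_biUnion] at h ⊢
    obtain ⟨⟨ha, hb⟩, hc⟩ := h
    have hg : a.gcd b ≠ 1 := hc
    have hg0 : 0 < a.gcd b := Nat.gcd_pos_of_pos_left _ (by omega)
    have hga : a.gcd b ∣ a := Nat.gcd_dvd_left a b
    have := Nat.le_of_dvd (by omega) hga
    exact ⟨a.gcd b, ⟨by omega, by omega⟩, ⟨ha, hga⟩, hb, Nat.gcd_dvd_right a b⟩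
  have hcard : ∀ d ∈ Finset.Icc 2 N, ((((Finset.Icc 1 N).filter (d ∣ ·)) ×ˢ
      ((Finset.Icc 1 N).filter (d ∣ ·))).card : ℝ) ≤ (N : ℝ) ^ 2 * ((d : ℝ) ^ 2)⁻¹ := by
    intro d hd
    have hd2 := (Finset.mem_Icc.mp hd).1
    have h1 : ((Finset.Icc 1 N).filter (d ∣ ·)).card = N / d := by
      have := Nat.Ioc_filter_dvd_card_eq_div N d
      convert this using 2
      ext x; simp; omega
    rw [Finset.card_product, h1]
    push_cast
    have h2 : ((N / d : ℕ) : ℝ) ≤ N / d := Nat.cast_div_le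
    calc ((N / d : ℕ) : ℝ) * ((N / d : ℕ) : ℝ) ≤ (N / d) * (N / d) := by gcongr
      _ = _ := by rw [← sq, div_pow, div_eq_mul_inv]
  calc _ ≤ (((Finset.Icc 2 N).biUnion fun d =>
        ((Finset.Icc 1 N).filter (d ∣ ·)) ×ˢ ((Finset.Icc 1 N).filter (d ∣ ·))).card : ℝ) := by
        exact_mod_cast Finset.card_le_card hsub
    _ ≤ ∑ d ∈ Finset.Icc 2 N, ((((Finset.Icc 1 N).filter (d ∣ ·)) ×ˢ
      ((Finset.Icc 1 N).filter (d ∣ ·))).card : ℝ) := by exact_mod_cast Finset.card_biUnion_le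
    _ ≤ ∑ d ∈ Finset.Icc 2 N, (N : ℝ) ^ 2 * ((d : ℝ) ^ 2)⁻¹ := Finset.sum_le_sum hcard
    _ = (N : ℝ) ^ 2 * ∑ d ∈ Finset.Icc 2 N, ((d : ℝ) ^ 2)⁻¹ := by rw [Finset.mul_sum]
    _ ≤ (N : ℝ) ^ 2 * (3 / 4) := by
        gcongr
        rcases Nat.lt_or_ge N 2 with h | h
        · rw [Finset.Icc_eq_empty (by omega)]; norm_num
        · have e : Finset.Icc 2 N = insert 2 (Finset.Ioc 2 N) := by
            ext x; simp; omega
          rw [e, Finset.sum_insert (by simp)]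
          have := sum_Ioc_inv_sq_le_sub (α := ℝ) (k := 2) (n := N) (by norm_num) h
          have h3 : (0 : ℝ) ≤ (N : ℝ)⁻¹ := by positivity
          push_cast at this ⊢
          norm_num at this ⊢
          linarith
    _ = _ := by ring

/-- Coprime pairs `(s, r)` with `r ≤ s ≤ 64 n` and `16 n < s`. -/
def seedPairs (n : ℕ) : Finset (ℕ × ℕ) :=
  ((Finset.Icc 1 (64 * n)) ×ˢ (Finset.Icc 1 (64 * n))).filter
    fun x => Nat.Coprime x.1 x.2 ∧ x.2 ≤ x.1 ∧ 16 * n < x.1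

lemma card_seedPairs (n : ℕ) : 256 * n ^ 2 ≤ (seedPairs n).card := by
  classical
  set B := (Finset.Icc 1 (64 * n)) ×ˢ (Finset.Icc 1 (64 * n)) with hB
  set U := B.filter fun x => Nat.Coprime x.1 x.2 with hU
  set V := U.filter fun x => x.2 ≤ x.1 with hV
  have hBc : B.card = (64 * n) ^ 2 := by rw [hB, Finset.card_product]; simp; ring
  have h1 : 1024 * n ^ 2 ≤ U.card := by
    have h2 := card_not_coprime_le (64 * n)
    have h3 := Finset.card_filter_add_card_filter_not (s := B) fun x : ℕ × ℕ => Nat.Coprime x.1 x.2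
    rw [← hB] at h2
    rw [hBc, ← hU] at h3
    have h4 : 4 * (B.filter fun x : ℕ × ℕ => ¬ Nat.Coprime x.1 x.2).card ≤ 3 * (64 * n) ^ 2 := by
      have : (4 : ℝ) * (B.filter fun x : ℕ × ℕ => ¬ Nat.Coprime x.1 x.2).card
        ≤ 3 * ((64 * n : ℕ) : ℝ) ^ 2 := by linarith
      exact_mod_cast this
    nlinarith
  have h2 : U.card ≤ 2 * V.card := by
    have h3 := Finset.card_filter_add_card_filter_not (s := U) fun x : ℕ × ℕ => x.2 ≤ x.1
    have h4 : (U.filter fun x => ¬ x.2 ≤ x.1).card ≤ V.card := by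
      apply Finset.card_le_card_of_injOn Prod.swap
      · rintro ⟨a, b⟩ h
        simp only [hV, hU, hB, Finset.coe_filter, Finset.mem_filter, Finset.mem_product,
          Finset.mem_Icc, Set.mem_ofPred_eq, Prod.swap] at h ⊢
        exact ⟨⟨⟨h.1.1.2, h.1.1.1⟩, h.1.2.symm⟩, by omega⟩
      · exact Prod.swap_injective.injOn
    rw [← hV] at h3
    omega
  have h3 : V.card ≤ (seedPairs n).card + 256 * n ^ 2 := by
    have h4 := Finset.card_filter_add_card_filter_not (s := V) fun x : ℕ × ℕ => 16 * n < x.1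
    have h5 : V.filter (fun x : ℕ × ℕ => 16 * n < x.1) = seedPairs n := by
      rw [hV, hU, Finset.filter_filter, Finset.filter_filter]
      unfold seedPairs
      congr 1
    have h6 : (V.filter fun x : ℕ × ℕ => ¬ 16 * n < x.1).card ≤
        ((Finset.Icc 1 (16 * n)) ×ˢ (Finset.Icc 1 (16 * n))).card := by
      apply Finset.card_le_card
      rintro ⟨a, b⟩ h
      simp only [hV, hU, hB, Finset.mem_filter, Finset.mem_product, Finset.mem_Icc] at h ⊢
      omega
    have h7 : ((Finset.Icc 1 (16 * n)) ×ˢ (Finset.Icc 1 (16 * n))).card = 256 * n ^ 2 := by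
      rw [Finset.card_product]; simp; ring
    rw [h5] at h4
    omega
  omega

lemma exists_block (s r : ℕ) (hr : 1 ≤ r) (hrs : r ≤ s) (h : Nat.Coprime s r) :
    ∃ g : SLTwo, g 1 1 = s ∧ g 1 0 = r + s ∧ s ≤ g 0 1 ∧ g 0 1 < 2 * s ∧ s ≤ g 0 0 ∧
      g 0 0 ≤ 5 * s := by
  have hs : (0 : ℤ) < s := by omega
  have hbez := Nat.gcd_eq_gcd_ab s r
  rw [h] at hbez
  set y := s.gcdB r
  set x := s.gcdA r
  set t : ℤ := (-y) % s with ht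
  have ht0 : 0 ≤ t := Int.emod_nonneg _ hs.ne'
  have hts : t < s := Int.emod_lt_of_pos _ hs
  obtain ⟨c, hc⟩ : ∃ c : ℤ, t = -y - s * c := ⟨(-y) / s, by
    have := Int.emod_add_mul_ediv (-y) s; rw [ht]; linarith⟩
  set P : ℤ := x - c * r + t + r + s with hP
  have hdet : P * s - (t + s) * (r + s) = 1 := by
    rw [hP, hc]
    push_cast at hbez
    linear_combination -hbez
  refine ⟨⟨!![P, t + s; (r : ℤ) + s, (s : ℤ)], by rw [Matrix.det_fin_two_of]; exact hdet⟩,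
    by simp, by simp, by simp; omega, by simp; omega, ?_, ?_⟩
  · simp only [Matrix.of_apply, Matrix.cons_val', Matrix.cons_val_zero,
      Matrix.cons_val_fin_one]
    nlinarith
  · simp only [Matrix.of_apply, Matrix.cons_val', Matrix.cons_val_zero,
      Matrix.cons_val_fin_one]
    by_contra hcon
    push Not at hcon
    have h1 : (t + s) * (r + s) ≤ (2 * s - 1) * (2 * s) := by
      apply mul_le_mul <;> omega
    nlinarith

/-- Vectors whose coordinates are both positive. -/
def PosVec (v : ℤ × ℤ) : Prop := 0 < v.1 ∧ 0 < v.2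

/-- Vectors whose coordinates have strictly opposite signs. -/
def OppVec (v : ℤ × ℤ) : Prop := v.1 * v.2 < 0

/-- A set of matrices generating a free monoid by ping-pong on both sides. -/
structure BlockSystem (K : Finset SLTwo) (Y : ℕ) : Prop where
  lower : ∀ b ∈ K, ∀ i j, (Y : ℤ) ≤ 40 * b i j
  upper : ∀ b ∈ K, ∀ i j, 2 * b i j ≤ Y
  card_le : Y ^ 2 ≤ 409600 * K.card
  pre : ∀ b ∈ K, ∀ b' ∈ K, b ≠ b' → ∀ v, PosVec v → OppVec (act (b⁻¹ * b') v)
  suf : ∀ b ∈ K, ∀ b' ∈ K, b ≠ b' → ∀ v, OppVec v → ¬ OppVec (act (b * b'⁻¹) v)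

lemma mul_neg_of_det_one {x y z w : ℤ} (h : x * w - y * z = 1) (hxz : x * z ≤ 0) (hyw : y * w ≤ 0)
    (hxy : 0 ≤ x * y) (hzw : 0 ≤ z * w) (hne : ¬ (x = 1 ∧ y = 0 ∧ z = 0 ∧ w = 1))
    (hne' : ¬ (x = -1 ∧ y = 0 ∧ z = 0 ∧ w = -1)) : y * z < 0 := by
  by_contra hcon
  push Not at hcon
  have hxw : 1 ≤ x * w := by linarith
  rcases lt_trichotomy x 0 with hx | hx | hx
  · have hw : w < 0 := by nlinarith
    have hz : z = 0 := by nlinarith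
    have hy : y = 0 := by nlinarith
    subst hz hy
    apply hne'
    refine ⟨?_, rfl, rfl, ?_⟩ <;> nlinarith
  · subst hx; simp at hxw
  · have hw : 0 < w := by nlinarith
    have hz : z = 0 := by nlinarith
    have hy : y = 0 := by nlinarith
    subst hz hy
    apply hne
    refine ⟨?_, rfl, rfl, ?_⟩ <;> nlinarith

lemma mul_nonpos_of_combination {x z a b c : ℤ} (ha : 0 < a) (hb : 0 < b)
    (hc : c = x * a + z * b) (hc0 : 0 < c) (hcl : c < a + b) : x * z ≤ 0 := by
  by_contra hcon
  push Not at hcon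
  rcases lt_trichotomy x 0 with hx | hx | hx
  · have hz : z < 0 := by nlinarith
    nlinarith
  · subst hx; simp at hcon
  · have hz : 0 < z := by nlinarith
    nlinarith

lemma mul_entries (g h : SLTwo) (i j : Fin 2) :
    (g * h) i j = g i 0 * h 0 j + g i 1 * h 1 j := by
  simp [Matrix.SpecialLinearGroup.coe_mul, Matrix.mul_apply, Fin.sum_univ_two]

lemma inv_entries (g : SLTwo) :
    g⁻¹ 0 0 = g 1 1 ∧ g⁻¹ 0 1 = -g 0 1 ∧ g⁻¹ 1 0 = -g 1 0 ∧ g⁻¹ 1 1 = g 0 0 := by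
  simp [Matrix.SpecialLinearGroup.coe_inv, Matrix.adjugate_fin_two]

lemma SLTwo.ext_entries {g h : SLTwo} (h00 : g 0 0 = h 0 0) (h01 : g 0 1 = h 0 1)
    (h10 : g 1 0 = h 1 0) (h11 : g 1 1 = h 1 1) : g = h := by
  ext i j
  fin_cases i <;> fin_cases j <;> assumption

lemma oppVec_of_row_bounds {b b' : SLTwo} (hb : ∀ i j, 0 < b i j) (hb' : ∀ i j, 0 < b' i j)
    (h : ∀ j, b' 1 j < b 1 0 + b 1 1) (h' : ∀ j, b 1 j < b' 1 0 + b' 1 1) (hne : b ≠ b')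
    {v : ℤ × ℤ} (hv : PosVec v) : OppVec (act (b⁻¹ * b') v) := by
  obtain ⟨M, hM⟩ : ∃ M : SLTwo, M = b⁻¹ * b' := ⟨_, rfl⟩
  rw [← hM]
  have e1 : b' = b * M := by rw [hM]; group
  have e2 : b = b' * M⁻¹ := by rw [e1]; group
  obtain ⟨i00, i01, i10, i11⟩ := inv_entries M
  have h10 : b' 1 0 = M 0 0 * b 1 0 + M 1 0 * b 1 1 := by
    rw [congrFun (congrFun (congrArg Subtype.val e1) 1) 0]
    exact (mul_entries b M 1 0).trans (by ring)
  have h11 : b' 1 1 = M 0 1 * b 1 0 + M 1 1 * b 1 1 := by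
    rw [congrFun (congrFun (congrArg Subtype.val e1) 1) 1]
    exact (mul_entries b M 1 1).trans (by ring)
  have k10 : b 1 0 = M 1 1 * b' 1 0 + (-M 1 0) * b' 1 1 := by
    have := congrFun (congrFun (congrArg Subtype.val e2) 1) 0
    exact this.trans ((mul_entries b' M⁻¹ 1 0).trans (by rw [i00, i10]; ring))
  have k11 : b 1 1 = (-M 0 1) * b' 1 0 + M 0 0 * b' 1 1 := by
    have := congrFun (congrFun (congrArg Subtype.val e2) 1) 1
    exact this.trans ((mul_entries b' M⁻¹ 1 1).trans (by rw [i01, i11]; ring))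
  have c1 := mul_nonpos_of_combination (hb 1 0) (hb 1 1) h10 (hb' 1 0) (h 0)
  have c2 := mul_nonpos_of_combination (hb 1 0) (hb 1 1) h11 (hb' 1 1) (h 1)
  have c3 := mul_nonpos_of_combination (hb' 1 0) (hb' 1 1) k10 (hb 1 0) (h' 0)
  have c4 := mul_nonpos_of_combination (hb' 1 0) (hb' 1 1) k11 (hb 1 1) (h' 1)
  have hdet := det_entries M
  have key : M 0 1 * M 1 0 < 0 := by
    apply mul_neg_of_det_one hdet c1 c2 (by linarith) (by linarith)
    · rintro ⟨m1, m2, m3, m4⟩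
      apply hne
      have : M = 1 := by
        apply SLTwo.ext_entries <;> simp [m1, m2, m3, m4]
      rw [e1, this, mul_one]
    · rintro ⟨m1, m2, m3, m4⟩
      rw [m2, m4] at h11
      linarith [hb 1 1, hb' 1 1]
  obtain ⟨v1, v2⟩ := hv
  have hvv := mul_pos v1 v2
  unfold OppVec act
  simp only
  have : (M 0 0 * v.1 + M 0 1 * v.2) * (M 1 0 * v.1 + M 1 1 * v.2) =
      (M 0 0 * M 1 0) * v.1 ^ 2 + (1 + 2 * (M 0 1 * M 1 0)) * (v.1 * v.2)
        + (M 0 1 * M 1 1) * v.2 ^ 2 := by linear_combination (v.1 * v.2) * hdet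
  rw [this]
  have t1 := mul_nonneg (neg_nonneg.mpr c1) (sq_nonneg v.1)
  have t2 := mul_nonneg (neg_nonneg.mpr c2) (sq_nonneg v.2)
  nlinarith

lemma not_oppVec_of_column_bounds {b b' : SLTwo} (hb : ∀ i j, 0 < b i j) (hb' : ∀ i j, 0 < b' i j)
    (h : ∀ i, b' i 1 < b 0 1 + b 1 1) (h' : ∀ i, b i 1 < b' 0 1 + b' 1 1) (hne : b ≠ b')
    {v : ℤ × ℤ} (hv : OppVec v) : ¬ OppVec (act (b * b'⁻¹) v) := by
  obtain ⟨M, hM⟩ : ∃ M : SLTwo, M = b * b'⁻¹ := ⟨_, rfl⟩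
  rw [← hM]
  have e1 : b = M * b' := by rw [hM]; group
  have e2 : b' = M⁻¹ * b := by rw [e1]; group
  obtain ⟨i00, i01, i10, i11⟩ := inv_entries M
  have h01 : b 0 1 = M 0 0 * b' 0 1 + M 0 1 * b' 1 1 :=
    (congrFun (congrFun (congrArg Subtype.val e1) 0) 1).trans (mul_entries M b' 0 1)
  have h11 : b 1 1 = M 1 0 * b' 0 1 + M 1 1 * b' 1 1 :=
    (congrFun (congrFun (congrArg Subtype.val e1) 1) 1).trans (mul_entries M b' 1 1)
  have k01 : b' 0 1 = M 1 1 * b 0 1 + (-M 0 1) * b 1 1 :=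
    (congrFun (congrFun (congrArg Subtype.val e2) 0) 1).trans
      ((mul_entries M⁻¹ b 0 1).trans (by rw [i00, i01]))
  have k11 : b' 1 1 = (-M 1 0) * b 0 1 + M 0 0 * b 1 1 :=
    (congrFun (congrFun (congrArg Subtype.val e2) 1) 1).trans
      ((mul_entries M⁻¹ b 1 1).trans (by rw [i10, i11]))
  have c1 := mul_nonpos_of_combination (hb' 0 1) (hb' 1 1) h01 (hb 0 1) (h' 0)
  have c2 := mul_nonpos_of_combination (hb' 0 1) (hb' 1 1) h11 (hb 1 1) (h' 1)
  have c3 := mul_nonpos_of_combination (hb 0 1) (hb 1 1) k01 (hb' 0 1) (h 0)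
  have c4 := mul_nonpos_of_combination (hb 0 1) (hb 1 1) k11 (hb' 1 1) (h 1)
  have hdet := det_entries M
  have key : M 1 0 * M 0 1 < 0 := by
    apply mul_neg_of_det_one (x := M 0 0) (w := M 1 1) (by linarith) c1 c2 (by linarith)
      (by linarith)
    · rintro ⟨m1, m2, m3, m4⟩
      apply hne
      have : M = 1 := by
        apply SLTwo.ext_entries <;> simp [m1, m2, m3, m4]
      rw [e1, this, one_mul]
    · rintro ⟨m1, m2, m3, m4⟩
      rw [m2, m4] at h11
      linarith [hb 1 1, hb' 1 1]
  unfold OppVec at hv ⊢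
  unfold act
  simp only
  have : (M 0 0 * v.1 + M 0 1 * v.2) * (M 1 0 * v.1 + M 1 1 * v.2) =
      (M 0 0 * M 1 0) * v.1 ^ 2 + (1 + 2 * (M 1 0 * M 0 1)) * (v.1 * v.2)
        + (M 0 1 * M 1 1) * v.2 ^ 2 := by linear_combination (v.1 * v.2) * hdet
  rw [this]
  have d3 : 0 ≤ M 0 0 * M 1 0 := by linarith
  have d4 : 0 ≤ M 0 1 * M 1 1 := by linarith
  have t1 := mul_nonneg d3 (sq_nonneg v.1)
  have t2 := mul_nonneg d4 (sq_nonneg v.2)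
  nlinarith

lemma exists_blockSystem (n : ℕ) (hn : 0 < n) :
    ∃ K : Finset SLTwo, BlockSystem K (640 * n) := by
  classical
  choose! f hf using exists_block
  have hf' : ∀ x ∈ seedPairs n, 16 * n < x.1 ∧ x.1 ≤ 64 * n ∧ 1 ≤ x.2 ∧ x.2 ≤ x.1 ∧
      f x.1 x.2 1 1 = x.1 ∧ f x.1 x.2 1 0 = x.2 + x.1 ∧ x.1 ≤ f x.1 x.2 0 1 ∧
      f x.1 x.2 0 1 < 2 * x.1 ∧ x.1 ≤ f x.1 x.2 0 0 ∧ f x.1 x.2 0 0 ≤ 5 * x.1 := by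
    rintro ⟨s, r⟩ h
    simp only [seedPairs, Finset.mem_filter, Finset.mem_product, Finset.mem_Icc] at h
    exact ⟨h.2.2.2, h.1.1.2, h.1.2.1, h.2.2.1, hf s r h.1.2.1 h.2.2.1 h.2.1⟩
  have hinj : Set.InjOn (fun x : ℕ × ℕ => f x.1 x.2) (seedPairs n) := by
    rintro ⟨s, r⟩ h ⟨s', r'⟩ h' e
    have h1 := hf' _ h
    have h2 := hf' _ h'
    simp only at e h1 h2
    rw [e] at h1
    have : s = s' := by omega
    subst this
    have : r = r' := by omega
    subst this
    rfl
  obtain ⟨c, hc⟩ : ∃ c : ℕ × ℕ → ℕ × Bool × Bool, c = fun x =>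
    ((x.1 - 1) / n, decide (2 * x.2 < x.1), decide (2 * f x.1 x.2 0 1 < 3 * x.1)) := ⟨_, rfl⟩
  obtain ⟨T, hT⟩ : ∃ T : Finset (ℕ × Bool × Bool), T = Finset.range 64 ×ˢ Finset.univ := ⟨_, rfl⟩
  have hTc : T.card = 256 := by rw [hT, Finset.card_product]; simp
  have hmaps : ∀ x ∈ seedPairs n, c x ∈ T := by
    intro x hx
    have h1 := hf' x hx
    simp only [hT, hc, Finset.mem_product, Finset.mem_range, Finset.mem_univ, and_true]
    rw [Nat.div_lt_iff_lt_mul hn]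
    omega
  have hTn : T.card * n ^ 2 ≤ (seedPairs n).card := by rw [hTc]; exact card_seedPairs n
  have hTne : T.Nonempty := by rw [← Finset.card_pos, hTc]; exact Nat.succ_pos 255
  obtain ⟨y, hy, hcard⟩ := Finset.exists_le_card_fiber_of_mul_le_card_of_maps_to
    (s := seedPairs n) (t := T) (f := c) (n := n ^ 2) hmaps hTne hTn
  set F := (seedPairs n).filter fun x => c x = y with hF
  have hsub : F ⊆ seedPairs n := Finset.filter_subset _ _
  have hcmp : ∀ x ∈ F, ∀ x' ∈ F,
      (∀ j, f x'.1 x'.2 1 j < f x.1 x.2 1 0 + f x.1 x.2 1 1) ∧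
      (∀ i, f x'.1 x'.2 i 1 < f x.1 x.2 0 1 + f x.1 x.2 1 1) := by
    intro x hx x' hx'
    have h1 := hf' x (hsub hx)
    have h2 := hf' x' (hsub hx')
    have hcc : c x' = c x := by
      rw [(Finset.mem_filter.mp hx).2, (Finset.mem_filter.mp hx').2]
    simp only [hc, Prod.mk.injEq, decide_eq_decide] at hcc
    obtain ⟨w1, w2, w3⟩ := hcc
    obtain ⟨i, hi⟩ : ∃ i, (x.1 - 1) / n = i := ⟨_, rfl⟩
    rw [hi] at w1
    have a1 : i * n ≤ x.1 - 1 := by rw [← hi]; exact Nat.div_mul_le_self _ _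
    have a2 : x'.1 - 1 < (i + 1) * n := by
      rw [← w1]; exact Nat.lt_mul_of_div_lt (Nat.lt_succ_self _) hn
    have a3 : 16 ≤ i := by
      rw [← hi, Nat.le_div_iff_mul_le hn]; omega
    have a4 : 16 * x'.1 < 17 * x.1 := by
      have : 16 * ((i + 1) * n) ≤ 17 * (i * n) := by nlinarith
      omega
    constructor <;> intro j <;> fin_cases j <;> simp only [Fin.zero_eta, Fin.mk_one] <;> omega
  have hpos : ∀ x ∈ F, ∀ i j, (16 * n : ℤ) ≤ f x.1 x.2 i j ∧ f x.1 x.2 i j ≤ 320 * n := by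
    intro x hx i j
    have h1 := hf' x (hsub hx)
    fin_cases i <;> fin_cases j <;> simp only [Fin.zero_eta, Fin.mk_one] <;> omega
  refine ⟨F.image fun x => f x.1 x.2, ?_, ?_, ?_, ?_, ?_⟩
  · intro b hb i j
    obtain ⟨x, hx, rfl⟩ := Finset.mem_image.mp hb
    have := hpos x hx i j
    push_cast; omega
  · intro b hb i j
    obtain ⟨x, hx, rfl⟩ := Finset.mem_image.mp hb
    have := hpos x hx i j
    push_cast; omega
  · rw [Finset.card_image_of_injOn (hinj.mono (by exact_mod_cast hsub))]
    calc (640 * n) ^ 2 = 409600 * n ^ 2 := by ring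
      _ ≤ _ := by gcongr
  · intro b hb b' hb' hne v hv
    obtain ⟨x, hx, rfl⟩ := Finset.mem_image.mp hb
    obtain ⟨x', hx', rfl⟩ := Finset.mem_image.mp hb'
    refine oppVec_of_row_bounds ?_ ?_ (hcmp x hx x' hx').1 (hcmp x' hx' x hx).1 hne hv
    · intro i j; have := hpos x hx i j; omega
    · intro i j; have := hpos x' hx' i j; omega
  · intro b hb b' hb' hne v hv
    obtain ⟨x, hx, rfl⟩ := Finset.mem_image.mp hb
    obtain ⟨x', hx', rfl⟩ := Finset.mem_image.mp hb'
    refine not_oppVec_of_column_bounds ?_ ?_ (hcmp x hx x' hx').2 (hcmp x' hx' x hx).2 hne hv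
    · intro i j; have := hpos x hx i j; omega
    · intro i j; have := hpos x' hx' i j; omega

/-- The determinant of two integer vectors. -/
def cross (v w : ℤ × ℤ) : ℤ := v.1 * w.2 - v.2 * w.1

lemma cross_act (g : SLTwo) (v w : ℤ × ℤ) : cross (act g v) (act g w) = cross v w := by
  unfold cross act
  simp only
  linear_combination (v.1 * w.2 - v.2 * w.1) * det_entries g

lemma cross_swap (v w : ℤ × ℤ) : cross v w = -cross w v := by
  unfold cross; ring

/-- Products of `k` elements of `K`. -/
def words (K : Finset SLTwo) : ℕ → Finset SLTwo
  | 0 => {1}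
  | k + 1 => (K ×ˢ words K k).image fun x => x.1 * x.2

lemma mem_words_succ {K : Finset SLTwo} {k : ℕ} {w : SLTwo} :
    w ∈ words K (k + 1) ↔ ∃ b ∈ K, ∃ u ∈ words K k, b * u = w := by
  simp only [words, Finset.mem_image, Finset.mem_product, Prod.exists]
  constructor
  · rintro ⟨a, b, ⟨ha, hb⟩, rfl⟩; exact ⟨a, ha, b, hb, rfl⟩
  · rintro ⟨a, ha, b, hb, rfl⟩; exact ⟨a, b, ⟨ha, hb⟩, rfl⟩

lemma mem_words_add {K : Finset SLTwo} {j k : ℕ} {w : SLTwo} :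
    w ∈ words K (j + k) ↔ ∃ h ∈ words K j, ∃ u ∈ words K k, h * u = w := by
  induction j generalizing w with
  | zero => simp [words]
  | succ j ih =>
    rw [show j + 1 + k = (j + k) + 1 by ring, mem_words_succ]
    constructor
    · rintro ⟨b, hb, x, hx, rfl⟩
      obtain ⟨h, hh, u, hu, rfl⟩ := ih.mp hx
      exact ⟨b * h, mem_words_succ.mpr ⟨b, hb, h, hh, rfl⟩, u, hu, by group⟩
    · rintro ⟨x, hx, u, hu, rfl⟩
      obtain ⟨b, hb, h, hh, rfl⟩ := mem_words_succ.mp hx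
      exact ⟨b, hb, h * u, ih.mpr ⟨h, hh, u, hu, rfl⟩, by group⟩

lemma exists_words_vecCost_le (K : Finset SLTwo) : ∃ L : ℕ, ∀ k, ∀ w ∈ words K k, ∀ v,
    vecCost (act w v) ≤ vecCost v + k * L ∧ vecCost v ≤ vecCost (act w v) + k * L := by
  choose f hf using exists_act_vecCost_le
  refine ⟨∑ b ∈ K, f b, fun k => ?_⟩
  induction k with
  | zero =>
    intro w hw v
    have : w = 1 := by simpa [words] using hw
    rw [this, act_one]; simp
  | succ k ih =>
    intro w hw v
    obtain ⟨b, hb, u, hu, rfl⟩ := mem_words_succ.mp hw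
    have h1 := hf b (act u v)
    have h2 := ih u hu v
    have h3 : f b ≤ ∑ b ∈ K, f b := Finset.single_le_sum (fun _ _ => Nat.zero_le _) hb
    rw [act_mul]
    have e : (k + 1) * ∑ b ∈ K, f b = k * ∑ b ∈ K, f b + ∑ b ∈ K, f b := by ring
    omega

lemma oppVec_act_inv {b : SLTwo} (hb : ∀ i j, 0 ≤ b i j) {v : ℤ × ℤ} (hv : OppVec v) :
    OppVec (act b⁻¹ v) := by
  have h00 := hb 0 0
  have h01 := hb 0 1
  have h10 := hb 1 0
  have h11 := hb 1 1
  have hdet := det_entries b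
  unfold OppVec at hv ⊢
  rw [act_inv]
  simp only
  have e : (b 1 1 * v.1 - b 0 1 * v.2) * (-b 1 0 * v.1 + b 0 0 * v.2) =
      -(b 1 1 * b 1 0 * v.1 ^ 2) + (1 + 2 * (b 0 1 * b 1 0)) * (v.1 * v.2)
        - b 0 1 * b 0 0 * v.2 ^ 2 := by linear_combination (v.1 * v.2) * hdet
  rw [e]
  have t1 : 0 ≤ b 1 1 * b 1 0 * v.1 ^ 2 := by positivity
  have t2 : 0 ≤ b 0 1 * b 0 0 * v.2 ^ 2 := by positivity
  have t3 : 0 ≤ b 0 1 * b 1 0 := by positivity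
  nlinarith

/-- Supremum norm bound. -/
def InBox (B : ℤ) (v : ℤ × ℤ) : Prop := |v.1| ≤ B ∧ |v.2| ≤ B

namespace BlockSystem

variable {K : Finset SLTwo} {Y : ℕ}

lemma entry_pos (hK : BlockSystem K Y) (hY : 0 < Y) {b : SLTwo} (hb : b ∈ K) (i j : Fin 2) :
    0 < b i j := by
  have := hK.lower b hb i j
  omega

lemma words_nonneg (hK : BlockSystem K Y) (hY : 0 < Y) {k : ℕ} {w : SLTwo} (hw : w ∈ words K k)
    (i j : Fin 2) : 0 ≤ w i j := by
  induction k generalizing w i j with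
  | zero =>
    have : w = 1 := by simpa [words] using hw
    subst this
    fin_cases i <;> fin_cases j <;> simp
  | succ k ih =>
    obtain ⟨b, hb, u, hu, rfl⟩ := mem_words_succ.mp hw
    rw [mul_entries]
    have := fun i j => (hK.entry_pos hY hb i j).le
    exact add_nonneg (mul_nonneg (this _ _) (ih hu _ _)) (mul_nonneg (this _ _) (ih hu _ _))

lemma words_bounds (hK : BlockSystem K Y) (hY : 0 < Y) {k : ℕ} {w : SLTwo} (hw : w ∈ words K k)
    {B : ℤ} {v : ℤ × ℤ} (h1 : 1 ≤ v.1) (h2 : 1 ≤ v.2) (hB : InBox B v) :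
    ((Y : ℤ) ^ k ≤ 20 ^ k * (act w v).1 ∧ (Y : ℤ) ^ k ≤ 20 ^ k * (act w v).2) ∧
      InBox (Y ^ k * B) (act w v) := by
  induction k generalizing w with
  | zero =>
    have : w = 1 := by simpa [words] using hw
    subst this
    rw [act_one]; simpa using ⟨⟨h1, h2⟩, hB⟩
  | succ k ih =>
    obtain ⟨b, hb, u, hu, rfl⟩ := mem_words_succ.mp hw
    rw [act_mul]
    obtain ⟨⟨i1, i2⟩, i3, i4⟩ := ih hu
    set x := act u v
    have hYk : (0 : ℤ) < Y ^ k := by positivity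
    have hx1 : 0 < x.1 := by
      by_contra hcon
      push Not at hcon
      have : (20 : ℤ) ^ k * x.1 ≤ 0 := mul_nonpos_of_nonneg_of_nonpos (by positivity) hcon
      linarith
    have hx2 : 0 < x.2 := by
      by_contra hcon
      push Not at hcon
      have : (20 : ℤ) ^ k * x.2 ≤ 0 := mul_nonpos_of_nonneg_of_nonpos (by positivity) hcon
      linarith
    rw [abs_of_pos hx1] at i3
    rw [abs_of_pos hx2] at i4
    have low : ∀ i, (Y : ℤ) ^ (k + 1) ≤ 20 ^ (k + 1) * (b i 0 * x.1 + b i 1 * x.2) := by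
      intro i
      have l0 := hK.lower b hb i 0
      have l1 := hK.lower b hb i 1
      have e : (20 : ℤ) ^ (k + 1) * (b i 0 * x.1 + b i 1 * x.2) =
        (20 * b i 0) * (20 ^ k * x.1) + (20 * b i 1) * (20 ^ k * x.2) := by ring
      rw [e]
      have m1 : (20 * b i 0) * (Y : ℤ) ^ k ≤ (20 * b i 0) * (20 ^ k * x.1) :=
        mul_le_mul_of_nonneg_left i1 (by have := hK.entry_pos hY hb i 0; omega)
      have m2 : (20 * b i 1) * (Y : ℤ) ^ k ≤ (20 * b i 1) * (20 ^ k * x.2) :=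
        mul_le_mul_of_nonneg_left i2 (by have := hK.entry_pos hY hb i 1; omega)
      have m3 : (Y : ℤ) * Y ^ k ≤ (20 * b i 0 + 20 * b i 1) * Y ^ k :=
        mul_le_mul_of_nonneg_right (by linarith) hYk.le
      rw [pow_succ']
      linarith
    have up : ∀ i, |b i 0 * x.1 + b i 1 * x.2| ≤ Y ^ (k + 1) * B := by
      intro i
      have p0 := hK.entry_pos hY hb i 0
      have p1 := hK.entry_pos hY hb i 1
      have u0 := hK.upper b hb i 0
      have u1 := hK.upper b hb i 1
      rw [abs_of_nonneg (by positivity)]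
      have m1 := mul_le_mul_of_nonneg_left i3 p0.le
      have m2 := mul_le_mul_of_nonneg_left i4 p1.le
      have hB' : 0 ≤ (Y : ℤ) ^ k * B := by linarith
      have m3 := mul_le_mul_of_nonneg_right (by linarith : b i 0 + b i 1 ≤ Y) hB'
      have e : (Y : ℤ) ^ (k + 1) * B = Y * (Y ^ k * B) := by ring
      rw [e]
      linarith
    exact ⟨⟨low 0, low 1⟩, up 0, up 1⟩

lemma posVec_act (hK : BlockSystem K Y) (hY : 0 < Y) {k : ℕ} {w : SLTwo} (hw : w ∈ words K k)
    {v : ℤ × ℤ} (hv : PosVec v) : PosVec (act w v) := by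
  have h := (hK.words_bounds hY hw (B := max |v.1| |v.2|) (v := v) hv.1 hv.2
    ⟨le_max_left _ _, le_max_right _ _⟩).1
  have hYk : (0 : ℤ) < Y ^ k := by positivity
  exact ⟨pos_of_mul_pos_right (hYk.trans_le h.1) (by positivity),
    pos_of_mul_pos_right (hYk.trans_le h.2) (by positivity)⟩

lemma entry_le (hK : BlockSystem K Y) (hY : 0 < Y) {k : ℕ} {w : SLTwo} (hw : w ∈ words K k)
    (i j : Fin 2) : w i j ≤ Y ^ k := by
  have h := (hK.words_bounds hY hw (B := 1) (v := (1, 1)) le_rfl le_rfl ⟨by simp, by simp⟩).2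
  have hn := hK.words_nonneg hY hw
  have e : act w (1, 1) = (w 0 0 + w 0 1, w 1 0 + w 1 1) := by simp [act]
  rw [e] at h
  obtain ⟨h1, h2⟩ := h
  have h1 := (le_abs_self _).trans h1
  have h2 := (le_abs_self _).trans h2
  simp only [mul_one] at h1 h2
  have n00 := hn 0 0
  have n01 := hn 0 1
  have n10 := hn 1 0
  have n11 := hn 1 1
  fin_cases i <;> fin_cases j <;> simp only [Fin.zero_eta, Fin.mk_one] <;> linarith

lemma inBox_act (hK : BlockSystem K Y) (hY : 0 < Y) {k : ℕ} {w : SLTwo} (hw : w ∈ words K k)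
    {B : ℤ} {v : ℤ × ℤ} (hv : InBox B v) :
    InBox (2 * Y ^ k * B) (act w v) ∧ InBox (2 * Y ^ k * B) (act w⁻¹ v) := by
  have hn := hK.words_nonneg hY hw
  have he := hK.entry_le hY hw
  have key : ∀ a b : ℤ, |a| ≤ Y ^ k → |b| ≤ Y ^ k → |a * v.1 + b * v.2| ≤ 2 * Y ^ k * B := by
    intro a b ha hb
    have h1 := mul_le_mul ha hv.1 (abs_nonneg _) (by positivity)
    have h2 := mul_le_mul hb hv.2 (abs_nonneg _) (by positivity)
    rw [← abs_mul] at h1 h2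
    linarith [abs_add_le (a * v.1) (b * v.2)]
  have ha : ∀ i j, |w i j| ≤ Y ^ k := fun i j => by rw [abs_of_nonneg (hn i j)]; exact he i j
  refine ⟨⟨key _ _ (ha _ _) (ha _ _), key _ _ (ha _ _) (ha _ _)⟩, ?_⟩
  rw [act_inv]
  refine ⟨?_, key _ _ (by rw [abs_neg]; exact ha _ _) (ha _ _)⟩
  rw [sub_eq_add_neg, ← neg_mul]
  exact key _ _ (ha _ _) (by rw [abs_neg]; exact ha _ _)

lemma oppVec_of_ne (hK : BlockSystem K Y) (hY : 0 < Y) {k : ℕ} {w w' : SLTwo}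
    (hw : w ∈ words K k) (hw' : w' ∈ words K k) (hne : w ≠ w') {v : ℤ × ℤ} (hv : PosVec v) :
    OppVec (act (w⁻¹ * w') v) := by
  induction k generalizing w w' v with
  | zero =>
    have h1 : w = 1 := by simpa [words] using hw
    have h2 : w' = 1 := by simpa [words] using hw'
    exact absurd (h1.trans h2.symm) hne
  | succ k ih =>
    obtain ⟨b, hb, u, hu, rfl⟩ := mem_words_succ.mp hw
    obtain ⟨b', hb', u', hu', rfl⟩ := mem_words_succ.mp hw'
    by_cases hbb : b = b'
    · subst hbb
      have : (b * u)⁻¹ * (b * u') = u⁻¹ * u' := by group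
      rw [this]
      exact ih hu hu' (fun h => hne (by rw [h])) hv
    · have : (b * u)⁻¹ * (b' * u') = u⁻¹ * ((b⁻¹ * b') * u') := by group
      rw [this, act_mul, act_mul]
      exact oppVec_act_inv (hK.words_nonneg hY hu)
        (hK.pre b hb b' hb' hbb _ (hK.posVec_act hY hu' hv))

lemma eq_of_act_inv_eq (hK : BlockSystem K Y) (hY : 0 < Y) {k : ℕ} {h h' : SLTwo}
    (hh : h ∈ words K k) (hh' : h' ∈ words K k) {v v' : ℤ × ℤ} (hv : OppVec v) (hv' : OppVec v')
    (heq : act h⁻¹ v = act h'⁻¹ v') : h = h' := by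
  induction k generalizing h h' v v' with
  | zero =>
    have h1 : h = 1 := by simpa [words] using hh
    have h2 : h' = 1 := by simpa [words] using hh'
    rw [h1, h2]
  | succ k ih =>
    obtain ⟨b, hb, u, hu, rfl⟩ := mem_words_succ.mp hh
    obtain ⟨b', hb', u', hu', rfl⟩ := mem_words_succ.mp hh'
    rw [mul_inv_rev, mul_inv_rev, act_mul, act_mul] at heq
    have huu := ih hu hu' (oppVec_act_inv (fun i j => (hK.entry_pos hY hb i j).le) hv)
      (oppVec_act_inv (fun i j => (hK.entry_pos hY hb' i j).le) hv') heq
    subst huu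
    have h2 := act_injective _ heq
    by_contra hne
    have hbb : b ≠ b' := fun h => hne (by rw [h])
    apply hK.suf b hb b' hb' hbb v' hv'
    rwa [act_mul, ← h2, act_act_inv]

lemma words_mul_injOn (hK : BlockSystem K Y) (hY : 0 < Y) (j k : ℕ) :
    Set.InjOn (fun x : SLTwo × SLTwo => x.1 * x.2) (words K j ×ˢ words K k : Finset _) := by
  rintro ⟨h, u⟩ hx ⟨h', u'⟩ hx' heq
  simp only [Finset.coe_product, Set.mem_prod, Finset.mem_coe] at hx hx' heq
  by_cases hhh : h = h'
  · subst hhh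
    rw [mul_left_cancel heq]
  · exfalso
    have h1 := hK.oppVec_of_ne hY hx.1 hx'.1 hhh (v := act u' (1, 1))
      (hK.posVec_act hY hx'.2 ⟨one_pos, one_pos⟩)
    rw [← act_mul] at h1
    have e : h⁻¹ * h' * u' = u := by rw [mul_assoc, ← heq]; group
    rw [e] at h1
    have h2 := hK.posVec_act hY hx.2 (v := (1, 1)) ⟨one_pos, one_pos⟩
    have := mul_pos h2.1 h2.2
    unfold OppVec at h1
    linarith

lemma words_add_eq_image (j k : ℕ) : words K (j + k) =
    (words K j ×ˢ words K k).image fun x => x.1 * x.2 := by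
  ext w
  rw [mem_words_add]
  simp only [Finset.mem_image, Finset.mem_product, Prod.exists]
  constructor
  · rintro ⟨a, ha, b, hb, rfl⟩; exact ⟨a, b, ⟨ha, hb⟩, rfl⟩
  · rintro ⟨a, b, ⟨ha, hb⟩, rfl⟩; exact ⟨a, ha, b, hb, rfl⟩

lemma words_one : words K 1 = K := by
  ext w
  simp [words]

lemma card_words (hK : BlockSystem K Y) (hY : 0 < Y) (k : ℕ) : (words K k).card = K.card ^ k := by
  induction k with
  | zero => simp [words]
  | succ k ih =>
    rw [add_comm, words_add_eq_image, Finset.card_image_of_injOn (hK.words_mul_injOn hY 1 k),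
      Finset.card_product, words_one, ih]
    ring

lemma cross_ne_zero (hK : BlockSystem K Y) (hY : 0 < Y) {k : ℕ} {w w' : SLTwo}
    (hw : w ∈ words K k) (hw' : w' ∈ words K k) (hne : w ≠ w') :
    cross (act w (1, 1)) (act w' (1, 1)) ≠ 0 := by
  have h := hK.oppVec_of_ne hY hw hw' hne (v := (1, 1)) ⟨one_pos, one_pos⟩
  have e : act w' (1, 1) = act w (act (w⁻¹ * w') (1, 1)) := by
    rw [← act_mul]; congr 1; group
  rw [e, cross_act]
  unfold OppVec at h
  unfold cross
  intro h0
  have : (act (w⁻¹ * w') (1, 1)).2 = (act (w⁻¹ * w') (1, 1)).1 := by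
    simp only at h0; linarith
  rw [this] at h
  nlinarith

end BlockSystem

lemma gcd_act_one_one (w : SLTwo) : IsCoprime (act w (1, 1)).1 (act w (1, 1)).2 := by
  have h := det_entries w
  refine ⟨w 1 1, -w 0 1, ?_⟩
  unfold act
  simp only
  linear_combination h

lemma isUnit_zmod_primePow {p : ℕ} (hp : p.Prime) (M : ℕ) {a : ℤ} (ha : ¬ (p : ℤ) ∣ a) :
    IsUnit (a : ZMod (p ^ M)) := by
  rw [ZMod.coe_int_isUnit_iff_isCoprime]
  push_cast
  apply IsCoprime.pow_left
  exact (Nat.prime_iff_prime_int.mp hp).irreducible.coprime_iff_not_dvd.mpr ha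

/-- Pairs of primitive vectors are often parallel modulo a prime power. -/
lemma sq_card_le_card_cross_dvd {ι : Type*} {p : ℕ} (hp : p.Prime) (M : ℕ)
    (s : Finset ι) (v : ι → ℤ × ℤ) (hv : ∀ i ∈ s, IsCoprime (v i).1 (v i).2) :
    s.card ^ 2 ≤ 2 * p ^ M *
      ((s ×ˢ s).filter fun x => ((p ^ M : ℕ) : ℤ) ∣ cross (v x.1) (v x.2)).card := by
  classical
  have : NeZero (p ^ M) := ⟨(pow_pos hp.pos M).ne'⟩
  set c : ι → Bool × ZMod (p ^ M) := fun i =>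
    if (p : ℤ) ∣ (v i).1 then (true, ((v i).1 : ZMod (p ^ M)) * ((v i).2 : ZMod (p ^ M))⁻¹)
    else (false, ((v i).2 : ZMod (p ^ M)) * ((v i).1 : ZMod (p ^ M))⁻¹) with hc
  have hcross : ∀ i ∈ s, ∀ j ∈ s, c i = c j → ((p ^ M : ℕ) : ℤ) ∣ cross (v i) (v j) := by
    intro i hi j hj hij
    rw [← ZMod.intCast_zmod_eq_zero_iff_dvd]
    unfold cross
    push_cast
    have hu : ∀ k ∈ s, (p : ℤ) ∣ (v k).1 → IsUnit ((v k).2 : ZMod (p ^ M)) := by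
      intro k hk hpk
      apply isUnit_zmod_primePow hp
      intro h2
      exact (Nat.prime_iff_prime_int.mp hp).not_isUnit ((hv k hk).isUnit_of_dvd' hpk h2)
    simp only [hc] at hij
    split_ifs at hij with h1 h2 h3
    · have e := congrArg Prod.snd hij
      simp only at e
      have u1 := ZMod.mul_inv_of_unit _ (hu i hi h1)
      have u2 := ZMod.mul_inv_of_unit _ (hu j hj h2)
      linear_combination ((v i).2 : ZMod (p ^ M)) * ((v j).2 : ZMod (p ^ M)) * e -
        ((v i).1 : ZMod (p ^ M)) * ((v j).2 : ZMod (p ^ M)) * u1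
        + ((v j).1 : ZMod (p ^ M)) * ((v i).2 : ZMod (p ^ M)) * u2
    · simp at hij
    · simp at hij
    · have e := congrArg Prod.snd hij
      simp only at e
      have u1 := ZMod.mul_inv_of_unit _ (isUnit_zmod_primePow hp M h1)
      have u2 := ZMod.mul_inv_of_unit _ (isUnit_zmod_primePow hp M h3)
      linear_combination -((v i).1 : ZMod (p ^ M)) * ((v j).1 : ZMod (p ^ M)) * e +
        ((v i).2 : ZMod (p ^ M)) * ((v j).1 : ZMod (p ^ M)) * u1
        - ((v j).2 : ZMod (p ^ M)) * ((v i).1 : ZMod (p ^ M)) * u2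
  have h1 : s.card = ∑ b : Bool × ZMod (p ^ M), (s.filter fun i => c i = b).card :=
    Finset.card_eq_sum_card_fiberwise (fun _ _ => Finset.mem_coe.mpr (Finset.mem_univ _))
  have h2 : ∑ b : Bool × ZMod (p ^ M), (s.filter fun i => c i = b).card ^ 2 ≤
      ((s ×ˢ s).filter fun x => ((p ^ M : ℕ) : ℤ) ∣ cross (v x.1) (v x.2)).card := by
    have : ∀ b, (s.filter fun i => c i = b).card ^ 2 =
        ((s.filter fun i => c i = b) ×ˢ (s.filter fun i => c i = b)).card := by
      intro b; rw [Finset.card_product, sq]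
    simp_rw [this]
    rw [← Finset.card_biUnion]
    · apply Finset.card_le_card
      intro x hx
      simp only [Finset.mem_biUnion, Finset.mem_univ, true_and, Finset.mem_product,
        Finset.mem_filter] at hx ⊢
      obtain ⟨b, ⟨hx1, e1⟩, hx2, e2⟩ := hx
      exact ⟨⟨hx1, hx2⟩, hcross _ hx1 _ hx2 (e1.trans e2.symm)⟩
    · intro b _ b' _ hbb
      rw [Function.onFun, Finset.disjoint_left]
      intro x hx hx'
      simp only [Finset.mem_product, Finset.mem_filter] at hx hx'
      exact hbb (hx.1.2.symm.trans hx'.1.2)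
  calc s.card ^ 2 = (∑ b : Bool × ZMod (p ^ M), (s.filter fun i => c i = b).card) ^ 2 := by rw [← h1]
    _ ≤ (Finset.univ : Finset (Bool × ZMod (p ^ M))).card *
        ∑ b : Bool × ZMod (p ^ M), (s.filter fun i => c i = b).card ^ 2 :=
        sq_sum_le_card_mul_sum_sq
    _ = 2 * p ^ M * ∑ b : Bool × ZMod (p ^ M), (s.filter fun i => c i = b).card ^ 2 := by
        rw [Finset.card_univ, Fintype.card_prod, ZMod.card]; simp
    _ ≤ _ := by gcongr

lemma eq_add_mul_of_cross_eq {u y y' : ℤ × ℤ} (hu : IsCoprime u.1 u.2)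
    (h : cross y u = cross y' u) : ∃ k : ℤ, y'.1 = y.1 + k * u.1 ∧ y'.2 = y.2 + k * u.2 := by
  obtain ⟨a, b, hab⟩ := hu
  unfold cross at h
  refine ⟨a * (y'.1 - y.1) + b * (y'.2 - y.2), ?_, ?_⟩
  · linear_combination (y.1 - y'.1) * hab - b * h
  · linear_combination (y.2 - y'.2) * hab + a * h

lemma card_le_card_image_cross_mul (s : Finset (ℤ × ℤ)) {u : ℤ × ℤ} (hu : IsCoprime u.1 u.2)
    (hpos : 0 < u.1) (a : ℤ) (T : ℕ) (hs : ∀ y ∈ s, a ≤ y.1 ∧ y.1 < a + u.1 * T) :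
    s.card ≤ (s.image fun y => cross y u).card * T := by
  classical
  have : s.card ≤ ((s.image fun y => cross y u) ×ˢ Finset.Ico (0 : ℤ) T).card := by
    apply Finset.card_le_card_of_injOn fun y => (cross y u, (y.1 - a) / u.1)
    · intro y hy
      simp only [Finset.coe_product, Set.mem_prod, Finset.mem_coe, Finset.mem_Ico]
      obtain ⟨h1, h2⟩ := hs y hy
      refine ⟨Finset.mem_image_of_mem _ hy, Int.ediv_nonneg (by linarith) hpos.le, ?_⟩
      apply Int.ediv_lt_of_lt_mul hpos
      linarith
    · intro y hy y' hy' h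
      simp only [Prod.mk.injEq] at h
      obtain ⟨k, h1, h2⟩ := eq_add_mul_of_cross_eq hu h.1
      have h3 : (y'.1 - a) / u.1 = (y.1 - a) / u.1 + k := by
        rw [h1, show y.1 + k * u.1 - a = y.1 - a + k * u.1 by ring,
          Int.add_mul_ediv_right _ _ hpos.ne']
      have hk : k = 0 := by linarith [h.2]
      subst hk
      ext <;> linarith
  rw [Finset.card_product, Int.card_Ico] at this
  simpa using this

lemma card_multiples_le (s : Finset ℤ) {Q : ℕ} (hQ : 0 < Q) (X : ℕ)
    (hs : ∀ z ∈ s, (Q : ℤ) ∣ z ∧ |z| ≤ X) : s.card ≤ 2 * (X / Q) + 1 := by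
  have h : s.card ≤ (Finset.Icc (-((X / Q : ℕ) : ℤ)) ((X / Q : ℕ) : ℤ)).card := by
    apply Finset.card_le_card_of_injOn fun z : ℤ => z / (Q : ℤ)
    · intro z hz
      obtain ⟨⟨k, rfl⟩, h2⟩ := hs z hz
      have hQ' : (Q : ℤ) ≠ 0 := by omega
      simp only [Finset.coe_Icc, Set.mem_Icc]
      rw [Int.mul_ediv_cancel_left _ hQ', ← abs_le]
      push_cast
      rw [Int.le_ediv_iff_mul_le (by omega)]
      rwa [abs_mul, abs_of_nonneg (by omega : (0 : ℤ) ≤ Q), mul_comm] at h2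
    · intro z hz z' hz' h
      obtain ⟨⟨k, rfl⟩, _⟩ := hs z hz
      obtain ⟨⟨k', rfl⟩, _⟩ := hs z' hz'
      have hQ' : (Q : ℤ) ≠ 0 := by omega
      simp only [Int.mul_ediv_cancel_left _ hQ'] at h
      rw [h]
  rw [Int.card_Icc] at h
  omega

lemma card_nonzero_multiples_le (s : Finset ℤ) {Q : ℕ} (hQ : 0 < Q) (X : ℕ)
    (hs : ∀ z ∈ s, (Q : ℤ) ∣ z ∧ |z| ≤ X ∧ z ≠ 0) : s.card ≤ 2 * (X / Q) := by
  have h := card_multiples_le (insert 0 s) hQ X (by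
    intro z hz
    rcases Finset.mem_insert.mp hz with rfl | hz
    · simp
    · exact ⟨(hs z hz).1, (hs z hz).2.1⟩)
  rw [Finset.card_insert_of_notMem (fun h0 => (hs 0 h0).2.2 rfl)] at h
  omega

/-- A finite set of pairwise non-parallel primitive vectors whose coordinates are comparable
to `n` up to a factor `Z`, and which contains a proportion at least `1 / Z` of the square. -/
structure VecFam (A : Finset (ℤ × ℤ)) (n Z : ℕ) : Prop where
  pos : ∀ v ∈ A, 0 < v.1 ∧ 0 < v.2
  le : ∀ v ∈ A, v.1 ≤ n ∧ v.2 ≤ n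
  ge : ∀ v ∈ A, (n : ℤ) ≤ Z * v.1 ∧ (n : ℤ) ≤ Z * v.2
  coprime : ∀ v ∈ A, IsCoprime v.1 v.2
  cross_ne : ∀ v ∈ A, ∀ w ∈ A, v ≠ w → cross v w ≠ 0
  dense : n ^ 2 ≤ Z * A.card

namespace VecFam

variable {A : Finset (ℤ × ℤ)} {n Z : ℕ}

lemma abs_cross_lt (hA : VecFam A n Z) {v w : ℤ × ℤ} (hv : v ∈ A) (hw : w ∈ A) :
    |cross v w| ≤ (n ^ 2 : ℕ) := by
  obtain ⟨p1, p2⟩ := hA.pos v hv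
  obtain ⟨p3, p4⟩ := hA.pos w hw
  obtain ⟨l1, l2⟩ := hA.le v hv
  obtain ⟨l3, l4⟩ := hA.le w hw
  unfold cross
  push_cast
  have m1 := mul_le_mul l1 l4 p4.le (by omega)
  have m2 := mul_le_mul l2 l3 p3.le (by omega)
  have m3 := mul_pos p1 p4
  have m4 := mul_pos p2 p3
  rw [abs_le]
  constructor <;> nlinarith

lemma card_parallel_le (hA : VecFam A n Z) {u : ℤ × ℤ} (hu : u ∈ A) {Q : ℕ} (hQ : 0 < Q) :
    ((A.filter fun v => v ≠ u ∧ (Q : ℤ) ∣ cross v u).card : ℝ) ≤ 2 * Z * n ^ 2 / Q := by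
  set s := A.filter fun v => v ≠ u ∧ (Q : ℤ) ∣ cross v u with hs
  have hmem : ∀ y ∈ s, y ∈ A ∧ y ≠ u ∧ (Q : ℤ) ∣ cross y u := by
    intro y hy; simpa [hs] using hy
  have h1 := card_le_card_image_cross_mul s (hA.coprime u hu) (hA.pos u hu).1 1 Z (by
    intro y hy
    have hyA := (hmem y hy).1
    have := (hA.pos y hyA).1
    have := (hA.le y hyA).1
    have := (hA.ge u hu).1
    constructor
    · omega
    · rw [mul_comm]; omega)
  have h2 := card_nonzero_multiples_le (s.image fun y => cross y u) hQ (n ^ 2) (by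
    intro z hz
    obtain ⟨y, hy, rfl⟩ := Finset.mem_image.mp hz
    obtain ⟨a, b, c⟩ := hmem y hy
    exact ⟨c, hA.abs_cross_lt a hu, hA.cross_ne y a u hu b⟩)
  have h3 : s.card ≤ 2 * (n ^ 2 / Q) * Z := h1.trans (Nat.mul_le_mul_right _ h2)
  have h4 : ((n ^ 2 / Q : ℕ) : ℝ) ≤ (n : ℝ) ^ 2 / Q := by exact_mod_cast Nat.cast_div_le
  calc (s.card : ℝ) ≤ 2 * ((n ^ 2 / Q : ℕ) : ℝ) * Z := by exact_mod_cast h3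
    _ ≤ 2 * ((n : ℝ) ^ 2 / Q) * Z := by gcongr
    _ = _ := by ring

lemma card_parallel_pairs_le (hA : VecFam A n Z) {Q : ℕ} (hQ : 0 < Q) :
    (((A ×ˢ A).filter fun x => x.1 ≠ x.2 ∧ (Q : ℤ) ∣ cross x.1 x.2).card : ℝ) ≤
      A.card * (2 * Z * n ^ 2 / Q) := by
  classical
  have h : ((A ×ˢ A).filter fun x => x.1 ≠ x.2 ∧ (Q : ℤ) ∣ cross x.1 x.2).card =
      ∑ u ∈ A, (A.filter fun v => v ≠ u ∧ (Q : ℤ) ∣ cross v u).card := by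
    simp_rw [Finset.card_filter]
    rw [Finset.sum_product_right]
  rw [h]
  push_cast
  calc _ ≤ ∑ u ∈ A, (2 * Z * n ^ 2 / Q : ℝ) := Finset.sum_le_sum fun u hu => hA.card_parallel_le hu hQ
    _ = _ := by rw [Finset.sum_const, nsmul_eq_mul]

/-- Vectors of a box that are nearly parallel to `u` modulo `Q`. -/
lemma card_box_parallel_le (hA : VecFam A n Z) {u : ℤ × ℤ} (hu : u ∈ A) {Q B : ℕ} (hQ : 0 < Q)
    (hn : 0 < n) (s : Finset (ℤ × ℤ)) (hs : ∀ y ∈ s, InBox B y ∧ (Q : ℤ) ∣ cross y u) :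
    (s.card : ℝ) ≤ (4 * B * n / Q + 1) * (2 * B * Z / n + 1) := by
  obtain ⟨p1, p2⟩ := hA.pos u hu
  obtain ⟨l1, l2⟩ := hA.le u hu
  obtain ⟨g1, g2⟩ := hA.ge u hu
  have hT : (((2 * B * Z) / n : ℕ) : ℝ) ≤ 2 * B * Z / n := by exact_mod_cast Nat.cast_div_le
  have h1 := card_le_card_image_cross_mul s (hA.coprime u hu) p1 (-B) ((2 * B * Z) / n + 1) (by
    intro y hy
    obtain ⟨⟨b1, _⟩, _⟩ := hs y hy
    rw [abs_le] at b1
    refine ⟨b1.1, ?_⟩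
    have h3 : 2 * B * Z < n * ((2 * B * Z) / n + 1) := by
      have := Nat.lt_mul_div_succ (2 * B * Z) hn
      exact this
    have h4 : (2 * B : ℤ) < u.1 * (((2 * B * Z) / n + 1 : ℕ) : ℤ) := by
      have h5 : (2 * B * Z : ℤ) < n * (((2 * B * Z) / n + 1 : ℕ) : ℤ) := by exact_mod_cast h3
      have h6 : (n : ℤ) * (((2 * B * Z) / n + 1 : ℕ) : ℤ) ≤
          Z * u.1 * (((2 * B * Z) / n + 1 : ℕ) : ℤ) := by gcongr
      by_contra hcon
      push Not at hcon
      have h7 : (Z : ℤ) * (u.1 * (((2 * B * Z) / n + 1 : ℕ) : ℤ)) ≤ Z * (2 * B) := by gcongr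
      nlinarith
    linarith)
  have h2 := card_multiples_le (s.image fun y => cross y u) hQ (2 * B * n) (by
    intro z hz
    obtain ⟨y, hy, rfl⟩ := Finset.mem_image.mp hz
    obtain ⟨⟨b1, b2⟩, hd⟩ := hs y hy
    refine ⟨hd, ?_⟩
    unfold cross
    have m1 : |y.1 * u.2| ≤ B * n := by
      rw [abs_mul]; apply mul_le_mul b1 _ (abs_nonneg _) (by omega)
      rw [abs_of_pos p2]; exact l2
    have m2 : |y.2 * u.1| ≤ B * n := by
      rw [abs_mul]; apply mul_le_mul b2 _ (abs_nonneg _) (by omega)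
      rw [abs_of_pos p1]; exact l1
    have := abs_sub (y.1 * u.2) (y.2 * u.1)
    push_cast
    linarith)
  have h3 := h1.trans (Nat.mul_le_mul_right _ h2)
  have h4 : (((2 * B * n) / Q : ℕ) : ℝ) ≤ 2 * B * n / Q := by exact_mod_cast Nat.cast_div_le
  calc (s.card : ℝ) ≤ (2 * (((2 * B * n) / Q : ℕ) : ℝ) + 1) * ((((2 * B * Z) / n : ℕ) : ℝ) + 1) := by
        exact_mod_cast h3
    _ ≤ (2 * (2 * B * n / Q) + 1) * (2 * B * Z / n + 1) := by gcongr
    _ = _ := by ring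

lemma card_box_cross_eq_le (hA : VecFam A n Z) {u : ℤ × ℤ} (hu : u ∈ A) {B : ℕ}
    (hn : 0 < n) (r : ℤ) (s : Finset (ℤ × ℤ)) (hs : ∀ y ∈ s, InBox B y ∧ cross y u = r) :
    (s.card : ℝ) ≤ 2 * B * Z / n + 1 := by
  obtain ⟨p1, p2⟩ := hA.pos u hu
  obtain ⟨g1, g2⟩ := hA.ge u hu
  have hT : (((2 * B * Z) / n : ℕ) : ℝ) ≤ 2 * B * Z / n := by exact_mod_cast Nat.cast_div_le
  have h1 := card_le_card_image_cross_mul s (hA.coprime u hu) p1 (-B) ((2 * B * Z) / n + 1) (by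
    intro y hy
    obtain ⟨⟨b1, _⟩, _⟩ := hs y hy
    rw [abs_le] at b1
    refine ⟨b1.1, ?_⟩
    have h3 : 2 * B * Z < n * ((2 * B * Z) / n + 1) := by
      have := Nat.lt_mul_div_succ (2 * B * Z) hn
      exact this
    have h4 : (2 * B : ℤ) < u.1 * (((2 * B * Z) / n + 1 : ℕ) : ℤ) := by
      have h5 : (2 * B * Z : ℤ) < n * (((2 * B * Z) / n + 1 : ℕ) : ℤ) := by exact_mod_cast h3
      have h6 : (n : ℤ) * (((2 * B * Z) / n + 1 : ℕ) : ℤ) ≤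
          Z * u.1 * (((2 * B * Z) / n + 1 : ℕ) : ℤ) := by gcongr
      by_contra hcon
      push Not at hcon
      have h7 : (Z : ℤ) * (u.1 * (((2 * B * Z) / n + 1 : ℕ) : ℤ)) ≤ Z * (2 * B) := by gcongr
      nlinarith
    linarith)
  have h2 : (s.image fun y => cross y u).card ≤ 1 := by
    rw [Finset.card_le_one]
    intro a ha b hb
    obtain ⟨y, hy, rfl⟩ := Finset.mem_image.mp ha
    obtain ⟨y', hy', rfl⟩ := Finset.mem_image.mp hb
    rw [(hs y hy).2, (hs y' hy').2]
  have h3 := h1.trans (Nat.mul_le_mul_right _ h2)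
  calc (s.card : ℝ) ≤ 1 * ((((2 * B * Z) / n : ℕ) : ℝ) + 1) := by exact_mod_cast h3
    _ ≤ _ := by linarith

end VecFam

/-- Among many integers divisible by `p ^ M₀`, many have the same `p`-adic valuation. -/
lemma exists_exact_valuation {ι : Type*} {p : ℕ} (hp : 2 ≤ p) (M₀ : ℕ) (s : Finset ι) (d : ι → ℤ)
    {a U : ℝ} (ha : 0 < a)
    (hlow : a / (p : ℝ) ^ M₀ ≤ ((s.filter fun i => ((p ^ M₀ : ℕ) : ℤ) ∣ d i).card : ℝ))
    (hup : ∀ v, ((s.filter fun i => ((p ^ (M₀ + v) : ℕ) : ℤ) ∣ d i).card : ℝ) ≤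
      U / (p : ℝ) ^ (M₀ + v)) :
    ∃ v, (p : ℝ) ^ v ≤ (U / a) ^ 2 ∧ a / (4 * (p : ℝ) ^ (M₀ + v)) ≤
      ((s.filter fun i => ((p ^ (M₀ + v) : ℕ) : ℤ) ∣ d i ∧
        ¬ ((p ^ (M₀ + v + 1) : ℕ) : ℤ) ∣ d i).card : ℝ) := by
  classical
  have hp' : (2 : ℝ) ≤ p := by exact_mod_cast hp
  set N : ℕ → ℝ := fun v => ((s.filter fun i => ((p ^ (M₀ + v) : ℕ) : ℤ) ∣ d i).card : ℝ) with hN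
  have hN0 : a / (p : ℝ) ^ M₀ ≤ N 0 := hlow
  have hpow : ∀ v, (3 / 4 : ℝ) ^ v * N 0 ≤ N v → (3 / 4 * p : ℝ) ^ v ≤ U / a := by
    intro v hv
    have h1 := hv.trans (hup v)
    have h2 : (3 / 4 : ℝ) ^ v * (a / (p : ℝ) ^ M₀) ≤ U / (p : ℝ) ^ (M₀ + v) :=
      le_trans (by gcongr) h1
    rw [le_div_iff₀ (by positivity)] at h2 ⊢
    calc (3 / 4 * p : ℝ) ^ v * a = (3 / 4 : ℝ) ^ v * (a / (p : ℝ) ^ M₀) * (p : ℝ) ^ (M₀ + v) := by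
          rw [pow_add, mul_pow]; field_simp
      _ ≤ U := h2
  have hex : ∃ v, N (v + 1) < 3 / 4 * N v := by
    by_contra hcon
    push Not at hcon
    have hall : ∀ v, (3 / 4 : ℝ) ^ v * N 0 ≤ N v := by
      intro v
      induction v with
      | zero => simp
      | succ v ih => rw [pow_succ']; linarith [hcon v]
    obtain ⟨v, hv⟩ := pow_unbounded_of_one_lt (U / a) (by linarith : (1 : ℝ) < 3 / 4 * p)
    linarith [hpow v (hall v)]
  set v := Nat.find hex with hv
  have hfind := Nat.find_spec hex
  rw [← hv] at hfind
  have hall : ∀ w ≤ v, (3 / 4 : ℝ) ^ w * N 0 ≤ N w := by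
    intro w
    induction w with
    | zero => intro _; simp
    | succ w ih =>
      intro hw
      have := Nat.find_min hex (m := w) (by omega)
      push Not at this
      rw [pow_succ']
      linarith [ih (by omega)]
  refine ⟨v, ?_, ?_⟩
  · have h1 := hpow v (hall v le_rfl)
    calc (p : ℝ) ^ v ≤ ((3 / 4 * p) ^ 2 : ℝ) ^ v := by gcongr; nlinarith
      _ = ((3 / 4 * p : ℝ) ^ v) ^ 2 := by rw [pow_right_comm]
      _ ≤ _ := by gcongr
  · have hsplit : ((s.filter fun i => ((p ^ (M₀ + v) : ℕ) : ℤ) ∣ d i ∧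
        ¬ ((p ^ (M₀ + v + 1) : ℕ) : ℤ) ∣ d i).card : ℝ) = N v - N (v + 1) := by
      have h := Finset.card_filter_add_card_filter_not
        (s := s.filter fun i => ((p ^ (M₀ + v) : ℕ) : ℤ) ∣ d i)
        fun i => ((p ^ (M₀ + v + 1) : ℕ) : ℤ) ∣ d i
      rw [Finset.filter_filter, Finset.filter_filter] at h
      have e : (s.filter fun i => ((p ^ (M₀ + v) : ℕ) : ℤ) ∣ d i ∧
          ((p ^ (M₀ + v + 1) : ℕ) : ℤ) ∣ d i) =
          s.filter fun i => ((p ^ (M₀ + (v + 1)) : ℕ) : ℤ) ∣ d i := by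
        apply Finset.filter_congr
        intro i _
        constructor
        · exact fun h => h.2
        · intro h
          refine ⟨dvd_trans ?_ h, h⟩
          exact_mod_cast pow_dvd_pow p (by omega)
      rw [e] at h
      simp only [hN]
      rw [← h]
      push_cast
      ring
    rw [hsplit]
    have h1 := hall v le_rfl
    have h2 : a / (p : ℝ) ^ (M₀ + v) ≤ N v := by
      calc a / (p : ℝ) ^ (M₀ + v) = (1 / p : ℝ) ^ v * (a / (p : ℝ) ^ M₀) := by
            rw [pow_add, one_div, inv_pow]; field_simp
        _ ≤ (3 / 4 : ℝ) ^ v * (a / (p : ℝ) ^ M₀) := by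
            refine mul_le_mul_of_nonneg_right ?_ (by positivity)
            refine pow_le_pow_left₀ (by positivity) ?_ v
            rw [div_le_div_iff₀ (by positivity) (by norm_num)]; linarith
        _ ≤ (3 / 4 : ℝ) ^ v * N 0 := by gcongr
        _ ≤ _ := h1
    have h3 : a / (4 * (p : ℝ) ^ (M₀ + v)) = (a / (p : ℝ) ^ (M₀ + v)) / 4 := by
      field_simp
    rw [h3]
    linarith

lemma norm_sum_sq_le_card_mul {ι : Type*} (s : Finset ι) (f : ι → ℂ) :
    ‖∑ i ∈ s, f i‖ ^ 2 ≤ s.card * ∑ i ∈ s, ‖f i‖ ^ 2 := by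
  calc ‖∑ i ∈ s, f i‖ ^ 2 ≤ (∑ i ∈ s, ‖f i‖) ^ 2 := by gcongr; exact norm_sum_le _ _
    _ ≤ _ := sq_sum_le_card_mul_sum_sq

lemma norm_sum_sq_eq {ι : Type*} (s : Finset ι) (f : ι → ℂ) :
    ((‖∑ i ∈ s, f i‖ ^ 2 : ℝ) : ℂ) = ∑ i ∈ s, ∑ j ∈ s, f i * (starRingEnd ℂ) (f j) := by
  rw [Complex.ofReal_pow, ← Complex.mul_conj', map_sum, Finset.sum_mul_sum]

lemma sum_norm_sq_sum_stdAddChar_le {P : ℕ} [NeZero P] {ι : Type*} (T : Finset ι)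
    (x : ι → ZMod P) (α : ι → ℂ) (hα : ∀ i ∈ T, ‖α i‖ ≤ 1) {m : ℕ}
    (hx : ∀ i ∈ T, (T.filter fun j => x j = x i).card ≤ m) :
    ∑ y : ZMod P, ‖∑ i ∈ T, α i * ZMod.stdAddChar (x i * y)‖ ^ 2 ≤ (T.card * P * m : ℝ) := by
  have key : ((∑ y : ZMod P, ‖∑ i ∈ T, α i * ZMod.stdAddChar (x i * y)‖ ^ 2 : ℝ) : ℂ) =
      ∑ i ∈ T, ∑ j ∈ T, α i * (starRingEnd ℂ) (α j) * (if x j = x i then (P : ℂ) else 0) := by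
    rw [Complex.ofReal_sum]
    simp_rw [norm_sum_sq_eq]
    rw [Finset.sum_comm]
    refine Finset.sum_congr rfl fun i _ => ?_
    rw [Finset.sum_comm]
    refine Finset.sum_congr rfl fun j _ => ?_
    have h := AddChar.sum_mulShift (ψ := (ZMod.stdAddChar : AddChar (ZMod P) ℂ)) (x i - x j)
      (ZMod.isPrimitive_stdAddChar P)
    rw [ZMod.card] at h
    have h2 : (if x j = x i then (P : ℂ) else 0) = ((if x i - x j = 0 then P else 0 : ℕ) : ℂ) := by
      by_cases hh : x j = x i
      · simp [hh]
      · rw [if_neg hh, if_neg (by rw [sub_eq_zero]; exact fun h => hh h.symm)]; simp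
    rw [h2, ← h, Finset.mul_sum]
    refine Finset.sum_congr rfl fun y _ => ?_
    rw [map_mul (starRingEnd ℂ), ← AddChar.map_neg_eq_conj,
      show y * (x i - x j) = x i * y + -(x j * y) by ring, AddChar.map_add_eq_mul]
    ring
  have h0 : (0 : ℝ) ≤ ∑ y : ZMod P, ‖∑ i ∈ T, α i * ZMod.stdAddChar (x i * y)‖ ^ 2 := by
    positivity
  rw [← abs_of_nonneg h0, ← Real.norm_eq_abs, ← Complex.norm_real, key]
  calc _ ≤ ∑ i ∈ T, ((P * m : ℝ)) := by
        refine norm_sum_le_of_le _ fun i hi => ?_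
        calc _ ≤ ∑ j ∈ T, if x j = x i then (P : ℝ) else 0 := by
              refine norm_sum_le_of_le _ fun j hj => ?_
              split_ifs
              · rw [norm_mul, norm_mul, RCLike.norm_conj, Complex.norm_natCast]
                have h1 := mul_le_one₀ (hα i hi) (norm_nonneg _) (hα j hj)
                nlinarith [(Nat.cast_nonneg P : (0 : ℝ) ≤ P)]
              · simp
          _ = P * ((T.filter fun j => x j = x i).card : ℝ) := by
              rw [← Finset.sum_filter, Finset.sum_const, nsmul_eq_mul, mul_comm]
          _ ≤ P * m := by gcongr; exact_mod_cast hx i hi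
    _ = _ := by rw [Finset.sum_const, nsmul_eq_mul]; ring

/-- A bilinear exponential sum with few coincidences is small. -/
lemma norm_bilinear_sq_le {P : ℕ} [NeZero P] {ι κ : Type*} (T : Finset ι) (U : Finset κ)
    (x : ι → ZMod P) (y : κ → ZMod P) (α : ι → ℂ) (β : κ → ℂ)
    (hα : ∀ i ∈ T, ‖α i‖ ≤ 1) (hβ : ∀ j ∈ U, ‖β j‖ ≤ 1) {m : ℕ}
    (hx : ∀ i ∈ T, (T.filter fun j => x j = x i).card ≤ m)
    (hy : ∀ i ∈ U, (U.filter fun j => y j = y i).card ≤ m) :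
    ‖∑ i ∈ T, ∑ j ∈ U, α i * β j * ZMod.stdAddChar (x i * y j)‖ ^ 2 ≤
      (T.card * U.card * P * m ^ 2 : ℝ) := by
  set g : ZMod P → ℂ := fun z => ∑ i ∈ T, α i * ZMod.stdAddChar (x i * z) with hg
  have h1 : ∑ i ∈ T, ∑ j ∈ U, α i * β j * ZMod.stdAddChar (x i * y j) =
      ∑ j ∈ U, β j * g (y j) := by
    rw [Finset.sum_comm]
    refine Finset.sum_congr rfl fun j _ => ?_
    rw [hg, Finset.mul_sum]
    refine Finset.sum_congr rfl fun i _ => ?_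
    ring
  have h2 : ∑ j ∈ U, ‖β j * g (y j)‖ ^ 2 ≤ m * ∑ z : ZMod P, ‖g z‖ ^ 2 := by
    calc _ ≤ ∑ j ∈ U, ‖g (y j)‖ ^ 2 := by
          refine Finset.sum_le_sum fun j hj => ?_
          rw [norm_mul]
          gcongr
          exact mul_le_of_le_one_left (norm_nonneg _) (hβ j hj)
      _ = ∑ z ∈ U.image y, (U.filter fun j => y j = z).card • ‖g z‖ ^ 2 :=
          Finset.sum_comp (fun z => ‖g z‖ ^ 2) y
      _ ≤ ∑ z ∈ U.image y, m * ‖g z‖ ^ 2 := by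
          refine Finset.sum_le_sum fun z hz => ?_
          obtain ⟨j, hj, rfl⟩ := Finset.mem_image.mp hz
          rw [nsmul_eq_mul]
          gcongr
          exact hy j hj
      _ ≤ ∑ z : ZMod P, m * ‖g z‖ ^ 2 :=
          Finset.sum_le_sum_of_subset_of_nonneg (Finset.subset_univ _)
            fun _ _ _ => by positivity
      _ = _ := by rw [Finset.mul_sum]
  rw [h1]
  calc _ ≤ U.card * ∑ j ∈ U, ‖β j * g (y j)‖ ^ 2 := norm_sum_sq_le_card_mul _ _
    _ ≤ U.card * (m * (T.card * P * m)) := by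
        gcongr
        refine h2.trans ?_
        gcongr
        exact sum_norm_sq_sum_stdAddChar_le T x α hα hx
    _ = _ := by ring

/-- Few elements of a short interval satisfy a congruence. -/
lemma card_filter_range_dvd_le {P S : ℕ} {D : ℕ} (hD : 0 < D) (T : Finset ℕ)
    (hT : T ⊆ Finset.range S) (t₀ : ℕ) (h : ∀ t ∈ T, (P : ℤ) ∣ D * ((t : ℤ) - t₀)) :
    T.card ≤ S * D / P + 1 := by
  have h1 : T.card ≤ (Finset.range (S * D / P + 1)).card := by
    apply Finset.card_le_card_of_injOn fun t => D * t / P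
    · intro t ht
      simp only [Finset.coe_range, Set.mem_Iio]
      have := Finset.mem_range.mp (hT ht)
      rw [Nat.lt_succ_iff]
      apply Nat.div_le_div_right
      rw [mul_comm S]
      gcongr
    · intro t ht t' ht' heq
      simp only at heq
      have h2 : (P : ℤ) ∣ D * ((t : ℤ) - t') := by
        have := dvd_sub (h t ht) (h t' ht')
        rwa [← mul_sub, sub_sub_sub_cancel_right] at this
      have h3 : D * t ≡ D * t' [MOD P] := by
        apply (Nat.modEq_iff_dvd.mpr ?_).symm
        push_cast
        rwa [← mul_sub]
      have h4 : D * t = D * t' := by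
        rw [← Nat.div_add_mod (D * t) P, ← Nat.div_add_mod (D * t') P, heq, h3]
      exact Nat.eq_of_mul_eq_mul_left hD h4
  simpa using h1

lemma exists_int_inv {p : ℕ} (hp : p.Prime) {r : ℤ} (hr : ¬ (p : ℤ) ∣ r) (M : ℕ) :
    ∃ a : ℤ, ((p ^ M : ℕ) : ℤ) ∣ a * r - 1 := by
  have h : IsCoprime ((p : ℤ) ^ M) r :=
    IsCoprime.pow_left (((Nat.prime_iff_prime_int.mp hp).coprime_iff_not_dvd).mpr hr)
  obtain ⟨a, b, hab⟩ := h
  exact ⟨b, -a, by push_cast; linear_combination hab⟩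

lemma zmod_inv_eq_of_dvd {N : ℕ} {a r : ℤ} (h : (N : ℤ) ∣ a * r - 1) :
    (r : ZMod N)⁻¹ = (a : ZMod N) := by
  have h1 : (a : ZMod N) * (r : ZMod N) = 1 := by
    have := (ZMod.intCast_zmod_eq_zero_iff_dvd _ N).mpr h
    push_cast at this
    linear_combination this
  have hu : IsUnit (r : ZMod N) := IsUnit.of_mul_eq_one_right _ h1
  calc (r : ZMod N)⁻¹ = (a * r) * (r : ZMod N)⁻¹ := by rw [h1, one_mul]
    _ = a := by rw [mul_assoc, ZMod.mul_inv_of_unit _ hu, mul_one]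

/-- Reducing the modulus of the standard additive character at a fraction. -/
lemma stdAddChar_reduce {p : ℕ} (hp : p.Prime) {M e : ℕ} (he : e ≤ M) [NeZero (p ^ M)]
    [NeZero (p ^ (M - e))] {r₁ r₂ : ℤ} (h₁ : ¬ (p : ℤ) ∣ r₁) (h₂ : ¬ (p : ℤ) ∣ r₂) (κ : ℤ) :
    ZMod.stdAddChar (((p ^ e * κ : ℤ) : ZMod (p ^ M)) * (r₁ : ZMod (p ^ M))⁻¹ *
      (r₂ : ZMod (p ^ M))⁻¹) =
    ZMod.stdAddChar ((κ : ZMod (p ^ (M - e))) * (r₁ : ZMod (p ^ (M - e)))⁻¹ *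
      (r₂ : ZMod (p ^ (M - e)))⁻¹) := by
  obtain ⟨a, ha⟩ := exists_int_inv hp h₁ M
  obtain ⟨b, hb⟩ := exists_int_inv hp h₂ M
  have hd : ((p ^ (M - e) : ℕ) : ℤ) ∣ ((p ^ M : ℕ) : ℤ) := by
    exact_mod_cast pow_dvd_pow p (Nat.sub_le M e)
  rw [zmod_inv_eq_of_dvd ha, zmod_inv_eq_of_dvd hb, zmod_inv_eq_of_dvd (hd.trans ha),
    zmod_inv_eq_of_dvd (hd.trans hb)]
  have e1 : ((p ^ e * κ : ℤ) : ZMod (p ^ M)) * (a : ZMod (p ^ M)) * (b : ZMod (p ^ M)) =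
      ((p ^ e * κ * a * b : ℤ) : ZMod (p ^ M)) := by push_cast; ring
  have e2 : (κ : ZMod (p ^ (M - e))) * (a : ZMod (p ^ (M - e))) * (b : ZMod (p ^ (M - e))) =
      ((κ * a * b : ℤ) : ZMod (p ^ (M - e))) := by push_cast; ring
  rw [e1, e2, ZMod.stdAddChar_coe, ZMod.stdAddChar_coe]
  congr 1
  have hp0 : (p : ℂ) ≠ 0 := by exact_mod_cast hp.ne_zero
  have hsplit : (p : ℂ) ^ M = p ^ e * p ^ (M - e) := by rw [← pow_add, Nat.add_sub_cancel' he]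
  push_cast
  rw [hsplit]
  field_simp

/-- The summand attached to two fractions with a common denominator pattern. -/
noncomputable def pairTerm (p M : ℕ) [NeZero (p ^ M)] (ζ : ℤ → ℂ) (c : ℤ) (r₁ r₂ : ℤ) : ℂ :=
  open Classical in
  if ¬ (p : ℤ) ∣ r₁ ∧ ¬ (p : ℤ) ∣ r₂ then
    ζ r₁ * (starRingEnd ℂ) (ζ r₂) *
      ZMod.stdAddChar ((c : ZMod (p ^ M)) * (r₁ : ZMod (p ^ M))⁻¹ * (r₂ : ZMod (p ^ M))⁻¹)
  else 0

lemma norm_pairTerm_le {p M : ℕ} [NeZero (p ^ M)] {ζ : ℤ → ℂ} (hζ : ∀ r, ‖ζ r‖ ≤ 1)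
    (c r₁ r₂ : ℤ) : ‖pairTerm p M ζ c r₁ r₂‖ ≤ 1 := by
  unfold pairTerm
  split_ifs
  · rw [norm_mul, norm_mul, AddChar.norm_apply, mul_one, RCLike.norm_conj]
    exact mul_le_one₀ (hζ _) (norm_nonneg _) (hζ _)
  · simp

lemma zmod_eq_of_inv_eq {N : ℕ} {a b : ZMod N} (ha : IsUnit a) (hb : IsUnit b)
    (h : a⁻¹ = b⁻¹) : a = b := by
  calc a = a * (b⁻¹ * b) := by rw [ZMod.inv_mul_of_unit _ hb, mul_one]
    _ = b := by rw [← h, ← mul_assoc, ZMod.mul_inv_of_unit _ ha, one_mul]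

lemma card_progression_class_le {p : ℕ} (hp : p.Prime) {M w S : ℕ} {κ D r : ℤ}
    (hκ : ¬ (p : ℤ) ∣ κ) (hD : D = p ^ w * κ) (T : Finset ℕ) (hT : T ⊆ Finset.range S)
    (hr : ∀ t ∈ T, ¬ (p : ℤ) ∣ r + D * t) (t₀ : ℕ) (ht₀ : t₀ ∈ T) :
    (T.filter fun t : ℕ => (((r + D * t : ℤ) : ZMod (p ^ M)))⁻¹ =
      (((r + D * t₀ : ℤ) : ZMod (p ^ M)))⁻¹).card ≤ S * p ^ w / p ^ M + 1 := by
  apply card_filter_range_dvd_le (pow_pos hp.pos w) _ ((Finset.filter_subset _ _).trans hT) t₀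
  intro t ht
  obtain ⟨ht, heq⟩ := Finset.mem_filter.mp ht
  have h := zmod_eq_of_inv_eq (isUnit_zmod_primePow hp M (hr t ht))
    (isUnit_zmod_primePow hp M (hr t₀ ht₀)) heq
  rw [ZMod.intCast_eq_intCast_iff_dvd_sub] at h
  have h2 : ((p ^ M : ℕ) : ℤ) ∣ κ * (p ^ w * ((t : ℤ) - t₀)) := by
    have e1 : κ * (p ^ w * ((t : ℤ) - t₀)) = -(r + D * t₀ - (r + D * t)) := by rw [hD]; ring
    rw [e1, dvd_neg]
    exact h
  have hco : IsCoprime ((p ^ M : ℕ) : ℤ) κ := by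
    push_cast
    exact IsCoprime.pow_left (((Nat.prime_iff_prime_int.mp hp).coprime_iff_not_dvd).mpr hκ)
  have := hco.dvd_of_dvd_mul_left h2
  push_cast
  push_cast at this
  exact this

/-- Averages of `pairTerm` along a two-dimensional progression are small. -/
lemma norm_sum_pairTerm_sq_le {p : ℕ} (hp : p.Prime) {M e w S : ℕ} (he : e ≤ M) [NeZero (p ^ M)]
    {ζ : ℤ → ℂ} (hζ : ∀ r, ‖ζ r‖ ≤ 1) {c κ D κ' : ℤ} (hκ : ¬ (p : ℤ) ∣ κ) (hc : c = p ^ e * κ)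
    (hκ' : ¬ (p : ℤ) ∣ κ') (hD : D = p ^ w * κ') (r₁ r₂ : ℤ) :
    ‖∑ t ∈ Finset.range S, ∑ s ∈ Finset.range S,
      pairTerm p M ζ c (r₁ + -D * t) (r₂ + D * s)‖ ^ 2 ≤
      (S ^ 2 * p ^ (M - e) * (S * p ^ w / p ^ (M - e) + 1 : ℕ) ^ 2 : ℝ) := by
  classical
  have : NeZero (p ^ (M - e)) := ⟨(pow_pos hp.pos _).ne'⟩
  obtain ⟨T, hT⟩ : ∃ T, T = (Finset.range S).filter fun t : ℕ => ¬ (p : ℤ) ∣ r₁ + -D * t :=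
    ⟨_, rfl⟩
  obtain ⟨U, hU⟩ : ∃ U, U = (Finset.range S).filter fun t : ℕ => ¬ (p : ℤ) ∣ r₂ + D * t :=
    ⟨_, rfl⟩
  have hTm : ∀ t ∈ T, ¬ (p : ℤ) ∣ r₁ + -D * t := by
    intro t ht; rw [hT] at ht; exact (Finset.mem_filter.mp ht).2
  have hUm : ∀ t ∈ U, ¬ (p : ℤ) ∣ r₂ + D * t := by
    intro t ht; rw [hU] at ht; exact (Finset.mem_filter.mp ht).2
  have hTs : T ⊆ Finset.range S := by rw [hT]; exact Finset.filter_subset _ _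
  have hUs : U ⊆ Finset.range S := by rw [hU]; exact Finset.filter_subset _ _
  obtain ⟨x, hx⟩ : ∃ x : ℕ → ZMod (p ^ (M - e)),
      x = fun t : ℕ => (κ : ZMod (p ^ (M - e))) * ((r₁ + -D * t : ℤ) : ZMod (p ^ (M - e)))⁻¹ :=
    ⟨_, rfl⟩
  obtain ⟨y, hy⟩ : ∃ y : ℕ → ZMod (p ^ (M - e)),
      y = fun s : ℕ => ((r₂ + D * s : ℤ) : ZMod (p ^ (M - e)))⁻¹ := ⟨_, rfl⟩
  have key : ∑ t ∈ Finset.range S, ∑ s ∈ Finset.range S,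
      pairTerm p M ζ c (r₁ + -D * t) (r₂ + D * s) =
      ∑ t ∈ T, ∑ s ∈ U, ζ (r₁ + -D * t) * (starRingEnd ℂ) (ζ (r₂ + D * s)) *
        ZMod.stdAddChar (x t * y s) := by
    rw [hT, Finset.sum_filter]
    refine Finset.sum_congr rfl fun t _ => ?_
    rw [hU, Finset.sum_filter]
    by_cases h1 : (p : ℤ) ∣ r₁ + -D * t
    · rw [if_neg (not_not.mpr h1)]
      refine Finset.sum_eq_zero fun s _ => ?_
      unfold pairTerm
      rw [if_neg fun h => h.1 h1]
    · rw [if_pos h1]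
      refine Finset.sum_congr rfl fun s _ => ?_
      unfold pairTerm
      split_ifs with h3 h4 h4
      · exact absurd h4 h3.2
      · rw [hc, stdAddChar_reduce hp he h3.1 h3.2, hx, hy]
      · rfl
      · exact absurd ⟨h1, h4⟩ h3
  have hκu := isUnit_zmod_primePow hp (M - e) hκ
  rw [key]
  refine (norm_bilinear_sq_le T U x y _ _ (fun t _ => hζ _)
    (fun s _ => by rw [RCLike.norm_conj]; exact hζ _) (m := S * p ^ w / p ^ (M - e) + 1)
    ?_ ?_).trans ?_
  · intro i hi
    refine (Finset.card_le_card ?_).trans (card_progression_class_le hp (κ := -κ')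
      (by rwa [dvd_neg]) (by rw [hD]; ring) T hTs hTm i hi)
    intro t ht
    rw [Finset.mem_filter] at ht ⊢
    refine ⟨ht.1, ?_⟩
    have := ht.2
    rw [hx] at this
    exact hκu.mul_left_cancel this
  · intro i hi
    refine (Finset.card_le_card ?_).trans (card_progression_class_le hp hκ' hD U hUs hUm i hi)
    intro t ht
    rw [Finset.mem_filter] at ht ⊢
    refine ⟨ht.1, ?_⟩
    have := ht.2
    rwa [hy] at this
  · have h1 : (T.card : ℝ) ≤ S := by
      have := Finset.card_le_card hTs
      rw [Finset.card_range] at this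
      exact_mod_cast this
    have h2 : (U.card : ℝ) ≤ S := by
      have := Finset.card_le_card hUs
      rw [Finset.card_range] at this
      exact_mod_cast this
    rw [sq (S : ℝ)]
    push_cast
    gcongr

/-- The integer points of a centred square. -/
noncomputable def latBox (B : ℕ) : Finset (ℤ × ℤ) := Finset.Icc (-(B : ℤ)) B ×ˢ Finset.Icc (-(B : ℤ)) B

lemma mem_latBox {B : ℕ} {y : ℤ × ℤ} : y ∈ latBox B ↔ InBox B y := by
  unfold latBox InBox
  rw [Finset.mem_product, Finset.mem_Icc, Finset.mem_Icc, abs_le, abs_le]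

/-- A Lipschitz weight that is at least one on the box `B` and vanishes off the box `2 * B`. -/
noncomputable def tent (B : ℕ) (y : ℤ × ℤ) : ℝ := max 0 (2 - (max |y.1| |y.2| : ℤ) / B)

lemma tent_nonneg (B : ℕ) (y : ℤ × ℤ) : 0 ≤ tent B y := le_max_left _ _

lemma tent_le_two (B : ℕ) (y : ℤ × ℤ) : tent B y ≤ 2 := by
  unfold tent
  apply max_le (by norm_num)
  have : (0 : ℝ) ≤ (max |y.1| |y.2| : ℤ) / B := by
    apply div_nonneg _ (Nat.cast_nonneg _)
    exact_mod_cast (abs_nonneg y.1).trans (le_max_left _ _)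
  linarith

lemma one_le_tent {B : ℕ} (hB : 0 < B) {y : ℤ × ℤ} (hy : InBox B y) : 1 ≤ tent B y := by
  unfold tent
  apply le_max_of_le_right
  have h : ((max |y.1| |y.2| : ℤ) : ℝ) ≤ B := by exact_mod_cast max_le hy.1 hy.2
  have : ((max |y.1| |y.2| : ℤ) : ℝ) / B ≤ 1 := by
    rw [div_le_one (by exact_mod_cast hB)]; exact h
  linarith

lemma tent_eq_zero {B : ℕ} (hB : 0 < B) {y : ℤ × ℤ} (hy : ¬ InBox (2 * B : ℕ) y) :
    tent B y = 0 := by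
  unfold tent
  apply max_eq_left
  have h : ((2 * B : ℕ) : ℤ) ≤ max |y.1| |y.2| := by
    by_contra hcon
    push Not at hcon
    exact hy ⟨(le_max_left _ _).trans hcon.le, (le_max_right _ _).trans hcon.le⟩
  have h2 : (2 * B : ℝ) ≤ ((max |y.1| |y.2| : ℤ) : ℝ) := by exact_mod_cast h
  have hB' : (0 : ℝ) < B := by exact_mod_cast hB
  have : 2 ≤ ((max |y.1| |y.2| : ℤ) : ℝ) / B := by
    rw [le_div_iff₀ hB']; exact h2
  linarith

lemma abs_tent_add_sub_le {B E : ℕ} {z : ℤ × ℤ} (hz : InBox E z) (y : ℤ × ℤ) :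
    |tent B (y + z) - tent B y| ≤ E / B := by
  unfold tent
  have h1 : |(max |(y + z).1| |(y + z).2| - max |y.1| |y.2| : ℤ)| ≤ E := by
    refine (abs_max_sub_max_le_max _ _ _ _).trans (max_le ?_ ?_)
    · refine (abs_abs_sub_abs_le_abs_sub _ _).trans ?_
      simpa using hz.1
    · refine (abs_abs_sub_abs_le_abs_sub _ _).trans ?_
      simpa using hz.2
  have h2 : |((max |(y + z).1| |(y + z).2| : ℤ) : ℝ) - ((max |y.1| |y.2| : ℤ) : ℝ)| ≤ E := by
    exact_mod_cast h1
  refine (abs_max_sub_max_le_max _ _ _ _).trans (max_le (by simp; positivity) ?_)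
  rw [sub_sub_sub_cancel_left, ← sub_div, abs_div, Nat.abs_cast, abs_sub_comm]
  gcongr

lemma cross_self_eq_zero (u : ℤ × ℤ) : cross u u = 0 := by unfold cross; ring

/-- A smooth sum over a sublattice is controlled by averages along the directions `u₁`, `u₂`. -/
lemma norm_sum_lattice_le {Q B S ϖ n : ℕ} (hQ : 0 < Q) (hB : 0 < B) (hS : 0 < S) {δ : ℤ}
    {u₁ u₂ : ℤ × ℤ} (hu₁ : InBox n u₁) (hu₂ : InBox n u₂) (hδ : cross u₁ u₂ = Q * δ)
    (hsmall : 2 * ϖ * S * n ≤ B) (c : ℤ × ℤ → Prop) [DecidablePred c]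
    (hc : ∀ y z : ℤ × ℤ, c (y.1 + ϖ * z.1, y.2 + ϖ * z.2) ↔ c y)
    (g : ℤ → ℤ → ℂ) (hg : ∀ a b, ‖g a b‖ ≤ 1) {σ : ℝ}
    (hσ : ∀ r₁ r₂ : ℤ, ‖∑ t ∈ Finset.range S, ∑ s ∈ Finset.range S,
      g (r₁ + -(ϖ * δ) * t) (r₂ + ϖ * δ * s)‖ ≤ S ^ 2 * σ) :
    ‖∑ y ∈ (latBox (2 * B)).filter
        (fun y => (Q : ℤ) ∣ cross y u₁ ∧ (Q : ℤ) ∣ cross y u₂ ∧ c y),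
      (tent B y : ℂ) * g (cross y u₁ / Q) (cross y u₂ / Q)‖ ≤
      ((latBox (3 * B)).filter fun y => (Q : ℤ) ∣ cross y u₁).card *
        (2 * σ + 2 * ϖ * S * n / B) := by
  classical
  have hQ' : (Q : ℤ) ≠ 0 := by exact_mod_cast hQ.ne'
  set cond : ℤ × ℤ → Prop := fun y => (Q : ℤ) ∣ cross y u₁ ∧ (Q : ℤ) ∣ cross y u₂ ∧ c y with hcond
  set h : ℤ × ℤ → ℂ := fun y =>
    if cond y then (tent B y : ℂ) * g (cross y u₁ / Q) (cross y u₂ / Q) else 0 with hh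
  set z : ℕ → ℕ → ℤ × ℤ := fun t s =>
    ((ϖ * (s * u₁.1 + t * u₂.1) : ℤ), (ϖ * (s * u₁.2 + t * u₂.2) : ℤ)) with hz
  have hzbox : ∀ t ∈ Finset.range S, ∀ s ∈ Finset.range S, InBox (2 * ϖ * S * n : ℕ) (z t s) := by
    intro t ht s hs
    rw [Finset.mem_range] at ht hs
    have key : ∀ a b : ℤ, |a| ≤ n → |b| ≤ n →
        |(ϖ * (s * a + t * b) : ℤ)| ≤ (2 * ϖ * S * n : ℕ) := by
      intro a b ha hb
      have e1 : |(s * a + t * b : ℤ)| ≤ S * n + S * n := by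
        refine (abs_add_le _ _).trans ?_
        rw [abs_mul, abs_mul, Nat.abs_cast, Nat.abs_cast]
        gcongr
      rw [abs_mul, Nat.abs_cast]
      push_cast
      calc (ϖ : ℤ) * |(s * a + t * b : ℤ)| ≤ ϖ * (S * n + S * n) := by gcongr
        _ = _ := by ring
    exact ⟨key _ _ hu₁.1 hu₂.1, key _ _ hu₁.2 hu₂.2⟩
  have hcross1 : ∀ y t s, cross (y + z t s) u₁ = cross y u₁ + Q * (-(ϖ * δ) * t) := by
    intro y t s
    have : cross u₂ u₁ = -(Q * δ) := by rw [cross_swap, hδ]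
    unfold cross at *
    simp only [hz, Prod.fst_add, Prod.snd_add]
    linear_combination (ϖ * t : ℤ) * this
  have hcross2 : ∀ y t s, cross (y + z t s) u₂ = cross y u₂ + Q * (ϖ * δ * s) := by
    intro y t s
    unfold cross at *
    simp only [hz, Prod.fst_add, Prod.snd_add]
    linear_combination (ϖ * s : ℤ) * hδ
  have hcondz : ∀ y t s, cond (y + z t s) ↔ cond y := by
    intro y t s
    simp only [hcond]
    rw [hcross1, hcross2, dvd_add_left (dvd_mul_right _ _), dvd_add_left (dvd_mul_right _ _)]
    have : c (y + z t s) ↔ c y := hc y (s * u₁.1 + t * u₂.1, s * u₁.2 + t * u₂.2)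
    rw [this]
  have hsum : ∑ y ∈ (latBox (2 * B)).filter cond,
      (tent B y : ℂ) * g (cross y u₁ / Q) (cross y u₂ / Q) = ∑' y, h y := by
    rw [Finset.sum_filter, tsum_eq_sum (s := latBox (2 * B))]
    intro y hy
    simp only [hh]
    rw [tent_eq_zero hB (fun hcon => hy (mem_latBox.mpr hcon))]
    simp
  have hshift : ∀ t ∈ Finset.range S, ∀ s ∈ Finset.range S,
      ∑' y, h y = ∑ y ∈ latBox (3 * B), h (y + z t s) := by
    intro t ht s hs
    rw [← (Equiv.addRight (z t s)).tsum_eq h, tsum_eq_sum (s := latBox (3 * B))]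
    · rfl
    · intro y hy
      simp only [hh, Equiv.coe_addRight]
      rw [tent_eq_zero hB]
      · simp
      · intro hcon
        apply hy
        rw [mem_latBox]
        have hb := hzbox t ht s hs
        have h3 : ((2 * ϖ * S * n : ℕ) : ℤ) ≤ B := by exact_mod_cast hsmall
        obtain ⟨a1, a2⟩ := hcon
        obtain ⟨b1, b2⟩ := hb
        simp only [Prod.fst_add, Prod.snd_add] at a1 a2
        rw [abs_le] at *
        push_cast at *
        constructor
        · rw [abs_le]; constructor <;> linarith [a1.1, a1.2, b1.1, b1.2]
        · rw [abs_le]; constructor <;> linarith [a2.1, a2.2, b2.1, b2.2]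
  have hpoint : ∀ y, ‖∑ t ∈ Finset.range S, ∑ s ∈ Finset.range S, h (y + z t s)‖ ≤
      if (Q : ℤ) ∣ cross y u₁ then S ^ 2 * (2 * σ + 2 * ϖ * S * n / B) else (0 : ℝ) := by
    intro y
    by_cases hy : cond y
    · rw [if_pos hy.1]
      obtain ⟨r₁, hr₁⟩ := hy.1
      obtain ⟨r₂, hr₂⟩ := hy.2.1
      have e : ∀ t s, h (y + z t s) = (tent B (y + z t s) : ℂ) *
          g (r₁ + -(ϖ * δ) * t) (r₂ + ϖ * δ * s) := by
        intro t s
        simp only [hh]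
        rw [if_pos ((hcondz y t s).mpr hy), hcross1, hcross2, hr₁, hr₂, ← mul_add, ← mul_add,
          Int.mul_ediv_cancel_left _ hQ', Int.mul_ediv_cancel_left _ hQ']
      have e2 : ∑ t ∈ Finset.range S, ∑ s ∈ Finset.range S, h (y + z t s) =
          (tent B y : ℂ) * (∑ t ∈ Finset.range S, ∑ s ∈ Finset.range S,
            g (r₁ + -(ϖ * δ) * t) (r₂ + ϖ * δ * s)) +
          ∑ t ∈ Finset.range S, ∑ s ∈ Finset.range S, ((tent B (y + z t s) - tent B y : ℝ) : ℂ) *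
            g (r₁ + -(ϖ * δ) * t) (r₂ + ϖ * δ * s) := by
        simp_rw [Finset.mul_sum, ← Finset.sum_add_distrib]
        refine Finset.sum_congr rfl fun t _ => Finset.sum_congr rfl fun s _ => ?_
        rw [e]; push_cast; ring
      rw [e2]
      refine (norm_add_le _ _).trans ?_
      have b1 : ‖(tent B y : ℂ) * (∑ t ∈ Finset.range S, ∑ s ∈ Finset.range S,
            g (r₁ + -(ϖ * δ) * t) (r₂ + ϖ * δ * s))‖ ≤ 2 * (S ^ 2 * σ) := by
        rw [norm_mul, Complex.norm_real, Real.norm_of_nonneg (tent_nonneg _ _)]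
        exact mul_le_mul (tent_le_two _ _) (hσ _ _) (norm_nonneg _) (by norm_num)
      have b2 : ‖∑ t ∈ Finset.range S, ∑ s ∈ Finset.range S,
            ((tent B (y + z t s) - tent B y : ℝ) : ℂ) *
            g (r₁ + -(ϖ * δ) * t) (r₂ + ϖ * δ * s)‖ ≤ S ^ 2 * (2 * ϖ * S * n / B) := by
        calc _ ≤ ∑ t ∈ Finset.range S, ∑ s ∈ Finset.range S, (2 * ϖ * S * n / B : ℝ) := by
              refine norm_sum_le_of_le _ fun t ht => norm_sum_le_of_le _ fun s hs => ?_
              rw [norm_mul, Complex.norm_real, Real.norm_eq_abs]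
              have hb := abs_tent_add_sub_le (B := B) (hzbox t ht s hs) y
              push_cast at hb
              calc _ ≤ (2 * ϖ * S * n / B : ℝ) * 1 :=
                    mul_le_mul hb (hg _ _) (norm_nonneg _) (by positivity)
                _ = _ := mul_one _
          _ = _ := by
              simp only [Finset.sum_const, Finset.card_range, nsmul_eq_mul]; ring
      linarith
    · have : ∑ t ∈ Finset.range S, ∑ s ∈ Finset.range S, h (y + z t s) = 0 := by
        refine Finset.sum_eq_zero fun t _ => Finset.sum_eq_zero fun s _ => ?_
        simp only [hh]
        rw [if_neg (fun hcon => hy ((hcondz y t s).mp hcon))]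
      rw [this, norm_zero]
      have hσ0 : 0 ≤ S ^ 2 * σ := (norm_nonneg _).trans (hσ 0 0)
      split_ifs
      · have : (0 : ℝ) ≤ S ^ 2 * (2 * ϖ * S * n / B) := by positivity
        nlinarith
      · exact le_rfl
  have htotal : ((S : ℂ) ^ 2) * ∑' y, h y =
      ∑ y ∈ latBox (3 * B), ∑ t ∈ Finset.range S, ∑ s ∈ Finset.range S, h (y + z t s) := by
    rw [Finset.sum_comm]
    simp_rw [Finset.sum_comm (s := latBox (3 * B))]
    rw [Finset.sum_congr rfl fun t ht => Finset.sum_congr rfl fun s hs => (hshift t ht s hs).symm]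
    simp only [Finset.sum_const, Finset.card_range, nsmul_eq_mul]
    ring
  rw [hsum]
  have hS' : (0 : ℝ) < (S : ℝ) ^ 2 := by positivity
  refine le_of_mul_le_mul_left ?_ hS'
  calc (S : ℝ) ^ 2 * ‖∑' y, h y‖ = ‖((S : ℂ) ^ 2) * ∑' y, h y‖ := by
        rw [norm_mul, norm_pow, Complex.norm_natCast]
    _ ≤ ∑ y ∈ latBox (3 * B), if (Q : ℤ) ∣ cross y u₁ then
          S ^ 2 * (2 * σ + 2 * ϖ * S * n / B) else (0 : ℝ) := by
        rw [htotal]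
        exact norm_sum_le_of_le _ fun y _ => hpoint y
    _ = _ := by
        rw [← Finset.sum_filter, Finset.sum_const, nsmul_eq_mul]; ring

lemma exists_eq_pow_mul_of_ne_zero {p : ℕ} (hp : p.Prime) {a : ℤ} (ha : a ≠ 0) :
    ∃ (e : ℕ) (k : ℤ), a = p ^ e * k ∧ ¬ (p : ℤ) ∣ k := by
  have hf : FiniteMultiplicity (p : ℤ) a :=
    Int.finiteMultiplicity_iff.mpr ⟨by simpa using hp.one_lt.ne', ha⟩
  obtain ⟨k, h1, h2⟩ := hf.exists_eq_pow_mul_and_not_dvd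
  exact ⟨_, k, h1, h2⟩

lemma exists_eq_pow_mul_of_not_dvd {p : ℕ} (hp : p.Prime) {a : ℤ} {m : ℕ}
    (ha : ¬ ((p ^ m : ℕ) : ℤ) ∣ a) :
    ∃ (e : ℕ) (k : ℤ), e < m ∧ a = p ^ e * k ∧ ¬ (p : ℤ) ∣ k := by
  have h0 : a ≠ 0 := by rintro rfl; exact ha (dvd_zero _)
  obtain ⟨e, k, h1, h2⟩ := exists_eq_pow_mul_of_ne_zero hp h0
  refine ⟨e, k, ?_, h1, h2⟩
  by_contra hcon
  push Not at hcon
  apply ha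
  rw [h1]
  push_cast
  exact (pow_dvd_pow _ hcon).mul_right _

/-- The off-diagonal contribution of a pair whose cofactor is not too divisible by `p`. -/
lemma norm_sum_pairTerm_lattice_le {p : ℕ} (hp : p.Prime) {M m h B S b n : ℕ} [NeZero (p ^ M)]
    (hB : 0 < B) (hS : 0 < S) (hMe : m + h ≤ M + 1) {δ ξ : ℤ} {u₁ u₂ : ℤ × ℤ}
    (hu₁ : InBox n u₁) (hu₂ : InBox n u₂) (hδ : cross u₁ u₂ = (p ^ M : ℕ) * δ)
    (hsmall : 2 * p ^ b * S * n ≤ B) (c : ℤ × ℤ → Prop) [DecidablePred c]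
    (hc : ∀ y z : ℤ × ℤ, c (y.1 + (p ^ b : ℕ) * z.1, y.2 + (p ^ b : ℕ) * z.2) ↔ c y)
    {ζ : ℤ → ℂ} (hζ : ∀ r, ‖ζ r‖ ≤ 1) (hξ : ¬ ((p ^ m : ℕ) : ℤ) ∣ ξ)
    (hδh : ¬ ((p ^ (h + 1) : ℕ) : ℤ) ∣ δ) {σ : ℝ} (hσ0 : 0 ≤ σ)
    (hσ : (p : ℝ) ^ (h + b) / √((p : ℝ) ^ (M + 1 - (m + h))) + √((p : ℝ) ^ M) / S ≤ σ) :
    ‖∑ y ∈ (latBox (2 * B)).filter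
        (fun y => ((p ^ M : ℕ) : ℤ) ∣ cross y u₁ ∧ ((p ^ M : ℕ) : ℤ) ∣ cross y u₂ ∧ c y),
      (tent B y : ℂ) * pairTerm p M ζ (ξ * δ) (cross y u₁ / (p ^ M : ℕ))
        (cross y u₂ / (p ^ M : ℕ))‖ ≤
      ((latBox (3 * B)).filter fun y => ((p ^ M : ℕ) : ℤ) ∣ cross y u₁).card *
        (2 * σ + 2 * p ^ b * S * n / B) := by
  obtain ⟨e₁, ξ', he₁, rfl, hξ'⟩ := exists_eq_pow_mul_of_not_dvd hp hξ
  obtain ⟨v, δ', hv, hδv, hδ'⟩ := exists_eq_pow_mul_of_not_dvd hp hδh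
  have hpp := Nat.prime_iff_prime_int.mp hp
  have hκ : ¬ (p : ℤ) ∣ ξ' * δ' := fun hcon => (hpp.dvd_or_dvd hcon).elim hξ' hδ'
  have he : e₁ + v ≤ M := by omega
  have hp1 : (1 : ℝ) ≤ p := by exact_mod_cast hp.one_lt.le
  have hp0 : (0 : ℝ) < p := by linarith
  have hSr : (0 : ℝ) < S := by exact_mod_cast hS
  have := norm_sum_lattice_le (ϖ := p ^ b) (σ := σ) (pow_pos hp.pos M) hB hS hu₁ hu₂ hδ hsmall c hc
    (pairTerm p M ζ (p ^ e₁ * ξ' * δ)) (norm_pairTerm_le hζ _) ?_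
  · push_cast at this ⊢
    exact this
  intro r₁ r₂
  have hmain := norm_sum_pairTerm_sq_le hp he (S := S) hζ (c := p ^ e₁ * ξ' * δ) hκ
    (by rw [hδv]; ring) hδ' (D := (p ^ b : ℕ) * δ) (w := v + b) (by rw [hδv]; push_cast; ring)
    r₁ r₂
  apply le_of_sq_le_sq _ (by positivity)
  refine hmain.trans ?_
  set P : ℝ := (p : ℝ) ^ (M - (e₁ + v)) with hP
  have hPpos : 0 < P := by positivity
  have hPs : √P * √P = P := Real.mul_self_sqrt hPpos.le
  have hPspos : 0 < √P := Real.sqrt_pos.mpr hPpos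
  have hm : ((S * p ^ (v + b) / p ^ (M - (e₁ + v)) + 1 : ℕ) : ℝ) ≤ S * p ^ (v + b) / P + 1 := by
    push_cast
    gcongr
    have : ((S * p ^ (v + b) / p ^ (M - (e₁ + v)) : ℕ) : ℝ) ≤
      ((S * p ^ (v + b) : ℕ) : ℝ) / ((p ^ (M - (e₁ + v)) : ℕ) : ℝ) := Nat.cast_div_le
    push_cast at this
    rw [← hP] at this
    exact this
  have h1 : (p : ℝ) ^ (v + b) / √P ≤ (p : ℝ) ^ (h + b) / √((p : ℝ) ^ (M + 1 - (m + h))) := by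
    apply div_le_div₀ (by positivity) (pow_le_pow_right₀ hp1 (by omega))
      (Real.sqrt_pos.mpr (by positivity))
    exact Real.sqrt_le_sqrt (pow_le_pow_right₀ hp1 (by omega))
  have h2 : √P / S ≤ √((p : ℝ) ^ M) / S := by
    rw [hP]
    gcongr
    omega
  have h3 : √P * (S * p ^ (v + b) / P + 1) ≤ S * σ := by
    have e1 : √P * (S * p ^ (v + b) / P + 1) = S * ((p : ℝ) ^ (v + b) / √P + √P / S) := by
      field_simp
      rw [Real.sq_sqrt hPpos.le]
    rw [e1]
    gcongr
    linarith
  calc (S : ℝ) ^ 2 * P * ((S * p ^ (v + b) / p ^ (M - (e₁ + v)) + 1 : ℕ) : ℝ) ^ 2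
      ≤ (S : ℝ) ^ 2 * P * (S * p ^ (v + b) / P + 1) ^ 2 := by gcongr
    _ = S ^ 2 * (√P * (S * p ^ (v + b) / P + 1)) ^ 2 := by rw [mul_pow, sq √P, hPs]; ring
    _ ≤ S ^ 2 * (S * σ) ^ 2 := by gcongr
    _ = _ := by ring

/-- Not both coordinates are divisible by `p`. -/
def PrimMod (p : ℕ) (y : ℤ × ℤ) : Prop := ¬ ((p : ℤ) ∣ y.1 ∧ (p : ℤ) ∣ y.2)

/-- `p ^ M` exactly divides the cross product. -/
def ExactPair (p M : ℕ) (y u : ℤ × ℤ) : Prop :=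
  ((p ^ M : ℕ) : ℤ) ∣ cross y u ∧ ¬ ((p ^ (M + 1) : ℕ) : ℤ) ∣ cross y u

lemma exactPair_iff {p M : ℕ} (hp : p.Prime) {y u : ℤ × ℤ} : ExactPair p M y u ↔
    ((p ^ M : ℕ) : ℤ) ∣ cross y u ∧ ¬ (p : ℤ) ∣ cross y u / (p ^ M : ℕ) := by
  unfold ExactPair
  refine and_congr_right fun h => not_congr ?_
  obtain ⟨r, hr⟩ := h
  have h0 : ((p ^ M : ℕ) : ℤ) ≠ 0 := by exact_mod_cast (pow_pos hp.pos M).ne'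
  rw [hr, Int.mul_ediv_cancel_left _ h0, pow_succ, Nat.cast_mul, mul_dvd_mul_iff_left h0]

/-- The value of the additive character at the fraction attached to the pair `(y, u)`. -/
noncomputable def pairPhase (p M : ℕ) [NeZero (p ^ M)] (z : ℤ × ℤ → ℤ × ℤ) (ξ : ℤ)
    (y u : ℤ × ℤ) : ℂ :=
  ZMod.stdAddChar (((ξ * cross u (z y) : ℤ) : ZMod (p ^ M)) *
    ((cross y u / (p ^ M : ℕ) : ℤ) : ZMod (p ^ M))⁻¹)

open Classical in
/-- The twisted summand attached to the pair `(y, u)`. -/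
noncomputable def phaseTerm (p M : ℕ) [NeZero (p ^ M)] (ζ : ℤ → ℂ) (z : ℤ × ℤ → ℤ × ℤ) (ξ : ℤ)
    (y u : ℤ × ℤ) : ℂ :=
  if ExactPair p M y u then ζ (cross y u / (p ^ M : ℕ)) * pairPhase p M z ξ y u else 0

lemma cross_plucker (y u v : ℤ × ℤ) :
    cross y u * v.1 - cross y v * u.1 = -cross u v * y.1 ∧
    cross y u * v.2 - cross y v * u.2 = -cross u v * y.2 := by
  unfold cross
  constructor <;> ring

lemma dvd_cross_of_primMod {p M : ℕ} (hp : p.Prime) {y u v : ℤ × ℤ} (hy : PrimMod p y)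
    (hu : ((p ^ M : ℕ) : ℤ) ∣ cross y u) (hv : ((p ^ M : ℕ) : ℤ) ∣ cross y v) :
    ((p ^ M : ℕ) : ℤ) ∣ cross u v := by
  obtain ⟨h1, h2⟩ := cross_plucker y u v
  have hco : ∀ a : ℤ, ¬ (p : ℤ) ∣ a → IsCoprime ((p ^ M : ℕ) : ℤ) a := by
    intro a ha
    push_cast
    exact IsCoprime.pow_left (((Nat.prime_iff_prime_int.mp hp).coprime_iff_not_dvd).mpr ha)
  have hd : ∀ a b c : ℤ, cross y u * a - cross y v * b = -cross u v * c → ¬ (p : ℤ) ∣ c →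
      ((p ^ M : ℕ) : ℤ) ∣ cross u v := by
    intro a b c h hc
    have : ((p ^ M : ℕ) : ℤ) ∣ -cross u v * c := h ▸ dvd_sub (hu.mul_right _) (hv.mul_right _)
    exact dvd_neg.mp ((hco c hc).dvd_of_dvd_mul_right this)
  unfold PrimMod at hy
  rw [not_and_or] at hy
  rcases hy with hy | hy
  · exact hd _ _ _ h1 hy
  · exact hd _ _ _ h2 hy

lemma pairPhase_mul_conj {p M : ℕ} (hp : p.Prime) [NeZero (p ^ M)] {z : ℤ × ℤ → ℤ × ℤ}
    {y u₁ u₂ : ℤ × ℤ} (hz : ((p ^ M : ℕ) : ℤ) ∣ cross y (z y) - 1) {δ : ℤ}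
    (hδ : cross u₁ u₂ = (p ^ M : ℕ) * δ) (h₁ : ExactPair p M y u₁) (h₂ : ExactPair p M y u₂)
    (ξ : ℤ) :
    pairPhase p M z ξ y u₁ * (starRingEnd ℂ) (pairPhase p M z ξ y u₂) =
      ZMod.stdAddChar (((ξ * δ : ℤ) : ZMod (p ^ M)) *
        ((cross y u₁ / (p ^ M : ℕ) : ℤ) : ZMod (p ^ M))⁻¹ *
        ((cross y u₂ / (p ^ M : ℕ) : ℤ) : ZMod (p ^ M))⁻¹) := by
  have h0 : ((p ^ M : ℕ) : ℤ) ≠ 0 := by exact_mod_cast (pow_pos hp.pos M).ne'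
  obtain ⟨⟨r₁, hr₁⟩, n₁⟩ := (exactPair_iff hp).mp h₁
  obtain ⟨⟨r₂, hr₂⟩, n₂⟩ := (exactPair_iff hp).mp h₂
  rw [hr₁, Int.mul_ediv_cancel_left _ h0] at n₁
  rw [hr₂, Int.mul_ediv_cancel_left _ h0] at n₂
  unfold pairPhase
  rw [← AddChar.map_neg_eq_conj, ← AddChar.map_add_eq_mul, hr₁, hr₂,
    Int.mul_ediv_cancel_left _ h0, Int.mul_ediv_cancel_left _ h0]
  congr 1
  have u₁' := isUnit_zmod_primePow hp M n₁
  have u₂' := isUnit_zmod_primePow hp M n₂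
  have e₁ := ZMod.mul_inv_of_unit _ u₁'
  have e₂ := ZMod.mul_inv_of_unit _ u₂'
  have hkey : ((p ^ M : ℕ) : ℤ) ∣ cross u₁ (z y) * r₂ - cross u₂ (z y) * r₁ - δ := by
    obtain ⟨k, hk⟩ := hz
    obtain ⟨p1, p2⟩ := cross_plucker y u₁ u₂
    rw [hr₁, hr₂, hδ] at p1 p2
    have q1 : r₁ * u₂.1 - r₂ * u₁.1 = -δ * y.1 := mul_left_cancel₀ h0 (by linear_combination p1)
    have q2 : r₁ * u₂.2 - r₂ * u₁.2 = -δ * y.2 := mul_left_cancel₀ h0 (by linear_combination p2)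
    refine ⟨δ * k, ?_⟩
    unfold cross at *
    linear_combination (-(z y).2) * q1 + (z y).1 * q2 + δ * hk
  have hk2 := (ZMod.intCast_zmod_eq_zero_iff_dvd _ (p ^ M)).mpr hkey
  push_cast at hk2 ⊢
  set i₁ := ((r₁ : ZMod (p ^ M)))⁻¹
  set i₂ := ((r₂ : ZMod (p ^ M)))⁻¹
  linear_combination (ξ * i₁ * i₂ : ZMod (p ^ M)) * hk2 - (ξ * cross u₁ (z y) * i₁) * e₂ +
    (ξ * cross u₂ (z y) * i₂) * e₁

lemma phaseTerm_mul_conj {p M : ℕ} (hp : p.Prime) [NeZero (p ^ M)] (ζ : ℤ → ℂ)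
    {z : ℤ × ℤ → ℤ × ℤ} {y u₁ u₂ : ℤ × ℤ} (hz : ((p ^ M : ℕ) : ℤ) ∣ cross y (z y) - 1) {δ : ℤ}
    (hδ : cross u₁ u₂ = (p ^ M : ℕ) * δ) (ξ : ℤ) (h₁ : ((p ^ M : ℕ) : ℤ) ∣ cross y u₁)
    (h₂ : ((p ^ M : ℕ) : ℤ) ∣ cross y u₂) :
    phaseTerm p M ζ z ξ y u₁ * (starRingEnd ℂ) (phaseTerm p M ζ z ξ y u₂) =
      pairTerm p M ζ (ξ * δ) (cross y u₁ / (p ^ M : ℕ)) (cross y u₂ / (p ^ M : ℕ)) := by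
  unfold phaseTerm pairTerm
  by_cases n₁ : (p : ℤ) ∣ cross y u₁ / (p ^ M : ℕ)
  · have x₁ : ¬ ExactPair p M y u₁ := fun h => ((exactPair_iff hp).mp h).2 n₁
    have y₁ : ¬ (¬ (p : ℤ) ∣ cross y u₁ / (p ^ M : ℕ) ∧ ¬ (p : ℤ) ∣ cross y u₂ / (p ^ M : ℕ)) :=
      fun h => h.1 n₁
    rw [if_neg x₁, if_neg y₁, zero_mul]
  by_cases n₂ : (p : ℤ) ∣ cross y u₂ / (p ^ M : ℕ)
  · have x₂ : ¬ ExactPair p M y u₂ := fun h => ((exactPair_iff hp).mp h).2 n₂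
    have y₂ : ¬ (¬ (p : ℤ) ∣ cross y u₁ / (p ^ M : ℕ) ∧ ¬ (p : ℤ) ∣ cross y u₂ / (p ^ M : ℕ)) :=
      fun h => h.2 n₂
    rw [if_neg x₂, if_neg y₂, map_zero, mul_zero]
  have x₁ : ExactPair p M y u₁ := (exactPair_iff hp).mpr ⟨h₁, n₁⟩
  have x₂ : ExactPair p M y u₂ := (exactPair_iff hp).mpr ⟨h₂, n₂⟩
  rw [if_pos x₁, if_pos x₂, if_pos ⟨n₁, n₂⟩, ← pairPhase_mul_conj hp hz hδ x₁ x₂ ξ, map_mul]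
  ring

lemma norm_phaseTerm_le {p M : ℕ} [NeZero (p ^ M)] {ζ : ℤ → ℂ} (hζ : ∀ r, ‖ζ r‖ ≤ 1)
    (z : ℤ × ℤ → ℤ × ℤ) (ξ : ℤ) (y u : ℤ × ℤ) : ‖phaseTerm p M ζ z ξ y u‖ ≤ 1 := by
  unfold phaseTerm pairPhase
  split_ifs
  · rw [norm_mul, AddChar.norm_apply, mul_one]; exact hζ _
  · simp

lemma phaseTerm_eq_zero {p M : ℕ} [NeZero (p ^ M)] (ζ : ℤ → ℂ) (z : ℤ × ℤ → ℤ × ℤ) (ξ : ℤ)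
    {y u : ℤ × ℤ} (h : ¬ ((p ^ M : ℕ) : ℤ) ∣ cross y u) : phaseTerm p M ζ z ξ y u = 0 := by
  unfold phaseTerm
  rw [if_neg fun hx => h hx.1]

open Classical in
/-- The correlation of the twisted summands of `u₁` and `u₂` over a smoothed box. -/
noncomputable def phaseCorr (p M B : ℕ) [NeZero (p ^ M)] (ζ : ℤ → ℂ) (z : ℤ × ℤ → ℤ × ℤ) (ξ : ℤ)
    (u₁ u₂ : ℤ × ℤ) : ℂ :=
  ∑ y ∈ (latBox (2 * B)).filter (PrimMod p), (tent B y : ℂ) *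
    (phaseTerm p M ζ z ξ y u₁ * (starRingEnd ℂ) (phaseTerm p M ζ z ξ y u₂))

section
variable {p M B : ℕ} [NeZero (p ^ M)] {ζ : ℤ → ℂ} {z : ℤ × ℤ → ℤ × ℤ} {ξ : ℤ}

lemma latBox_mono {B B' : ℕ} (h : B ≤ B') : latBox B ⊆ latBox B' := by
  intro y hy
  rw [mem_latBox] at hy ⊢
  exact ⟨hy.1.trans (by exact_mod_cast h), hy.2.trans (by exact_mod_cast h)⟩

lemma norm_phaseCorr_le (hζ : ∀ r, ‖ζ r‖ ≤ 1) (u₁ u₂ : ℤ × ℤ) :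
    ‖phaseCorr p M B ζ z ξ u₁ u₂‖ ≤
      2 * ((latBox (3 * B)).filter fun y => ((p ^ M : ℕ) : ℤ) ∣ cross y u₁).card := by
  classical
  unfold phaseCorr
  refine (norm_sum_le _ _).trans ?_
  rw [mul_comm (2 : ℝ), ← nsmul_eq_mul, ← Finset.sum_const, Finset.sum_filter, Finset.sum_filter]
  refine (Finset.sum_le_sum (g := fun y => if ((p ^ M : ℕ) : ℤ) ∣ cross y u₁ then (2 : ℝ) else 0)
    fun y _ => ?_).trans (Finset.sum_le_sum_of_subset_of_nonneg (latBox_mono (by omega))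
      fun y _ _ => by positivity)
  by_cases h : ((p ^ M : ℕ) : ℤ) ∣ cross y u₁
  · rw [if_pos h]
    split_ifs with hy
    · rw [norm_mul, norm_mul, RCLike.norm_conj, Complex.norm_real, Real.norm_of_nonneg (tent_nonneg _ _)]
      have h1 := norm_phaseTerm_le hζ z ξ y u₁ (p := p) (M := M)
      have h2 := norm_phaseTerm_le hζ z ξ y u₂ (p := p) (M := M)
      have h3 : ‖phaseTerm p M ζ z ξ y u₁‖ * ‖phaseTerm p M ζ z ξ y u₂‖ ≤ 1 :=
        mul_le_one₀ h1 (norm_nonneg _) h2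
      have := mul_le_mul (tent_le_two B y) h3 (by positivity) (by norm_num)
      linarith
    · positivity
  · rw [if_neg h, phaseTerm_eq_zero ζ z ξ h]
    simp

lemma phaseCorr_eq_zero (hp : p.Prime) {u₁ u₂ : ℤ × ℤ}
    (h : ¬ ((p ^ M : ℕ) : ℤ) ∣ cross u₁ u₂) : phaseCorr p M B ζ z ξ u₁ u₂ = 0 := by
  classical
  unfold phaseCorr
  refine Finset.sum_eq_zero fun y hy => ?_
  have hy := (Finset.mem_filter.mp hy).2
  by_cases h1 : ((p ^ M : ℕ) : ℤ) ∣ cross y u₁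
  · by_cases h2 : ((p ^ M : ℕ) : ℤ) ∣ cross y u₂
    · exact absurd (dvd_cross_of_primMod hp hy h1 h2) h
    · rw [phaseTerm_eq_zero ζ z ξ h2, map_zero, mul_zero, mul_zero]
  · rw [phaseTerm_eq_zero ζ z ξ h1, zero_mul, mul_zero]

lemma norm_phaseCorr_light_le (hp : p.Prime) {m h S b n : ℕ}
    (hB : 0 < B) (hS : 0 < S) (hMe : m + h ≤ M + 1) {u₁ u₂ : ℤ × ℤ}
    (hu₁ : InBox n u₁) (hu₂ : InBox n u₂) (hd : ((p ^ M : ℕ) : ℤ) ∣ cross u₁ u₂)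
    (hsmall : 2 * p ^ b * S * n ≤ B) (c : ℤ × ℤ → Prop)
    (hc : ∀ y z : ℤ × ℤ, c (y.1 + (p ^ b : ℕ) * z.1, y.2 + (p ^ b : ℕ) * z.2) ↔ c y)
    (hcp : ∀ y, PrimMod p y → c y)
    (hz : ∀ y, PrimMod p y → ((p ^ M : ℕ) : ℤ) ∣ cross y (z y) - 1)
    (hζ : ∀ r, ‖ζ r‖ ≤ 1) (hξ : ¬ ((p ^ m : ℕ) : ℤ) ∣ ξ)
    (hdh : ¬ ((p ^ (M + h + 1) : ℕ) : ℤ) ∣ cross u₁ u₂) {σ : ℝ} (hσ0 : 0 ≤ σ)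
    (hσ : (p : ℝ) ^ (h + b) / √((p : ℝ) ^ (M + 1 - (m + h))) + √((p : ℝ) ^ M) / S ≤ σ) {N E : ℝ}
    (hN : (((latBox (3 * B)).filter fun y => ((p ^ M : ℕ) : ℤ) ∣ cross y u₁).card : ℝ) ≤ N)
    (hE : ∀ s : Finset (ℤ × ℤ), (∀ y ∈ s, InBox (2 * B : ℕ) y ∧ c y ∧ ¬ PrimMod p y ∧
      ((p ^ M : ℕ) : ℤ) ∣ cross y u₁) → 2 * (s.card : ℝ) ≤ E) :
    ‖phaseCorr p M B ζ z ξ u₁ u₂‖ ≤ N * (2 * σ + 2 * p ^ b * S * n / B) + E := by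
  classical
  obtain ⟨δ, hδ⟩ := hd
  have hδh : ¬ ((p ^ (h + 1) : ℕ) : ℤ) ∣ δ := by
    intro hx
    apply hdh
    rw [hδ, show M + h + 1 = M + (h + 1) by ring, pow_add, Nat.cast_mul]
    exact mul_dvd_mul_left _ hx
  have hlat := norm_sum_pairTerm_lattice_le hp hB hS hMe hu₁ hu₂ hδ hsmall c hc hζ hξ hδh hσ0 hσ
  obtain ⟨T, hT⟩ : ∃ T : ℤ × ℤ → ℂ, T = fun y => (tent B y : ℂ) *
      pairTerm p M ζ (ξ * δ) (cross y u₁ / (p ^ M : ℕ)) (cross y u₂ / (p ^ M : ℕ)) := ⟨_, rfl⟩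
  obtain ⟨D, hD⟩ : ∃ D : ℤ × ℤ → Prop, D = fun y =>
      ((p ^ M : ℕ) : ℤ) ∣ cross y u₁ ∧ ((p ^ M : ℕ) : ℤ) ∣ cross y u₂ := ⟨_, rfl⟩
  have e1 : phaseCorr p M B ζ z ξ u₁ u₂ =
      ∑ y ∈ (latBox (2 * B)).filter (fun y => D y ∧ PrimMod p y), T y := by
    unfold phaseCorr
    rw [Finset.sum_filter, Finset.sum_filter]
    refine Finset.sum_congr rfl fun y _ => ?_
    by_cases hy : PrimMod p y
    · by_cases hDy : D y
      · rw [if_pos hy, if_pos ⟨hDy, hy⟩, hT]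
        rw [hD] at hDy
        rw [phaseTerm_mul_conj hp ζ (hz y hy) hδ ξ hDy.1 hDy.2]
      · rw [if_pos hy, if_neg (fun x => hDy x.1)]
        rw [hD] at hDy
        simp only [not_and_or] at hDy
        rcases hDy with hDy | hDy
        · rw [phaseTerm_eq_zero ζ z ξ hDy, zero_mul, mul_zero]
        · rw [phaseTerm_eq_zero ζ z ξ hDy, map_zero, mul_zero, mul_zero]
    · rw [if_neg hy, if_neg (fun x => hy x.2)]
  have e2 : ∑ y ∈ (latBox (2 * B)).filter (fun y => D y ∧ PrimMod p y), T y =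
      ∑ y ∈ (latBox (2 * B)).filter (fun y => D y ∧ c y), T y -
      ∑ y ∈ (latBox (2 * B)).filter (fun y => D y ∧ c y ∧ ¬ PrimMod p y), T y := by
    rw [Finset.sum_filter, Finset.sum_filter, Finset.sum_filter, ← Finset.sum_sub_distrib]
    refine Finset.sum_congr rfl fun y _ => ?_
    by_cases hDy : D y
    · by_cases hy : PrimMod p y
      · have := hcp y hy
        simp [hDy, hy, this]
      · by_cases hcy : c y <;> simp [hDy, hy, hcy]
    · simp [hDy]
  have hT2 : ∀ y, ‖T y‖ ≤ 2 := by
    intro y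
    rw [hT]
    simp only [norm_mul, Complex.norm_real, Real.norm_of_nonneg (tent_nonneg _ _)]
    have := mul_le_mul (tent_le_two B y) (norm_pairTerm_le (p := p) (M := M) hζ (ξ * δ)
      (cross y u₁ / (p ^ M : ℕ)) (cross y u₂ / (p ^ M : ℕ))) (norm_nonneg _) (by norm_num)
    linarith
  rw [e1, e2]
  refine (norm_sub_le _ _).trans (add_le_add ?_ ?_)
  · have e3 : (latBox (2 * B)).filter (fun y => D y ∧ c y) = (latBox (2 * B)).filter
        (fun y => ((p ^ M : ℕ) : ℤ) ∣ cross y u₁ ∧ ((p ^ M : ℕ) : ℤ) ∣ cross y u₂ ∧ c y) := by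
      refine Finset.filter_congr fun y _ => ?_
      rw [hD, and_assoc]
    rw [e3, hT]
    refine le_trans ?_ (mul_le_mul_of_nonneg_right hN (by positivity))
    convert hlat using 3
  · refine (norm_sum_le _ _).trans ?_
    refine (Finset.sum_le_sum fun y _ => hT2 y).trans ?_
    rw [Finset.sum_const, nsmul_eq_mul, mul_comm]
    refine hE _ fun y hy => ?_
    obtain ⟨h1, h2, h3, h4⟩ := Finset.mem_filter.mp hy
    rw [hD] at h2
    exact ⟨mem_latBox.mp h1, h3, h4, h2.1⟩

lemma norm_theta_sq_le (hp : p.Prime) {m h S b n Z : ℕ} {A 𝒴 : Finset (ℤ × ℤ)}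
    (hA : VecFam A n Z) (hB : 0 < B) (hS : 0 < S) (hMe : m + h ≤ M + 1)
    (h𝒴 : ∀ y ∈ 𝒴, InBox B y ∧ PrimMod p y)
    (hsmall : 2 * p ^ b * S * n ≤ B) (c : ℤ × ℤ → Prop)
    (hc : ∀ y z : ℤ × ℤ, c (y.1 + (p ^ b : ℕ) * z.1, y.2 + (p ^ b : ℕ) * z.2) ↔ c y)
    (hcp : ∀ y, PrimMod p y → c y)
    (hz : ∀ y, PrimMod p y → ((p ^ M : ℕ) : ℤ) ∣ cross y (z y) - 1)
    (hζ : ∀ r, ‖ζ r‖ ≤ 1) (hξ : ¬ ((p ^ m : ℕ) : ℤ) ∣ ξ) {σ : ℝ} (hσ0 : 0 ≤ σ)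
    (hσ : (p : ℝ) ^ (h + b) / √((p : ℝ) ^ (M + 1 - (m + h))) + √((p : ℝ) ^ M) / S ≤ σ) {N E : ℝ}
    (hN : ∀ u ∈ A,
      (((latBox (3 * B)).filter fun y => ((p ^ M : ℕ) : ℤ) ∣ cross y u).card : ℝ) ≤ N)
    (hE : ∀ u ∈ A, ∀ s : Finset (ℤ × ℤ), (∀ y ∈ s, InBox (2 * B : ℕ) y ∧ c y ∧ ¬ PrimMod p y ∧
      ((p ^ M : ℕ) : ℤ) ∣ cross y u) → 2 * (s.card : ℝ) ≤ E) (hN0 : 0 ≤ N) (hE0 : 0 ≤ E) :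
    ‖∑ y ∈ 𝒴, ∑ u ∈ A, phaseTerm p M ζ z ξ y u‖ ^ 2 ≤ 𝒴.card * (A.card * (2 * N +
      2 * Z * n ^ 2 / (p ^ (M + h + 1) : ℕ) * (2 * N) +
      2 * Z * n ^ 2 / (p ^ M : ℕ) * (N * (2 * σ + 2 * p ^ b * S * n / B) + E))) := by
  classical
  refine (norm_sum_sq_le_card_mul _ _).trans (mul_le_mul_of_nonneg_left ?_ (by positivity))
  obtain ⟨F, hF⟩ : ∃ F : ℤ × ℤ → ℂ, F = fun y => ∑ u ∈ A, phaseTerm p M ζ z ξ y u := ⟨_, rfl⟩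
  have s1 : ∑ y ∈ 𝒴, ‖F y‖ ^ 2 ≤
      ∑ y ∈ (latBox (2 * B)).filter (PrimMod p), tent B y * ‖F y‖ ^ 2 := by
    refine (Finset.sum_le_sum (g := fun y => tent B y * ‖F y‖ ^ 2) fun y hy => ?_).trans
      (Finset.sum_le_sum_of_subset_of_nonneg ?_ fun y _ _ => mul_nonneg (tent_nonneg _ _) (by positivity))
    · have := one_le_tent hB (h𝒴 y hy).1
      exact le_mul_of_one_le_left (by positivity) this
    · intro y hy
      exact Finset.mem_filter.mpr ⟨latBox_mono (by omega) (mem_latBox.mpr (h𝒴 y hy).1), (h𝒴 y hy).2⟩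
  have s2 : ((∑ y ∈ (latBox (2 * B)).filter (PrimMod p), tent B y * ‖F y‖ ^ 2 : ℝ) : ℂ) =
      ∑ u₁ ∈ A, ∑ u₂ ∈ A, phaseCorr p M B ζ z ξ u₁ u₂ := by
    unfold phaseCorr
    rw [Complex.ofReal_sum]
    simp_rw [Complex.ofReal_mul, hF, norm_sum_sq_eq, Finset.mul_sum]
    rw [Finset.sum_comm]
    refine Finset.sum_congr rfl fun u _ => ?_
    rw [Finset.sum_comm]
  have s3 : ∑ y ∈ (latBox (2 * B)).filter (PrimMod p), tent B y * ‖F y‖ ^ 2 ≤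
      ∑ u₁ ∈ A, ∑ u₂ ∈ A, ‖phaseCorr p M B ζ z ξ u₁ u₂‖ := by
    have := congrArg norm s2
    rw [Complex.norm_real] at this
    refine (le_abs_self _).trans (this.le.trans ?_)
    exact (norm_sum_le _ _).trans (Finset.sum_le_sum fun u _ => norm_sum_le _ _)
  have hbox : ∀ u ∈ A, InBox n u := fun u hu => by
    have h1 := hA.pos u hu
    have h2 := hA.le u hu
    exact ⟨by rw [abs_of_pos h1.1]; exact h2.1, by rw [abs_of_pos h1.2]; exact h2.2⟩
  obtain ⟨Λ, hΛ⟩ : ∃ Λ : ℝ, Λ = N * (2 * σ + 2 * p ^ b * S * n / B) + E := ⟨_, rfl⟩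
  have hΛ0 : 0 ≤ Λ := by rw [hΛ]; positivity
  have s4 : ∀ u₁ ∈ A, ∀ u₂ ∈ A, ‖phaseCorr p M B ζ z ξ u₁ u₂‖ ≤
      (if u₁ = u₂ then 2 * N else 0) +
      (if u₁ ≠ u₂ ∧ ((p ^ (M + h + 1) : ℕ) : ℤ) ∣ cross u₁ u₂ then 2 * N else 0) +
      (if u₁ ≠ u₂ ∧ ((p ^ M : ℕ) : ℤ) ∣ cross u₁ u₂ then Λ else 0) := by
    intro u₁ hu₁ u₂ hu₂
    have htriv : ‖phaseCorr p M B ζ z ξ u₁ u₂‖ ≤ 2 * N :=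
      (norm_phaseCorr_le hζ u₁ u₂).trans (by linarith [hN u₁ hu₁])
    by_cases he : u₁ = u₂
    · rw [if_pos he, if_neg (fun x => x.1 he), if_neg (fun x => x.1 he)]
      linarith
    rw [if_neg he]
    by_cases hq : ((p ^ (M + h + 1) : ℕ) : ℤ) ∣ cross u₁ u₂
    · rw [if_pos ⟨he, hq⟩]
      have : 0 ≤ (if u₁ ≠ u₂ ∧ ((p ^ M : ℕ) : ℤ) ∣ cross u₁ u₂ then Λ else 0) := by
        split_ifs <;> simp [hΛ0]
      linarith
    rw [if_neg (fun x => hq x.2)]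
    by_cases hd : ((p ^ M : ℕ) : ℤ) ∣ cross u₁ u₂
    · rw [if_pos ⟨he, hd⟩, zero_add, zero_add, hΛ]
      exact norm_phaseCorr_light_le hp hB hS hMe (hbox _ hu₁) (hbox _ hu₂) hd hsmall c hc hcp hz hζ hξ
        hq hσ0 hσ (hN u₁ hu₁) (hE u₁ hu₁)
    · rw [phaseCorr_eq_zero hp hd, norm_zero, if_neg (fun x => hd x.2)]
      simp
  have hQ : ∀ k, 0 < p ^ k := fun k => pow_pos hp.pos k
  have s5 : ∀ (P : (ℤ × ℤ) × (ℤ × ℤ) → Prop) [DecidablePred P] (x : ℝ),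
      ∑ u₁ ∈ A, ∑ u₂ ∈ A, (if P (u₁, u₂) then x else 0) = ((A ×ˢ A).filter P).card * x := by
    intro P _ x
    rw [← Finset.sum_product', ← Finset.sum_filter, Finset.sum_const, nsmul_eq_mul]
  calc ∑ y ∈ 𝒴, ‖∑ u ∈ A, phaseTerm p M ζ z ξ y u‖ ^ 2 = ∑ y ∈ 𝒴, ‖F y‖ ^ 2 := by rw [hF]
    _ ≤ ∑ u₁ ∈ A, ∑ u₂ ∈ A, ((if u₁ = u₂ then 2 * N else 0) +
      (if u₁ ≠ u₂ ∧ ((p ^ (M + h + 1) : ℕ) : ℤ) ∣ cross u₁ u₂ then 2 * N else 0) +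
      (if u₁ ≠ u₂ ∧ ((p ^ M : ℕ) : ℤ) ∣ cross u₁ u₂ then Λ else 0)) :=
        (s1.trans s3).trans (Finset.sum_le_sum fun u₁ h₁ => Finset.sum_le_sum fun u₂ h₂ => s4 u₁ h₁ u₂ h₂)
    _ = A.card * (2 * N) +
        ((A ×ˢ A).filter fun x => x.1 ≠ x.2 ∧ ((p ^ (M + h + 1) : ℕ) : ℤ) ∣ cross x.1 x.2).card * (2 * N) +
        ((A ×ˢ A).filter fun x => x.1 ≠ x.2 ∧ ((p ^ M : ℕ) : ℤ) ∣ cross x.1 x.2).card * Λ := by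
      simp_rw [Finset.sum_add_distrib]
      congr 1
      · congr 1
        · simp
        · exact s5 (fun x => x.1 ≠ x.2 ∧ ((p ^ (M + h + 1) : ℕ) : ℤ) ∣ cross x.1 x.2) _
      · exact s5 (fun x => x.1 ≠ x.2 ∧ ((p ^ M : ℕ) : ℤ) ∣ cross x.1 x.2) _
    _ ≤ A.card * (2 * N) + A.card * (2 * Z * n ^ 2 / (p ^ (M + h + 1) : ℕ)) * (2 * N) +
        A.card * (2 * Z * n ^ 2 / (p ^ M : ℕ)) * Λ := by
      have c1 := hA.card_parallel_pairs_le (hQ (M + h + 1))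
      have c2 := hA.card_parallel_pairs_le (hQ M)
      gcongr
    _ = _ := by rw [hΛ]; ring

end

lemma cross_act_one_one_zero_one (g : SLTwo) : cross (act g (1, 1)) (act g (0, 1)) = 1 := by
  rw [cross_act]; simp [cross]

lemma exists_cheap_cross_div : ∃ c : ℕ, ∀ (g : SLTwo) (u : ℤ × ℤ),
    Cheap ((vecCost (act g⁻¹ u) + c : ℕ) : ℝ)
      ((cross u (act g (0, 1)) : ℚ) / cross (act g (1, 1)) u) := by
  obtain ⟨c, hc⟩ := exists_act_vecCost_le
    (⟨!![1, 0; -1, 1], by simp [Matrix.det_fin_two_of]⟩ : SLTwo)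
  refine ⟨c, fun g u => ?_⟩
  obtain ⟨x, rfl⟩ : ∃ x, u = act g x := ⟨_, (act_act_inv g u).symm⟩
  rw [cross_act, cross_act, act_inv_act]
  have h := (cheap_vecCost _).mono (Nat.cast_le (α := ℝ).mpr (hc x).1)
  convert h using 2
  · simp [cross, act]
  · simp [cross, act]; ring

/-- The vectors obtained from the words of length `k`. -/
def wordVecs (K : Finset SLTwo) (k : ℕ) : Finset (ℤ × ℤ) := (words K k).image fun w => act w (1, 1)

namespace BlockSystem
variable {K : Finset SLTwo} {Y : ℕ}

lemma act_one_one_injOn (hK : BlockSystem K Y) (hY : 0 < Y) (k : ℕ) :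
    Set.InjOn (fun w : SLTwo => act w (1, 1)) (words K k : Finset _) := by
  intro w hw w' hw' h
  by_contra hne
  have h' : act w (1, 1) = act w' (1, 1) := h
  apply hK.cross_ne_zero hY hw hw' hne
  rw [h', cross_self_eq_zero]

lemma card_wordVecs (hK : BlockSystem K Y) (hY : 0 < Y) (k : ℕ) :
    (wordVecs K k).card = K.card ^ k := by
  rw [wordVecs, Finset.card_image_of_injOn (hK.act_one_one_injOn hY k), hK.card_words hY]

lemma vecFam_wordVecs (hK : BlockSystem K Y) (hY : 0 < Y) {k Z : ℕ} (hZ : 409600 ^ k ≤ Z) :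
    VecFam (wordVecs K k) (Y ^ k) Z where
  pos := by
    intro v hv
    obtain ⟨w, hw, rfl⟩ := Finset.mem_image.mp hv
    exact hK.posVec_act hY hw ⟨one_pos, one_pos⟩
  le := by
    intro v hv
    obtain ⟨w, hw, rfl⟩ := Finset.mem_image.mp hv
    have h := (hK.words_bounds hY hw (B := 1) (v := (1, 1)) le_rfl le_rfl (by simp [InBox])).2
    have hp := hK.posVec_act hY hw (v := (1, 1)) ⟨one_pos, one_pos⟩
    unfold InBox at h
    rw [abs_of_pos hp.1, abs_of_pos hp.2, mul_one] at h
    exact_mod_cast h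
  ge := by
    intro v hv
    obtain ⟨w, hw, rfl⟩ := Finset.mem_image.mp hv
    have h := (hK.words_bounds hY hw (B := 1) (v := (1, 1)) le_rfl le_rfl (by simp [InBox])).1
    have hp := hK.posVec_act hY hw (v := (1, 1)) ⟨one_pos, one_pos⟩
    have h20 : (20 : ℤ) ^ k ≤ Z := by
      have : (20 : ℕ) ^ k ≤ Z := (Nat.pow_le_pow_left (by norm_num) k).trans hZ
      exact_mod_cast this
    push_cast
    exact ⟨h.1.trans (mul_le_mul_of_nonneg_right h20 hp.1.le),
      h.2.trans (mul_le_mul_of_nonneg_right h20 hp.2.le)⟩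
  coprime := by
    intro v hv
    obtain ⟨w, hw, rfl⟩ := Finset.mem_image.mp hv
    exact gcd_act_one_one w
  cross_ne := by
    intro v hv v' hv' hne
    obtain ⟨w, hw, rfl⟩ := Finset.mem_image.mp hv
    obtain ⟨w', hw', rfl⟩ := Finset.mem_image.mp hv'
    exact hK.cross_ne_zero hY hw hw' fun h => hne (by rw [h])
  dense := by
    rw [hK.card_wordVecs hY, ← pow_mul, mul_comm k 2, pow_mul]
    calc (Y ^ 2) ^ k ≤ (409600 * K.card) ^ k := Nat.pow_le_pow_left hK.card_le k
      _ = 409600 ^ k * K.card ^ k := mul_pow _ _ _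
      _ ≤ _ := Nat.mul_le_mul_right _ hZ

end BlockSystem

namespace VecFam
variable {A : Finset (ℤ × ℤ)} {n Z : ℕ}

lemma card_le_sq (hA : VecFam A n Z) : A.card ≤ n ^ 2 := by
  have : A ⊆ Finset.Icc (1 : ℤ) n ×ˢ Finset.Icc (1 : ℤ) n := by
    intro v hv
    have h1 := hA.pos v hv
    have h2 := hA.le v hv
    rw [Finset.mem_product, Finset.mem_Icc, Finset.mem_Icc]
    omega
  have := Finset.card_le_card this
  rw [Finset.card_product, Int.card_Icc] at this
  simpa [sq] using this

lemma inBox (hA : VecFam A n Z) {u : ℤ × ℤ} (hu : u ∈ A) : InBox n u := by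
  have h1 := hA.pos u hu
  have h2 := hA.le u hu
  exact ⟨by rw [abs_of_pos h1.1]; exact h2.1, by rw [abs_of_pos h1.2]; exact h2.2⟩

end VecFam

lemma primMod_of_isCoprime {p : ℕ} (hp : p.Prime) {y : ℤ × ℤ} (h : IsCoprime y.1 y.2) :
    PrimMod p y := by
  rintro ⟨h1, h2⟩
  have := h.isUnit_of_dvd' h1 h2
  exact (Nat.prime_iff_prime_int.mp hp).not_isUnit this

lemma exists_cross_sub_one_dvd {p : ℕ} (hp : p.Prime) (M : ℕ) {y : ℤ × ℤ} (hy : PrimMod p y) :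
    ∃ z, ((p ^ M : ℕ) : ℤ) ∣ cross y z - 1 := by
  unfold PrimMod at hy
  rw [not_and_or] at hy
  rcases hy with hy | hy
  · obtain ⟨a, ha⟩ := exists_int_inv hp hy M
    refine ⟨(0, a), ?_⟩
    simpa [cross, mul_comm] using ha
  · obtain ⟨a, ha⟩ := exists_int_inv hp hy M
    refine ⟨(-a, 0), ?_⟩
    simpa [cross, mul_comm] using ha

lemma sum_norm_sq_mul_stdAddChar_eq_zero {N : ℕ} [NeZero N] {ι : Type*} (I : Finset ι)
    (x : ι → ZMod N) (b : ZMod N) (h : ∀ i ∈ I, ∀ j ∈ I, x i - x j ≠ b) :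
    ∑ ξ : ZMod N, ((‖∑ i ∈ I, ZMod.stdAddChar (x i * ξ)‖ ^ 2 : ℝ) : ℂ) *
      ZMod.stdAddChar (-(b * ξ)) = 0 := by
  simp_rw [norm_sum_sq_eq, Finset.sum_mul]
  rw [Finset.sum_comm]
  refine Finset.sum_eq_zero fun i hi => ?_
  rw [Finset.sum_comm]
  refine Finset.sum_eq_zero fun j hj => ?_
  have h0 := AddChar.sum_mulShift (ψ := (ZMod.stdAddChar : AddChar (ZMod N) ℂ)) (x i - x j - b)
    (ZMod.isPrimitive_stdAddChar N)
  rw [if_neg (sub_ne_zero.mpr (h i hi j hj)), Nat.cast_zero] at h0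
  rw [← h0]
  refine Finset.sum_congr rfl fun ξ _ => ?_
  rw [← AddChar.map_neg_eq_conj, ← AddChar.map_add_eq_mul, ← AddChar.map_add_eq_mul]
  congr 1
  ring

open Classical in
/-- The Fourier energy at `ξ` of the points `t k`, grouped by the label `r k`. -/
noncomputable def fiberEnergy {N : ℕ} [NeZero N] {κ : Type*} (T : Finset κ) (t : κ → ZMod N)
    (r : κ → ℤ) (ξ : ZMod N) : ℝ :=
  ∑ ρ ∈ T.image r, ‖∑ k ∈ T.filter (fun k => r k = ρ), ZMod.stdAddChar (t k * ξ)‖ ^ 2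

lemma fiberEnergy_nonneg {N : ℕ} [NeZero N] {κ : Type*} (T : Finset κ) (t : κ → ZMod N)
    (r : κ → ℤ) (ξ : ZMod N) : 0 ≤ fiberEnergy T t r ξ :=
  Finset.sum_nonneg fun _ _ => by positivity

/-- A spectral gap forces a representation of every residue. -/
lemma exists_add_sub_eq {N : ℕ} [NeZero N] (B : Finset (ZMod N)) {κ : Type*} (T : Finset κ)
    (t : κ → ZMod N) (r : κ → ℤ) (b : ZMod N) (P : ZMod N → Prop) (hP : ∀ ξ, P ξ → b * ξ = 0)
    (hP0 : P 0) {η : ℝ} (hE0 : 0 < fiberEnergy T t r 0)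
    (hη : ∀ ξ, ¬ P ξ → fiberEnergy T t r ξ ≤ η * fiberEnergy T t r 0)
    (hη0 : 0 ≤ η) (hB : η * N < B.card) :
    ∃ β ∈ B, ∃ β' ∈ B, ∃ k ∈ T, ∃ k' ∈ T, r k = r k' ∧ β - β' + (t k - t k') = b := by
  classical
  by_contra hcon
  push Not at hcon
  obtain ⟨G, hG⟩ : ∃ G : ZMod N → ℝ, G = fun ξ =>
      ‖∑ β ∈ B, ZMod.stdAddChar (β * ξ)‖ ^ 2 * fiberEnergy T t r ξ := ⟨_, rfl⟩
  have hG0 : ∀ ξ, 0 ≤ G ξ := fun ξ => by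
    rw [hG]; exact mul_nonneg (by positivity) (fiberEnergy_nonneg _ _ _ _)
  have hzero : ∑ ξ : ZMod N, (G ξ : ℂ) * ZMod.stdAddChar (-(b * ξ)) = 0 := by
    have e : ∀ ξ, (G ξ : ℂ) * ZMod.stdAddChar (-(b * ξ)) = ∑ ρ ∈ T.image r,
        ((‖∑ i ∈ B ×ˢ T.filter (fun k => r k = ρ), ZMod.stdAddChar ((i.1 + t i.2) * ξ)‖ ^ 2 : ℝ) : ℂ) *
        ZMod.stdAddChar (-(b * ξ)) := by
      intro ξ
      rw [← Finset.sum_mul, ← Complex.ofReal_sum]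
      congr 2
      rw [hG]
      simp only [fiberEnergy]
      rw [Finset.mul_sum]
      refine Finset.sum_congr rfl fun ρ _ => ?_
      rw [← mul_pow, ← norm_mul, Finset.sum_mul_sum, ← Finset.sum_product']
      congr 2
      refine Finset.sum_congr rfl fun i _ => ?_
      rw [← AddChar.map_add_eq_mul, add_mul]
    simp_rw [e]
    rw [Finset.sum_comm]
    refine Finset.sum_eq_zero fun ρ _ =>
      sum_norm_sq_mul_stdAddChar_eq_zero _ (fun i : ZMod N × κ => i.1 + t i.2) b ?_
    intro i hi j hj
    rw [Finset.mem_product, Finset.mem_filter] at hi hj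
    have := hcon i.1 hi.1 j.1 hj.1 i.2 hi.2.1 j.2 hj.2.1 (by rw [hi.2.2, hj.2.2])
    intro hx
    apply this
    rw [← hx]
    ring
  have hpars : ∑ ξ : ZMod N, ‖∑ β ∈ B, ZMod.stdAddChar (β * ξ)‖ ^ 2 ≤ B.card * N := by
    have := sum_norm_sq_sum_stdAddChar_le B id (fun _ => 1) (by simp) (m := 1) (by
      intro i hi
      simp only [id]
      rw [Finset.filter_eq' B i, if_pos hi, Finset.card_singleton])
    simpa using this
  rw [← Finset.sum_filter_add_sum_filter_not Finset.univ P] at hzero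
  have h1 : ∑ ξ ∈ Finset.univ.filter P, (G ξ : ℂ) * ZMod.stdAddChar (-(b * ξ)) =
      ((∑ ξ ∈ Finset.univ.filter P, G ξ : ℝ) : ℂ) := by
    rw [Complex.ofReal_sum]
    refine Finset.sum_congr rfl fun ξ hξ => ?_
    rw [hP ξ (Finset.mem_filter.mp hξ).2, neg_zero, AddChar.map_zero_eq_one, mul_one]
  rw [h1] at hzero
  have h2 : ∑ ξ ∈ Finset.univ.filter P, G ξ ≤ ∑ ξ ∈ Finset.univ.filter (fun ξ => ¬ P ξ), G ξ := by
    have e := congrArg norm (eq_neg_of_add_eq_zero_left hzero)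
    rw [norm_neg, Complex.norm_real] at e
    refine (le_abs_self _).trans (e.le.trans (norm_sum_le_of_le _ fun ξ _ => ?_))
    rw [norm_mul, AddChar.norm_apply, mul_one, Complex.norm_real, Real.norm_of_nonneg (hG0 ξ)]
  have h3 : (B.card : ℝ) ^ 2 * fiberEnergy T t r 0 ≤ ∑ ξ ∈ Finset.univ.filter P, G ξ := by
    have : G 0 = (B.card : ℝ) ^ 2 * fiberEnergy T t r 0 := by rw [hG]; simp
    rw [← this]
    exact Finset.single_le_sum (fun ξ _ => hG0 ξ) (Finset.mem_filter.mpr ⟨Finset.mem_univ _, hP0⟩)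
  have h4 : ∑ ξ ∈ Finset.univ.filter (fun ξ => ¬ P ξ), G ξ ≤
      (B.card * N) * (η * fiberEnergy T t r 0) := by
    calc _ ≤ ∑ ξ ∈ Finset.univ.filter (fun ξ => ¬ P ξ),
          ‖∑ β ∈ B, ZMod.stdAddChar (β * ξ)‖ ^ 2 * (η * fiberEnergy T t r 0) := by
          refine Finset.sum_le_sum fun ξ hξ => ?_
          rw [hG]
          exact mul_le_mul_of_nonneg_left (hη ξ (Finset.mem_filter.mp hξ).2) (by positivity)
      _ ≤ ∑ ξ : ZMod N, ‖∑ β ∈ B, ZMod.stdAddChar (β * ξ)‖ ^ 2 * (η * fiberEnergy T t r 0) :=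
          Finset.sum_le_sum_of_subset_of_nonneg (Finset.filter_subset _ _) fun ξ _ _ => by positivity
      _ ≤ _ := by
          rw [← Finset.sum_mul]
          exact mul_le_mul_of_nonneg_right hpars (by positivity)
  have hBpos : (0 : ℝ) < B.card := lt_of_le_of_lt (by positivity) hB
  have h5 := h3.trans (h2.trans h4)
  have h6 : (B.card : ℝ) * N * (η * fiberEnergy T t r 0) <
      (B.card : ℝ) ^ 2 * fiberEnergy T t r 0 := by
    calc _ = (B.card * fiberEnergy T t r 0) * (η * N) := by ring
      _ < (B.card * fiberEnergy T t r 0) * B.card := by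
        exact mul_lt_mul_of_pos_left hB (by positivity)
      _ = _ := by ring
  linarith

lemma abs_mul_sub_mul_le {n : ℕ} {a b c d : ℤ} (ha : 0 < a) (hb : 0 < b) (hc : 0 < c) (hd : 0 < d)
    (ha' : a ≤ n) (hb' : b ≤ n) (hc' : c ≤ n) (hd' : d ≤ n) : |a * b - c * d| ≤ (n ^ 2 : ℕ) := by
  push_cast
  have m1 := mul_le_mul ha' hb' hb.le (by omega)
  have m2 := mul_le_mul hc' hd' hd.le (by omega)
  have m3 := mul_pos ha hb
  have m4 := mul_pos hc hd
  rw [abs_le]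
  constructor <;> nlinarith

/-- The pairs with a given cross product whose slope lies in a given class are few. -/
lemma VecFam.card_slope_class_le {A : Finset (ℤ × ℤ)} {n Z : ℕ} (hA : VecFam A n Z) {Q : ℕ}
    (hQ : 0 < Q) {D α : ℤ} (hD : D ≠ 0) (F : Finset ((ℤ × ℤ) × (ℤ × ℤ)))
    (hF : ∀ x ∈ F, x.1 ∈ A ∧ x.2 ∈ A ∧ cross x.1 x.2 = D ∧
      (Q : ℤ) ∣ x.2.1 - α * x.1.1 ∧ (Q : ℤ) ∣ x.2.2 - α * x.1.2) :
    F.card ≤ (2 * (n ^ 2 / Q) + 1) ^ 4 := by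
  classical
  rcases F.eq_empty_or_nonempty with rfl | ⟨s, hs⟩
  · simp
  obtain ⟨U, hU⟩ : ∃ U : Finset ℤ, U = (Finset.Icc (-((n ^ 2 : ℕ) : ℤ)) (n ^ 2 : ℕ)).filter
    fun z => (Q : ℤ) ∣ z := ⟨_, rfl⟩
  have hUc : U.card ≤ 2 * (n ^ 2 / Q) + 1 := card_multiples_le U hQ (n ^ 2) (by
    intro z hz
    rw [hU, Finset.mem_filter, Finset.mem_Icc] at hz
    exact ⟨hz.2, abs_le.mpr hz.1⟩)
  have hmem : ∀ z : ℤ, (Q : ℤ) ∣ z → |z| ≤ (n ^ 2 : ℕ) → z ∈ U := by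
    intro z h1 h2
    rw [hU, Finset.mem_filter, Finset.mem_Icc]
    exact ⟨abs_le.mp h2, h1⟩
  have hdvd : ∀ a b c d : ℤ, (Q : ℤ) ∣ a - α * b → (Q : ℤ) ∣ c - α * d → (Q : ℤ) ∣ a * d - c * b := by
    rintro a b c d ⟨k, hk⟩ ⟨l, hl⟩
    exact ⟨k * d - l * b, by linear_combination d * hk - b * hl⟩
  obtain ⟨s1, s2, s3, s4, s5⟩ := hF s hs
  have hc : F.card ≤ (U ×ˢ U ×ˢ U ×ˢ U).card := by
    apply Finset.card_le_card_of_injOn fun x => (x.2.1 * s.1.2 - s.2.2 * x.1.1,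
      s.2.1 * x.1.1 - x.2.1 * s.1.1, x.2.2 * s.1.2 - s.2.2 * x.1.2, s.2.1 * x.1.2 - x.2.2 * s.1.1)
    · intro x hx
      obtain ⟨x1, x2, x3, x4, x5⟩ := hF x hx
      have q1 := hA.pos _ x1
      have q2 := hA.pos _ x2
      have q3 := hA.pos _ s1
      have q4 := hA.pos _ s2
      have l1 := hA.le _ x1
      have l2 := hA.le _ x2
      have l3 := hA.le _ s1
      have l4 := hA.le _ s2
      simp only [Finset.coe_product, Set.mem_prod, Finset.mem_coe]
      refine ⟨hmem _ (hdvd _ _ _ _ x4 s5) ?_, hmem _ (hdvd _ _ _ _ s4 x4) ?_,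
        hmem _ (hdvd _ _ _ _ x5 s5) ?_, hmem _ (hdvd _ _ _ _ s4 x5) ?_⟩ <;>
      · apply abs_mul_sub_mul_le <;> tauto
    · intro x hx x' hx' h
      obtain ⟨-, -, x3, -, -⟩ := hF x hx
      simp only [Prod.mk.injEq] at h
      obtain ⟨h1, h2, h3, h4⟩ := h
      have e : s.1.1 * s.2.2 - s.1.2 * s.2.1 ≠ 0 := by
        unfold cross at s3; rw [s3]; exact hD
      ext
      · exact mul_left_cancel₀ e (by linear_combination -s.1.1 * h1 - s.1.2 * h2)
      · exact mul_left_cancel₀ e (by linear_combination -s.1.1 * h3 - s.1.2 * h4)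
      · exact mul_left_cancel₀ e (by linear_combination -s.2.1 * h1 - s.2.2 * h2)
      · exact mul_left_cancel₀ e (by linear_combination -s.2.1 * h3 - s.2.2 * h4)
  refine hc.trans ?_
  rw [Finset.card_product, Finset.card_product, Finset.card_product]
  calc U.card * (U.card * (U.card * U.card)) = U.card ^ 4 := by ring
    _ ≤ _ := Nat.pow_le_pow_left hUc 4

/-- The cheap fractions with a prime power denominator times a fixed cofactor. -/
lemma exists_cheap_residues {p : ℕ} (hp : p.Prime) (M₀ : ℕ) {A : Finset (ℤ × ℤ)} {n Z : ℕ}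
    (hA : VecFam A n Z) (hcard : 4 * p ^ M₀ ≤ A.card) {Λ : ℝ}
    (hcost : ∀ y ∈ A, ∀ u ∈ A, ∃ z, cross y z = 1 ∧ Cheap Λ ((cross u z : ℚ) / cross y u)) :
    ∃ (M₁ r : ℕ) (T : Finset ℤ), M₀ ≤ M₁ ∧ 0 < r ∧ r * p ^ M₁ ≤ n ^ 2 ∧
      (∀ τ ∈ T, 0 ≤ τ ∧ τ < (p ^ M₁ : ℕ)) ∧
      (∀ τ ∈ T, ∃ s : ℤ, Cheap Λ ((τ : ℚ) / (p ^ M₁ : ℕ) + (s : ℚ) / r)) ∧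
      (A.card : ℝ) ^ 2 ≤ 8 * n ^ 2 * (2 * (n ^ 2 / (p : ℝ) ^ M₁) + 1) ^ 4 * T.card := by
  classical
  have hQ : 0 < p ^ M₀ := pow_pos hp.pos _
  obtain ⟨I, hI⟩ : ∃ I, I = (A ×ˢ A).filter fun x => x.1 ≠ x.2 ∧ ((p ^ M₀ : ℕ) : ℤ) ∣ cross x.1 x.2 :=
    ⟨_, rfl⟩
  have hI1 : A.card ^ 2 ≤ 4 * p ^ M₀ * I.card := by
    have h := sq_card_le_card_cross_dvd hp M₀ A id fun v hv => hA.coprime v hv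
    have h2 : ((A ×ˢ A).filter fun x => ((p ^ M₀ : ℕ) : ℤ) ∣ cross (id x.1) (id x.2)).card ≤
        A.card + I.card := by
      have hsub : ((A ×ˢ A).filter fun x => ((p ^ M₀ : ℕ) : ℤ) ∣ cross (id x.1) (id x.2)) ⊆
          A.diag ∪ I := by
        intro x hx
        rw [Finset.mem_filter, Finset.mem_product] at hx
        rw [Finset.mem_union, Finset.mem_diag, hI, Finset.mem_filter, Finset.mem_product]
        by_cases hxx : x.1 = x.2
        · exact Or.inl ⟨hx.1.1, hxx⟩
        · exact Or.inr ⟨hx.1, hxx, hx.2⟩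
      refine (Finset.card_le_card hsub).trans ((Finset.card_union_le _ _).trans ?_)
      rw [Finset.diag_card]
    have h3 := h.trans (Nat.mul_le_mul_left _ h2)
    nlinarith
  have hApos : 0 < A.card := by omega
  have hIpos : 0 < I.card := by
    rcases Nat.eq_zero_or_pos I.card with h | h
    · rw [h] at hI1; nlinarith
    · exact h
  obtain ⟨V, hV⟩ : ∃ V, V = I.image fun x => cross x.1 x.2 := ⟨_, rfl⟩
  have hVc : V.card ≤ 2 * (n ^ 2 / p ^ M₀) := card_nonzero_multiples_le V hQ (n ^ 2) (by
    intro z hz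
    rw [hV, Finset.mem_image] at hz
    obtain ⟨x, hx, rfl⟩ := hz
    rw [hI, Finset.mem_filter, Finset.mem_product] at hx
    exact ⟨hx.2.2, hA.abs_cross_lt hx.1.1 hx.1.2, hA.cross_ne _ hx.1.1 _ hx.1.2 hx.2.1⟩)
  have hVpos : 0 < V.card := by
    rw [hV]; exact Finset.card_pos.mpr ((Finset.card_pos.mp hIpos).image _)
  obtain ⟨D, hDV, hD⟩ := Finset.exists_le_card_fiber_of_nsmul_le_card_of_maps_to
    (s := I) (t := V) (f := fun x => cross x.1 x.2) (b := (I.card : ℝ) / V.card)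
    (fun x hx => by rw [hV]; exact Finset.mem_image_of_mem _ hx) (Finset.card_pos.mp hVpos)
    (by rw [nsmul_eq_mul, mul_div_cancel₀ _ (by positivity)])
  obtain ⟨ID, hID⟩ : ∃ ID, ID = I.filter fun x => cross x.1 x.2 = D := ⟨_, rfl⟩
  rw [← hID] at hD
  have hDprop : D ≠ 0 ∧ ((p ^ M₀ : ℕ) : ℤ) ∣ D ∧ |D| ≤ (n ^ 2 : ℕ) := by
    rw [hV, Finset.mem_image] at hDV
    obtain ⟨x, hx, rfl⟩ := hDV
    rw [hI, Finset.mem_filter, Finset.mem_product] at hx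
    exact ⟨hA.cross_ne _ hx.1.1 _ hx.1.2 hx.2.1, hx.2.2, hA.abs_cross_lt hx.1.1 hx.1.2⟩
  obtain ⟨hD0, hDd, hDn⟩ := hDprop
  obtain ⟨M₁, r, hDr, hr⟩ := exists_eq_pow_mul_of_ne_zero hp hD0
  have hMM : M₀ ≤ M₁ := by
    by_contra hlt
    push Not at hlt
    apply hr
    have h1 : ((p ^ (M₁ + 1) : ℕ) : ℤ) ∣ D := by
      refine dvd_trans ?_ hDd
      exact_mod_cast pow_dvd_pow p hlt
    rw [hDr, pow_succ] at h1
    push_cast at h1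
    exact (mul_dvd_mul_iff_left (pow_ne_zero _ (by exact_mod_cast hp.ne_zero))).mp h1
  have hr0 : r ≠ 0 := by rintro rfl; simp at hr
  obtain ⟨ri, hri⟩ := exists_int_inv hp hr M₁
  have hmemI : ∀ x ∈ ID, x.1 ∈ A ∧ x.2 ∈ A ∧ cross x.1 x.2 = D := by
    intro x hx
    rw [hID, Finset.mem_filter, hI, Finset.mem_filter, Finset.mem_product] at hx
    exact ⟨hx.1.1.1, hx.1.1.2, hx.2⟩
  have hz : ∀ x : (ℤ × ℤ) × (ℤ × ℤ), ∃ z, x ∈ ID → cross x.1 z = 1 ∧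
      Cheap Λ ((cross x.2 z : ℚ) / D) := by
    intro x
    by_cases hx : x ∈ ID
    · obtain ⟨h1, h2, h3⟩ := hmemI x hx
      obtain ⟨z, hz⟩ := hcost _ h1 _ h2
      rw [h3] at hz
      exact ⟨z, fun _ => hz⟩
    · exact ⟨0, fun h => absurd h hx⟩
  choose z hz using hz
  have hQ₁ : 0 < p ^ M₁ := pow_pos hp.pos _
  have hQ₁z : (0 : ℤ) < (p ^ M₁ : ℕ) := by exact_mod_cast hQ₁
  obtain ⟨f, hf⟩ : ∃ f : (ℤ × ℤ) × (ℤ × ℤ) → ℤ,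
      f = fun x => (cross x.2 (z x) * ri) % (p ^ M₁ : ℕ) := ⟨_, rfl⟩
  have hfd : ∀ x, ((p ^ M₁ : ℕ) : ℤ) ∣ cross x.2 (z x) - f x * r := by
    intro x
    obtain ⟨k, hk⟩ := hri
    have h1 := Int.emod_add_mul_ediv (cross x.2 (z x) * ri) (p ^ M₁ : ℕ)
    rw [hf]
    refine ⟨(cross x.2 (z x) * ri) / (p ^ M₁ : ℕ) * r - cross x.2 (z x) * k, ?_⟩
    simp only
    linear_combination (-cross x.2 (z x)) * hk - r * h1
  refine ⟨M₁, r.natAbs, ID.image f, hMM, Int.natAbs_pos.mpr hr0, ?_, ?_, ?_, ?_⟩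
  · have h1 : |D| = ((r.natAbs * p ^ M₁ : ℕ) : ℤ) := by
      rw [hDr, abs_mul]; push_cast
      rw [abs_of_nonneg (by positivity : (0 : ℤ) ≤ (p : ℤ) ^ M₁)]
      ring
    rw [h1] at hDn
    exact_mod_cast hDn
  · intro τ hτ
    obtain ⟨x, -, rfl⟩ := Finset.mem_image.mp hτ
    rw [hf]
    exact ⟨Int.emod_nonneg _ hQ₁z.ne', Int.emod_lt_of_pos _ hQ₁z⟩
  · intro τ hτ
    obtain ⟨x, hx, rfl⟩ := Finset.mem_image.mp hτ
    obtain ⟨k, hk⟩ := hfd x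
    have hc := (hz x hx).2
    refine ⟨k * r.sign, ?_⟩
    convert hc using 1
    have hrq : (r : ℚ) ≠ 0 := by exact_mod_cast hr0
    have e1 : ((k * r.sign : ℤ) : ℚ) / r.natAbs = (k : ℚ) / r := by
      rw [div_eq_div_iff (by simpa using hr0) hrq]
      have e2 : r.sign * r = r.natAbs := by rw [Int.sign_mul_self_eq_natAbs]
      have e3 : k * r.sign * r = k * r.natAbs := by rw [mul_assoc, e2]
      have e3' := congrArg (Int.cast : ℤ → ℚ) e3
      rwa [Int.cast_mul, Int.cast_mul k (r.natAbs : ℤ), Int.cast_natCast] at e3'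
    have hPq : ((p ^ M₁ : ℕ) : ℚ) ≠ 0 := by exact_mod_cast hQ₁.ne'
    have e4 : (cross x.2 (z x) : ℚ) = f x * r + (p ^ M₁ : ℕ) * k := by
      have : cross x.2 (z x) = f x * r + (p ^ M₁ : ℕ) * k := by linarith
      exact_mod_cast this
    have e5 : (D : ℚ) = (p ^ M₁ : ℕ) * r := by rw [hDr]; push_cast; ring
    rw [e1, e4, e5]
    field_simp
  · have hfib : ID.card ≤ (2 * (n ^ 2 / p ^ M₁) + 1) ^ 4 * (ID.image f).card := by
      refine Finset.card_le_mul_card_image _ _ fun τ hτ => ?_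
      refine hA.card_slope_class_le hQ₁ hD0 (α := τ * r) _ fun x hx => ?_
      rw [Finset.mem_filter] at hx
      obtain ⟨h1, h2, h3⟩ := hmemI x hx.1
      obtain ⟨k, hk⟩ := hfd x
      rw [hx.2] at hk
      have h4 := (hz x hx.1).1
      have hDr' : cross x.1 x.2 = (p ^ M₁ : ℕ) * r := by rw [h3, hDr]; push_cast; ring
      refine ⟨h1, h2, h3, ⟨r * (z x).1 + k * x.1.1, ?_⟩, ⟨r * (z x).2 + k * x.1.2, ?_⟩⟩
      · unfold cross at *
        linear_combination x.1.1 * hk + (z x).1 * hDr' - x.2.1 * h4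
      · unfold cross at *
        linear_combination x.1.2 * hk + (z x).2 * hDr' - x.2.2 * h4
    have h1 : ((2 * (n ^ 2 / p ^ M₁) + 1 : ℕ) : ℝ) ≤ 2 * (n ^ 2 / (p : ℝ) ^ M₁) + 1 := by
      have : ((n ^ 2 / p ^ M₁ : ℕ) : ℝ) ≤ n ^ 2 / (p : ℝ) ^ M₁ := by exact_mod_cast Nat.cast_div_le
      push_cast
      linarith
    have h2 : (ID.card : ℝ) ≤ (2 * (n ^ 2 / (p : ℝ) ^ M₁) + 1) ^ 4 * (ID.image f).card := by
      calc (ID.card : ℝ) ≤ ((2 * (n ^ 2 / p ^ M₁) + 1 : ℕ) : ℝ) ^ 4 * (ID.image f).card := by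
            exact_mod_cast hfib
        _ ≤ _ := by gcongr
    have h3 : (V.card : ℝ) * p ^ M₀ ≤ 2 * n ^ 2 := by
      have : V.card * p ^ M₀ ≤ 2 * n ^ 2 := by
        calc V.card * p ^ M₀ ≤ 2 * (n ^ 2 / p ^ M₀) * p ^ M₀ := Nat.mul_le_mul_right _ hVc
          _ = 2 * (n ^ 2 / p ^ M₀ * p ^ M₀) := by ring
          _ ≤ _ := Nat.mul_le_mul_left _ (Nat.div_mul_le_self _ _)
      exact_mod_cast this
    have h4 : (I.card : ℝ) ≤ V.card * ID.card := by
      rw [div_le_iff₀ (by positivity)] at hD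
      linarith
    have h5 : (A.card : ℝ) ^ 2 ≤ 4 * p ^ M₀ * I.card := by exact_mod_cast hI1
    calc (A.card : ℝ) ^ 2 ≤ 4 * p ^ M₀ * (V.card * ID.card) := by
          refine h5.trans ?_; gcongr
      _ = 4 * (V.card * p ^ M₀) * ID.card := by ring
      _ ≤ 4 * (2 * n ^ 2) * ((2 * (n ^ 2 / (p : ℝ) ^ M₁) + 1) ^ 4 * (ID.image f).card) := by gcongr
      _ = _ := by ring

namespace BlockSystem
variable {K : Finset SLTwo} {Y : ℕ}

lemma card_words_parallel_le (hK : BlockSystem K Y) (hY : 0 < Y) {k Z : ℕ} (hZ : 409600 ^ k ≤ Z)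
    {Q : ℕ} (hQ : 0 < Q) {w' : SLTwo} (hw' : w' ∈ words K k) (s : Finset SLTwo)
    (hs : ∀ w ∈ s, w ∈ words K k ∧ w ≠ w' ∧ (Q : ℤ) ∣ cross (act w (1, 1)) (act w' (1, 1))) :
    (s.card : ℝ) ≤ 2 * Z * ((Y ^ k : ℕ) : ℝ) ^ 2 / Q := by
  have hA := hK.vecFam_wordVecs hY hZ
  refine le_trans ?_ (hA.card_parallel_le (Finset.mem_image_of_mem _ hw') hQ)
  have : s.card ≤ ((wordVecs K k).filter fun v => v ≠ act w' (1, 1) ∧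
      (Q : ℤ) ∣ cross v (act w' (1, 1))).card := by
    apply Finset.card_le_card_of_injOn fun w => act w (1, 1)
    · intro w hw
      obtain ⟨h1, h2, h3⟩ := hs w hw
      rw [Finset.coe_filter, Set.mem_ofPred_eq]
      exact ⟨Finset.mem_image_of_mem _ h1, fun he => h2 (hK.act_one_one_injOn hY k h1 hw' he), h3⟩
    · intro w hw w₂ hw₂ h
      exact hK.act_one_one_injOn hY k (hs w hw).1 (hs w₂ hw₂).1 h
  exact_mod_cast this

lemma card_shifted_pairs_le (hK : BlockSystem K Y) (hY : 0 < Y) {i k Z : ℕ}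
    (hZ : 409600 ^ (i + k) ≤ Z) {Q : ℕ} (hQ : 0 < Q) {l l' : SLTwo} (hl : l ∈ words K i)
    (hl' : l' ∈ words K i) (hne : l ≠ l') :
    (((words K k ×ˢ words K k).filter fun x =>
      (Q : ℤ) ∣ cross (act (l * x.1) (1, 1)) (act (l' * x.2) (1, 1))).card : ℝ) ≤
      (words K k).card * (2 * Z * ((Y ^ (i + k) : ℕ) : ℝ) ^ 2 / Q) := by
  classical
  have h : ((words K k ×ˢ words K k).filter fun x =>
      (Q : ℤ) ∣ cross (act (l * x.1) (1, 1)) (act (l' * x.2) (1, 1))).card =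
      ∑ w' ∈ words K k, ((words K k).filter fun w =>
        (Q : ℤ) ∣ cross (act (l * w) (1, 1)) (act (l' * w') (1, 1))).card := by
    simp_rw [Finset.card_filter]
    rw [Finset.sum_product_right]
  rw [h]
  push_cast
  rw [← nsmul_eq_mul, ← Finset.sum_const]
  refine Finset.sum_le_sum fun w' hw' => ?_
  rw [← Finset.card_image_of_injective _ (mul_right_injective l)]
  have := hK.card_words_parallel_le hY hZ hQ (w' := l' * w') (mem_words_add.mpr ⟨l', hl', w', hw', rfl⟩)
    (((words K k).filter fun w =>
        (Q : ℤ) ∣ cross (act (l * w) (1, 1)) (act (l' * w') (1, 1))).image fun w => l * w) (by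
      intro x hx
      obtain ⟨w, hw, rfl⟩ := Finset.mem_image.mp hx
      rw [Finset.mem_filter] at hw
      refine ⟨mem_words_add.mpr ⟨l, hl, w, hw.1, rfl⟩, fun he => hne ?_, hw.2⟩
      have := hK.words_mul_injOn hY i k (x₁ := (l, w)) (x₂ := (l', w'))
        (by simp [hl, hw.1]) (by simp [hl', hw']) he
      exact congrArg Prod.fst this)
  exact_mod_cast this

lemma card_pairs_le (hK : BlockSystem K Y) (hY : 0 < Y) {k Z : ℕ}
    (hZ : 409600 ^ k ≤ Z) {Q : ℕ} (hQ : 0 < Q) :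
    (((words K k ×ˢ words K k).filter fun x =>
      (Q : ℤ) ∣ cross (act x.1 (1, 1)) (act x.2 (1, 1))).card : ℝ) ≤
      (words K k).card * (1 + 2 * Z * ((Y ^ k : ℕ) : ℝ) ^ 2 / Q) := by
  classical
  have h : ((words K k ×ˢ words K k).filter fun x =>
      (Q : ℤ) ∣ cross (act x.1 (1, 1)) (act x.2 (1, 1))).card =
      ∑ w' ∈ words K k, ((words K k).filter fun w =>
        (Q : ℤ) ∣ cross (act w (1, 1)) (act w' (1, 1))).card := by
    simp_rw [Finset.card_filter]
    rw [Finset.sum_product_right]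
  rw [h]
  push_cast
  rw [← nsmul_eq_mul, ← Finset.sum_const]
  refine Finset.sum_le_sum fun w' hw' => ?_
  obtain ⟨s, hs⟩ : ∃ s, s = (words K k).filter fun w =>
    w ≠ w' ∧ (Q : ℤ) ∣ cross (act w (1, 1)) (act w' (1, 1)) := ⟨_, rfl⟩
  have h1 := hK.card_words_parallel_le hY hZ hQ hw' s (by
    intro w hw
    rw [hs, Finset.mem_filter] at hw
    exact hw)
  have h2 : ((words K k).filter fun w =>
        (Q : ℤ) ∣ cross (act w (1, 1)) (act w' (1, 1))).card ≤ s.card + 1 := by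
    refine (Finset.card_le_card (t := insert w' s) fun w hw => ?_).trans (Finset.card_insert_le _ _)
    rw [Finset.mem_insert, hs]
    rw [Finset.mem_filter] at hw ⊢
    by_cases he : w = w'
    · exact Or.inl he
    · exact Or.inr ⟨hw.1, he, hw.2⟩
  have h3 : (((words K k).filter fun w =>
        (Q : ℤ) ∣ cross (act w (1, 1)) (act w' (1, 1))).card : ℝ) ≤ s.card + 1 := by exact_mod_cast h2
  push_cast at h1
  linarith

/-- Some two distinct prefixes carry the expected number of parallel pairs. -/
lemma exists_prefixes (hK : BlockSystem K Y) (hY : 0 < Y) {p : ℕ} (hp : p.Prime) (M₀ : ℕ)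
    {i k Z : ℕ} (hZ : 409600 ^ (i + k) ≤ Z) (hZ64 : 64 ≤ Z) (hi : Y ^ i = Z ^ 3)
    (hQ : p ^ M₀ ≤ (Y ^ k) ^ 2) :
    ∃ l ∈ words K i, ∃ l' ∈ words K i, l ≠ l' ∧
      ((words K k).card : ℝ) ^ 2 / 4 / (p : ℝ) ^ M₀ ≤
      (((words K k ×ˢ words K k).filter fun x =>
      ((p ^ M₀ : ℕ) : ℤ) ∣ cross (act (l * x.1) (1, 1)) (act (l' * x.2) (1, 1))).card : ℝ) := by
  classical
  by_contra hcon
  push Not at hcon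
  have hQ0 : 0 < p ^ M₀ := pow_pos hp.pos _
  have h409 : ∀ j, j ≤ i + k → 409600 ^ j ≤ Z := fun j hj =>
    (Nat.pow_le_pow_right (by norm_num) hj).trans hZ
  obtain ⟨c, hc⟩ : ∃ c : SLTwo × SLTwo → ℕ, c = fun m => ((words K k ×ˢ words K k).filter fun x =>
      ((p ^ M₀ : ℕ) : ℤ) ∣ cross (act (m.1 * x.1) (1, 1)) (act (m.2 * x.2) (1, 1))).card := ⟨_, rfl⟩
  have htot := sq_card_le_card_cross_dvd hp M₀ (words K (i + k)) (fun w => act w (1, 1))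
    (fun w _ => gcd_act_one_one w)
  have hsum : ((words K (i + k) ×ˢ words K (i + k)).filter fun x => ((p ^ M₀ : ℕ) : ℤ) ∣
      cross (act x.1 (1, 1)) (act x.2 (1, 1))).card ≤ ∑ m ∈ words K i ×ˢ words K i, c m := by
    refine (Finset.card_le_card (t := (words K i ×ˢ words K i).biUnion fun m =>
      ((words K k ×ˢ words K k).filter fun x =>
      ((p ^ M₀ : ℕ) : ℤ) ∣ cross (act (m.1 * x.1) (1, 1)) (act (m.2 * x.2) (1, 1))).image
        fun x => (m.1 * x.1, m.2 * x.2)) ?_).trans (Finset.card_biUnion_le.trans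
        (Finset.sum_le_sum fun m _ => by rw [hc]; exact Finset.card_image_le))
    rintro ⟨x, x'⟩ hx
    rw [Finset.mem_filter, Finset.mem_product] at hx
    obtain ⟨⟨h1, h2⟩, h3⟩ := hx
    obtain ⟨l, hl, w, hw, rfl⟩ := mem_words_add.mp h1
    obtain ⟨l', hl', w', hw', rfl⟩ := mem_words_add.mp h2
    simp only [Finset.mem_biUnion, Finset.mem_image, Finset.mem_product, Finset.mem_filter]
    exact ⟨(l, l'), ⟨hl, hl'⟩, (w, w'), ⟨⟨hw, hw'⟩, h3⟩, rfl⟩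
  obtain ⟨a, ha⟩ : ∃ a, a = (words K k).card := ⟨_, rfl⟩
  obtain ⟨I, hI⟩ : ∃ I, I = (words K i).card := ⟨_, rfl⟩
  obtain ⟨N, hN⟩ : ∃ N, N = Y ^ k := ⟨_, rfl⟩
  have hcard : (words K (i + k)).card = I * a := by
    rw [hI, ha, hK.card_words hY, hK.card_words hY, hK.card_words hY, pow_add]
  have hda := (hK.vecFam_wordVecs hY (h409 k (by omega))).dense
  have hdI := (hK.vecFam_wordVecs hY (h409 i (by omega))).dense
  rw [hK.card_wordVecs hY, ← hK.card_words hY] at hda hdI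
  rw [← ha, ← hN] at hda
  rw [← hI, hi] at hdI
  rw [← hN] at hQ
  have hNpos : 0 < N := by rw [hN]; exact pow_pos hY _
  have hapos : 0 < a := by
    rcases Nat.eq_zero_or_pos a with h | h
    · rw [h, mul_zero] at hda; have := pow_pos hNpos 2; omega
    · exact h
  have hI5 : Z ^ 5 ≤ I := by
    have : Z * Z ^ 5 ≤ Z * I := by calc Z * Z ^ 5 = (Z ^ 3) ^ 2 := by ring
      _ ≤ _ := hdI
    exact Nat.le_of_mul_le_mul_left this (by omega)
  rw [hcard] at htot
  have hcd : ∀ l ∈ words K i, (c (l, l) : ℝ) ≤ a * (1 + 2 * Z * (N : ℝ) ^ 2 / (p : ℝ) ^ M₀) := by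
    intro l _
    have := hK.card_pairs_le hY (h409 k (by omega)) hQ0
    rw [hc]
    simp only [act_mul, cross_act]
    rw [ha, hN]
    exact_mod_cast this
  have hsplit : (∑ m ∈ words K i ×ˢ words K i, (c m : ℝ)) ≤
      I ^ 2 * ((a : ℝ) ^ 2 / 4 / (p : ℝ) ^ M₀) +
      I * (a * (1 + 2 * Z * (N : ℝ) ^ 2 / (p : ℝ) ^ M₀)) := by
    have e : ∀ m ∈ words K i ×ˢ words K i, (c m : ℝ) ≤ (a : ℝ) ^ 2 / 4 / (p : ℝ) ^ M₀ +
        (if m.1 = m.2 then a * (1 + 2 * Z * (N : ℝ) ^ 2 / (p : ℝ) ^ M₀) else 0) := by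
      intro m hm
      rw [Finset.mem_product] at hm
      by_cases hmm : m.1 = m.2
      · rw [if_pos hmm]
        have h1 := hcd m.1 hm.1
        have h2 : m = (m.1, m.1) := Prod.ext rfl hmm.symm
        rw [h2]
        have : (0 : ℝ) ≤ (a : ℝ) ^ 2 / 4 / (p : ℝ) ^ M₀ := by positivity
        linarith
      · rw [if_neg hmm, add_zero, hc, ha]
        exact (hcon m.1 hm.1 m.2 hm.2 hmm).le
    refine (Finset.sum_le_sum e).trans ?_
    rw [Finset.sum_add_distrib, Finset.sum_const, Finset.card_product, ← hI, Finset.sum_product]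
    simp only [Finset.sum_ite_eq, Finset.sum_ite_mem, Finset.inter_self, Finset.sum_const,
      nsmul_eq_mul, ← hI]
    push_cast
    apply le_of_eq
    ring
  have hQr : (0 : ℝ) < (p : ℝ) ^ M₀ := by exact_mod_cast hQ0
  have hQr2 : (p : ℝ) ^ M₀ ≤ (N : ℝ) ^ 2 := by exact_mod_cast hQ
  have t1 : ((I : ℝ) * a) ^ 2 ≤ 2 * (p : ℝ) ^ M₀ * (I ^ 2 * ((a : ℝ) ^ 2 / 4 / (p : ℝ) ^ M₀) +
      I * (a * (1 + 2 * Z * (N : ℝ) ^ 2 / (p : ℝ) ^ M₀))) := by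
    have h1 : ((I : ℝ) * a) ^ 2 ≤ 2 * (p : ℝ) ^ M₀ * ∑ m ∈ words K i ×ˢ words K i, (c m : ℝ) := by
      exact_mod_cast htot.trans (Nat.mul_le_mul_left _ hsum)
    exact h1.trans (by gcongr)
  have t2 : 2 * (p : ℝ) ^ M₀ * (I ^ 2 * ((a : ℝ) ^ 2 / 4 / (p : ℝ) ^ M₀) +
      I * (a * (1 + 2 * Z * (N : ℝ) ^ 2 / (p : ℝ) ^ M₀))) =
      I ^ 2 * a ^ 2 / 2 + I * a * (2 * (p : ℝ) ^ M₀ + 4 * Z * (N : ℝ) ^ 2) := by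
    field_simp
    ring
  rw [t2] at t1
  have hIpos : (0 : ℝ) < I := by
    have : 0 < I := lt_of_lt_of_le (pow_pos (by omega) 5) hI5
    exact_mod_cast this
  have har : (0 : ℝ) < a := by exact_mod_cast hapos
  have t3 : (I : ℝ) * a ≤ 2 * (2 * (p : ℝ) ^ M₀ + 4 * Z * (N : ℝ) ^ 2) := by
    have : (I : ℝ) * a * (I * a) ≤ I * a * (2 * (2 * (p : ℝ) ^ M₀ + 4 * Z * (N : ℝ) ^ 2)) := by linarith
    exact le_of_mul_le_mul_left this (by positivity)
  have hZr : (64 : ℝ) ≤ Z := by exact_mod_cast hZ64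
  have hdar : (N : ℝ) ^ 2 ≤ Z * a := by exact_mod_cast hda
  have t4 : (I : ℝ) * a ≤ 12 * Z ^ 2 * a := by
    have : 2 * (2 * (p : ℝ) ^ M₀ + 4 * Z * (N : ℝ) ^ 2) ≤ 12 * Z * (N : ℝ) ^ 2 := by
      nlinarith [sq_nonneg (N : ℝ)]
    calc (I : ℝ) * a ≤ 12 * Z * (N : ℝ) ^ 2 := t3.trans this
      _ ≤ 12 * Z * (Z * a) := by gcongr
      _ = _ := by ring
  have t5 : (I : ℝ) ≤ 12 * Z ^ 2 := le_of_mul_le_mul_right t4 har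
  have t6 : (Z : ℝ) ^ 5 ≤ I := by exact_mod_cast hI5
  have t7 : (12 : ℝ) < Z ^ 3 := by
    calc (12 : ℝ) < 64 ^ 3 := by norm_num
      _ ≤ _ := by gcongr
  have t8 : (12 : ℝ) * Z ^ 2 < Z ^ 5 := by
    calc (12 : ℝ) * Z ^ 2 < Z ^ 3 * Z ^ 2 := by gcongr
      _ = _ := by ring
  linarith

/-- Some exact valuation carries many parallel pairs with two fixed distinct prefixes. -/
lemma exists_exact_pairs (hK : BlockSystem K Y) (hY : 0 < Y) {p : ℕ} (hp : p.Prime) (M₀ : ℕ)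
    {i k Z : ℕ} (hZ : 409600 ^ (i + k) ≤ Z) (hZ64 : 64 ≤ Z) (hi : Y ^ i = Z ^ 3)
    (hQ : p ^ M₀ ≤ (Y ^ k) ^ 2) :
    ∃ M, M₀ ≤ M ∧ p ^ M ≤ p ^ M₀ * Z ^ 17 ∧ ∃ l ∈ words K i, ∃ l' ∈ words K i, l ≠ l' ∧
      ∃ X ⊆ words K k ×ˢ words K k,
        (∀ x ∈ X, ExactPair p M (act (l * x.1) (1, 1)) (act (l' * x.2) (1, 1))) ∧
        ((Y ^ k : ℕ) : ℝ) ^ 4 ≤ 16 * Z ^ 2 * (p : ℝ) ^ M * X.card := by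
  classical
  obtain ⟨l, hl, l', hl', hne, hlow⟩ := hK.exists_prefixes hY hp M₀ hZ hZ64 hi hQ
  have hda := (hK.vecFam_wordVecs hY
    ((Nat.pow_le_pow_right (by norm_num) (by omega : k ≤ i + k)).trans hZ)).dense
  rw [hK.card_wordVecs hY, ← hK.card_words hY] at hda
  obtain ⟨a, ha⟩ : ∃ a, a = (words K k).card := ⟨_, rfl⟩
  obtain ⟨N, hN⟩ : ∃ N, N = Y ^ k := ⟨_, rfl⟩
  rw [← ha, ← hN] at hda
  have hNpos : 0 < N := by rw [hN]; exact pow_pos hY _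
  have hapos : 0 < a := by
    rcases Nat.eq_zero_or_pos a with h | h
    · rw [h, mul_zero] at hda; have := pow_pos hNpos 2; omega
    · exact h
  have har : (0 : ℝ) < a := by exact_mod_cast hapos
  have hZr : (64 : ℝ) ≤ Z := by exact_mod_cast hZ64
  have hdar : (N : ℝ) ^ 2 ≤ Z * a := by exact_mod_cast hda
  obtain ⟨v, hv, hcount⟩ := exists_exact_valuation hp.two_le M₀ (words K k ×ˢ words K k)
    (fun x => cross (act (l * x.1) (1, 1)) (act (l' * x.2) (1, 1))) (a := (a : ℝ) ^ 2 / 4)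
    (U := a * (2 * Z * ((Z ^ 3 * N : ℕ) : ℝ) ^ 2)) (by positivity) (by rw [ha]; exact hlow) (by
      intro v
      have := hK.card_shifted_pairs_le hY hZ (pow_pos hp.pos (M₀ + v)) hl hl' hne
      rw [pow_add Y, hi, ← hN, ← ha] at this
      refine this.trans (le_of_eq ?_)
      push_cast
      ring)
  refine ⟨M₀ + v, by omega, ?_, l, hl, l', hl', hne, _, Finset.filter_subset _ _, fun x hx =>
    (Finset.mem_filter.mp hx).2, ?_⟩
  · have h1 : (a * (2 * Z * ((Z ^ 3 * N : ℕ) : ℝ) ^ 2)) / ((a : ℝ) ^ 2 / 4) ≤ 8 * Z ^ 8 := by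
      rw [div_le_iff₀ (by positivity)]
      push_cast
      calc (a : ℝ) * (2 * Z * (Z ^ 3 * N) ^ 2) = 2 * (Z : ℝ) ^ 7 * a * (N : ℝ) ^ 2 := by ring
        _ ≤ 2 * (Z : ℝ) ^ 7 * a * ((Z : ℝ) * a) := by gcongr
        _ = _ := by ring
    have h2 : (p : ℝ) ^ v ≤ Z ^ 17 := by
      calc (p : ℝ) ^ v ≤ _ := hv
        _ ≤ (8 * (Z : ℝ) ^ 8) ^ 2 := by gcongr
        _ = 64 * Z ^ 16 := by ring
        _ ≤ Z * Z ^ 16 := by gcongr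
        _ = _ := by ring
    rw [pow_add]
    exact Nat.mul_le_mul_left _ (by exact_mod_cast h2)
  · rw [div_le_iff₀ (by have := hp.pos; positivity)] at hcount
    rw [← hN]
    calc (N : ℝ) ^ 4 = ((N : ℝ) ^ 2) ^ 2 := by ring
      _ ≤ ((Z : ℝ) * a) ^ 2 := by gcongr
      _ = 4 * (Z : ℝ) ^ 2 * ((a : ℝ) ^ 2 / 4) := by ring
      _ ≤ 4 * (Z : ℝ) ^ 2 * _ := mul_le_mul_of_nonneg_left hcount (by positivity)
      _ = _ := by
        simp only [ExactPair]
        ring_nf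

end BlockSystem

lemma exists_cheap_words (K : Finset SLTwo) : ∃ L : ℕ, ∀ i j k : ℕ, ∀ l ∈ words K i,
    ∀ l' ∈ words K i, ∀ h ∈ words K j, ∀ w ∈ words K (j + k), ∀ u ∈ words K k,
    Cheap ((L * (2 * i + 2 * (j + k) + 1) : ℕ) : ℝ)
      ((cross (act u (1, 1)) (act (h⁻¹ * l⁻¹ * l' * w) (0, 1)) : ℚ) /
        cross (act (h⁻¹ * l⁻¹ * l' * w) (1, 1)) (act u (1, 1))) := by
  obtain ⟨L, hL⟩ := exists_words_vecCost_le K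
  obtain ⟨c, hc⟩ := exists_cheap_cross_div
  refine ⟨L + vecCost (1, 1) + c, fun i j k l hl l' hl' h hh w hw u hu => ?_⟩
  refine (hc (h⁻¹ * l⁻¹ * l' * w) (act u (1, 1))).mono ?_
  rw [Nat.cast_le]
  have e : act (h⁻¹ * l⁻¹ * l' * w)⁻¹ (act u (1, 1)) =
      act w⁻¹ (act l'⁻¹ (act l (act h (act u (1, 1))))) := by
    simp only [← act_mul]
    congr 1
    group
  rw [e]
  have h1 := (hL k u hu (1, 1)).1
  have h2 := (hL j h hh (act u (1, 1))).1
  have h3 := (hL i l hl (act h (act u (1, 1)))).1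
  have h4 := (hL i l' hl' (act l'⁻¹ (act l (act h (act u (1, 1)))))).2
  rw [act_act_inv] at h4
  have h5 := (hL (j + k) w hw (act w⁻¹ (act l'⁻¹ (act l (act h (act u (1, 1))))))).2
  rw [act_act_inv] at h5
  have h6 : (L + vecCost (1, 1) + c) * (2 * i + 2 * (j + k) + 1) =
      k * L + j * L + i * L + i * L + (j + k) * L + (L + vecCost (1, 1) + c) +
        (vecCost (1, 1) + c) * (2 * i + 2 * (j + k)) := by ring
  have h7 : 0 ≤ (vecCost (1, 1) + c) * (2 * i + 2 * (j + k)) := Nat.zero_le _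
  omega

namespace BlockSystem
variable {K : Finset SLTwo} {Y : ℕ}

/-- Stripping a long prefix turns pairs of words into distinct pairs of vectors of a box and
word vectors, with the same cross products. -/
lemma exists_pair_family (hK : BlockSystem K Y) (hY : 0 < Y) {p M i j k : ℕ} {l l' : SLTwo}
    (hl : l ∈ words K i) (hl' : l' ∈ words K i) (hne : l ≠ l') {Λ : ℝ}
    (hΛ : ∀ h ∈ words K j, ∀ w ∈ words K (j + k), ∀ u ∈ words K k,
      Cheap Λ ((cross (act u (1, 1)) (act (h⁻¹ * l⁻¹ * l' * w) (0, 1)) : ℚ) /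
        cross (act (h⁻¹ * l⁻¹ * l' * w) (1, 1)) (act u (1, 1))))
    (X : Finset (SLTwo × SLTwo)) (hX : X ⊆ words K (j + k) ×ˢ words K (j + k))
    (hexact : ∀ x ∈ X, ExactPair p M (act (l * x.1) (1, 1)) (act (l' * x.2) (1, 1))) :
    ∃ (𝒴 : Finset (ℤ × ℤ)) (z : ℤ × ℤ → ℤ × ℤ) (T : Finset ((ℤ × ℤ) × (ℤ × ℤ))),
      (∀ y ∈ 𝒴, InBox (4 * Y ^ (2 * i + 2 * j + k) : ℕ) y ∧ IsCoprime y.1 y.2 ∧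
        cross y (z y) = 1) ∧
      (∀ y ∈ 𝒴, ∀ u ∈ wordVecs K k, Cheap Λ ((cross u (z y) : ℚ) / cross y u)) ∧
      (∀ x, x ∈ T ↔ (x.1 ∈ 𝒴 ∧ x.2 ∈ wordVecs K k) ∧ ExactPair p M x.1 x.2) ∧
      X.card ≤ T.card := by
  classical
  obtain ⟨𝒴, h𝒴⟩ : ∃ 𝒴, 𝒴 = (words K j ×ˢ words K (j + k)).image
      fun x => act (x.1⁻¹ * l⁻¹ * l' * x.2) (1, 1) := ⟨_, rfl⟩
  have hmem : ∀ y, y ∈ 𝒴 ↔ ∃ h ∈ words K j, ∃ w ∈ words K (j + k),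
      act (h⁻¹ * l⁻¹ * l' * w) (1, 1) = y := by
    intro y
    rw [h𝒴]
    simp only [Finset.mem_image, Finset.mem_product, Prod.exists]
    constructor
    · rintro ⟨h, w, ⟨hh, hw⟩, e⟩; exact ⟨h, hh, w, hw, e⟩
    · rintro ⟨h, hh, w, hw, e⟩; exact ⟨h, w, ⟨hh, hw⟩, e⟩
  have hz : ∀ y, ∃ z, y ∈ 𝒴 → cross y z = 1 ∧
      ∀ u ∈ wordVecs K k, Cheap Λ ((cross u z : ℚ) / cross y u) := by
    intro y
    by_cases hy : y ∈ 𝒴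
    · obtain ⟨h, hh, w, hw, rfl⟩ := (hmem y).mp hy
      refine ⟨act (h⁻¹ * l⁻¹ * l' * w) (0, 1), fun _ => ⟨cross_act_one_one_zero_one _, ?_⟩⟩
      intro v hv
      obtain ⟨u, hu, rfl⟩ := Finset.mem_image.mp hv
      exact hΛ h hh w hw u hu
    · exact ⟨0, fun h => absurd h hy⟩
  choose z hz using hz
  obtain ⟨T, hT⟩ : ∃ T, T = (𝒴 ×ˢ wordVecs K k).filter fun x => ExactPair p M x.1 x.2 := ⟨_, rfl⟩
  have hTm : ∀ x, x ∈ T ↔ (x.1 ∈ 𝒴 ∧ x.2 ∈ wordVecs K k) ∧ ExactPair p M x.1 x.2 := by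
    intro x
    rw [hT, Finset.mem_filter, Finset.mem_product]
  refine ⟨𝒴, z, T, fun y hy => ⟨?_, ?_, (hz y hy).1⟩, fun y hy => (hz y hy).2, hTm, ?_⟩
  · obtain ⟨h, hh, w, hw, rfl⟩ := (hmem y).mp hy
    have h1 := (hK.words_bounds hY (k := i + (j + k)) (w := l' * w)
      (mem_words_add.mpr ⟨l', hl', w, hw, rfl⟩) (B := 1) (v := (1, 1)) le_rfl le_rfl
      ⟨by simp, by simp⟩).2
    have h2 := (hK.inBox_act hY hh (hK.inBox_act hY hl h1).2).2
    rw [← act_mul, ← act_mul] at h2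
    have e : ((4 * Y ^ (2 * i + 2 * j + k) : ℕ) : ℤ) =
        2 * (Y : ℤ) ^ j * (2 * (Y : ℤ) ^ i * ((Y : ℤ) ^ (i + (j + k)) * 1)) := by
      push_cast
      ring
    rw [e]
    simpa only [mul_assoc] using h2
  · obtain ⟨h, hh, w, hw, rfl⟩ := (hmem y).mp hy
    exact gcd_act_one_one _
  · have hsplit : ∀ w : SLTwo, ∃ x : SLTwo × SLTwo, w ∈ words K (j + k) →
        x.1 ∈ words K j ∧ x.2 ∈ words K k ∧ x.1 * x.2 = w := by
      intro w
      by_cases hw : w ∈ words K (j + k)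
      · obtain ⟨h, hh, u, hu, e⟩ := mem_words_add.mp hw
        exact ⟨(h, u), fun _ => ⟨hh, hu, e⟩⟩
      · exact ⟨1, fun h => absurd h hw⟩
    choose f hf using hsplit
    have hX' : ∀ x ∈ X, x.1 ∈ words K (j + k) ∧ x.2 ∈ words K (j + k) := fun x hx =>
      Finset.mem_product.mp (hX hx)
    have hopp : ∀ w ∈ words K (j + k), OppVec (act (l⁻¹ * l' * w) (1, 1)) := fun w hw => by
      rw [act_mul]
      exact hK.oppVec_of_ne hY hl hl' hne (hK.posVec_act hY hw ⟨one_pos, one_pos⟩)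
    refine Finset.card_le_card_of_injOn
      (fun x => (act ((f x.1).1⁻¹ * l⁻¹ * l' * x.2) (1, 1), act (f x.1).2 (1, 1))) ?_ ?_
    · intro x hx
      obtain ⟨h1, h2⟩ := hX' x hx
      obtain ⟨h3, h4, h5⟩ := hf x.1 h1
      refine (hTm _).mpr ⟨⟨(hmem _).mpr ⟨_, h3, _, h2, rfl⟩, Finset.mem_image_of_mem _ h4⟩, ?_⟩
      have e : cross (act ((f x.1).1⁻¹ * l⁻¹ * l' * x.2) (1, 1)) (act (f x.1).2 (1, 1)) =
          -cross (act (l * x.1) (1, 1)) (act (l' * x.2) (1, 1)) := by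
        rw [cross_swap, ← cross_act (l * (f x.1).1), ← act_mul, ← act_mul]
        congr 3
        · rw [mul_assoc, h5]
        · group
      have h6 := hexact x hx
      unfold ExactPair at h6 ⊢
      simp only
      rwa [e, dvd_neg, dvd_neg]
    · intro x hx x' hx' heq
      obtain ⟨h1, h2⟩ := hX' x hx
      obtain ⟨h3, h4, h5⟩ := hf x.1 h1
      obtain ⟨h1', h2'⟩ := hX' x' hx'
      obtain ⟨h3', h4', h5'⟩ := hf x'.1 h1'
      obtain ⟨e1, e2⟩ := Prod.mk.inj heq
      have e3 := hK.act_one_one_injOn hY k h4 h4' e2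
      have e4 : (f x.1).1 = (f x'.1).1 := by
        refine hK.eq_of_act_inv_eq hY h3 h3' (hopp _ h2) (hopp _ h2') ?_
        rw [← act_mul, ← act_mul]
        simpa only [mul_assoc] using e1
      have e5 : x.2 = x'.2 := by
        rw [← e4, act_mul, act_mul _ x'.2] at e1
        exact hK.act_one_one_injOn hY (j + k) h2 h2' (act_injective _ e1)
      exact Prod.ext (by rw [← h5, ← h5', e3, e4]) e5

end BlockSystem

lemma sq_card_le_card_mul_fiberEnergy {N : ℕ} [NeZero N] {κ : Type*} (T : Finset κ)
    (t : κ → ZMod N) (r : κ → ℤ) :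
    (T.card : ℝ) ^ 2 ≤ (T.image r).card * fiberEnergy T t r 0 := by
  classical
  unfold fiberEnergy
  simp only [mul_zero, AddChar.map_zero_eq_one, Finset.sum_const, nsmul_eq_mul, mul_one,
    Complex.norm_natCast]
  have h : (T.card : ℝ) = ∑ ρ ∈ T.image r, ((T.filter fun k => r k = ρ).card : ℝ) := by
    exact_mod_cast Finset.card_eq_sum_card_image r T
  rw [h]
  exact sq_sum_le_card_mul_sum_sq

section
variable {p M N : ℕ} [NeZero (p ^ M)] [NeZero (p ^ N)] {z : ℤ × ℤ → ℤ × ℤ}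

/-- The numerator over `p ^ N` of the fraction attached to the pair `x`. -/
def pairRes (p M N : ℕ) (z : ℤ × ℤ → ℤ × ℤ) (x : (ℤ × ℤ) × (ℤ × ℤ)) : ℤ :=
  (p : ℤ) ^ (N - M) * (cross x.2 (z x.1) *
    (((cross x.1 x.2 / (p ^ M : ℕ) : ℤ) : ZMod (p ^ M))⁻¹).val)

lemma stdAddChar_pow_mul (hp : p.Prime) (hMN : M ≤ N) (a k : ℤ) :
    ZMod.stdAddChar (((p : ℤ) ^ (N - M) * a * k : ℤ) : ZMod (p ^ N)) =
      ZMod.stdAddChar ((a * k : ℤ) : ZMod (p ^ M)) := by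
  rw [ZMod.stdAddChar_coe, ZMod.stdAddChar_coe]
  congr 1
  have hp0 : (p : ℂ) ≠ 0 := by exact_mod_cast hp.ne_zero
  have e : ((p ^ N : ℕ) : ℂ) = (p : ℂ) ^ (N - M) * ((p ^ M : ℕ) : ℂ) := by
    push_cast
    rw [← pow_add, Nat.sub_add_cancel hMN]
  have h1 : ((p ^ M : ℕ) : ℂ) ≠ 0 := by push_cast; positivity
  rw [e]
  push_cast
  push_cast at h1
  field_simp

lemma stdAddChar_pairRes_mul (hp : p.Prime) (hMN : M ≤ N) (x : (ℤ × ℤ) × (ℤ × ℤ))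
    (ξ : ZMod (p ^ N)) :
    ZMod.stdAddChar ((pairRes p M N z x : ZMod (p ^ N)) * ξ) =
      pairPhase p M z (ξ.val : ℤ) x.1 x.2 := by
  have e : (pairRes p M N z x : ZMod (p ^ N)) * ξ = ((p : ℤ) ^ (N - M) * (cross x.2 (z x.1) *
      (((cross x.1 x.2 / (p ^ M : ℕ) : ℤ) : ZMod (p ^ M))⁻¹).val) * (ξ.val : ℤ) : ℤ) := by
    rw [Int.cast_mul, Int.cast_natCast, ZMod.natCast_zmod_val]
    rfl
  rw [e, stdAddChar_pow_mul hp hMN]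
  unfold pairPhase
  congr 1
  rw [Int.cast_mul, Int.cast_mul, Int.cast_mul, Int.cast_natCast, Int.cast_natCast,
    ZMod.natCast_zmod_val]
  ring

variable {A 𝒴 : Finset (ℤ × ℤ)} {T : Finset ((ℤ × ℤ) × (ℤ × ℤ))}

lemma fiberEnergy_le (hp : p.Prime) (hMN : M ≤ N)
    (hT : ∀ x, x ∈ T ↔ (x.1 ∈ 𝒴 ∧ x.2 ∈ A) ∧ ExactPair p M x.1 x.2)
    {ν Θ : ℝ} (hν : 0 < ν) (ξ : ZMod (p ^ N))
    (hfib : ∀ ρ, ((T.filter fun x => cross x.1 x.2 / (p ^ M : ℕ) = ρ).card : ℝ) ≤ ν)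
    (hΘ : ∀ ζ : ℤ → ℂ, (∀ r, ‖ζ r‖ ≤ 1) →
      ‖∑ y ∈ 𝒴, ∑ u ∈ A, phaseTerm p M ζ z (ξ.val : ℤ) y u‖ ≤ Θ) :
    fiberEnergy T (fun x => (pairRes p M N z x : ZMod (p ^ N)))
      (fun x => cross x.1 x.2 / (p ^ M : ℕ)) ξ ≤ ν * Θ := by
  classical
  obtain ⟨F, hF⟩ : ∃ F : ℤ → ℂ, F = fun ρ => ∑ x ∈ T.filter (fun x => cross x.1 x.2 / (p ^ M : ℕ) = ρ),
    pairPhase p M z (ξ.val : ℤ) x.1 x.2 := ⟨_, rfl⟩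
  have hFn : ∀ ρ, ‖F ρ‖ ≤ ν := by
    intro ρ
    refine le_trans ?_ (hfib ρ)
    rw [hF, ← nsmul_one (Finset.card _), ← Finset.sum_const]
    refine (norm_sum_le _ _).trans (Finset.sum_le_sum fun x _ => ?_)
    unfold pairPhase
    rw [AddChar.norm_apply]
  have e1 : fiberEnergy T (fun x => (pairRes p M N z x : ZMod (p ^ N)))
      (fun x => cross x.1 x.2 / (p ^ M : ℕ)) ξ =
      ∑ ρ ∈ T.image (fun x => cross x.1 x.2 / (p ^ M : ℕ)), ‖F ρ‖ ^ 2 := by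
    unfold fiberEnergy
    simp_rw [stdAddChar_pairRes_mul hp hMN, hF]
  have e2 : ((∑ ρ ∈ T.image (fun x => cross x.1 x.2 / (p ^ M : ℕ)), ‖F ρ‖ ^ 2 : ℝ) : ℂ) =
      ∑ x ∈ T, (starRingEnd ℂ) (F (cross x.1 x.2 / (p ^ M : ℕ))) *
        pairPhase p M z (ξ.val : ℤ) x.1 x.2 := by
    rw [← Finset.sum_fiberwise_of_maps_to
      (g := fun x : (ℤ × ℤ) × (ℤ × ℤ) => cross x.1 x.2 / (p ^ M : ℕ))
      (fun x hx => Finset.mem_image_of_mem _ hx), Complex.ofReal_sum]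
    refine Finset.sum_congr rfl fun ρ _ => ?_
    have h1 : ((‖F ρ‖ ^ 2 : ℝ) : ℂ) = (starRingEnd ℂ) (F ρ) * F ρ := by
      rw [mul_comm, Complex.mul_conj, Complex.normSq_eq_norm_sq]
    rw [h1]
    nth_rw 2 [hF]
    rw [Finset.mul_sum]
    refine Finset.sum_congr rfl fun x hx => ?_
    rw [(Finset.mem_filter.mp hx).2]
  have e3 : ∑ x ∈ T, (starRingEnd ℂ) (F (cross x.1 x.2 / (p ^ M : ℕ))) *
        pairPhase p M z (ξ.val : ℤ) x.1 x.2 =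
      ν * ∑ y ∈ 𝒴, ∑ u ∈ A, phaseTerm p M (fun ρ => (starRingEnd ℂ) (F ρ) / ν) z (ξ.val : ℤ) y u := by
    have hν0 : (ν : ℂ) ≠ 0 := by exact_mod_cast hν.ne'
    have hTe : T = (𝒴 ×ˢ A).filter fun x => ExactPair p M x.1 x.2 := by
      ext x
      rw [hT, Finset.mem_filter, Finset.mem_product]
    rw [← Finset.sum_product', hTe, Finset.sum_filter, Finset.mul_sum]
    refine Finset.sum_congr rfl fun x _ => ?_
    unfold phaseTerm
    split_ifs
    · field_simp
    · rw [mul_zero]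
  rw [e1]
  have h0 : (0 : ℝ) ≤ ∑ ρ ∈ T.image (fun x => cross x.1 x.2 / (p ^ M : ℕ)), ‖F ρ‖ ^ 2 :=
    Finset.sum_nonneg fun _ _ => by positivity
  rw [← Complex.norm_of_nonneg h0, e2, e3, norm_mul, Complex.norm_of_nonneg hν.le]
  refine mul_le_mul_of_nonneg_left (hΘ _ fun r => ?_) hν.le
  rw [norm_div, RCLike.norm_conj, Complex.norm_of_nonneg hν.le]
  exact div_le_one_of_le₀ (hFn r) hν.le

end

section
variable {p M : ℕ} {A 𝒴 : Finset (ℤ × ℤ)} {T : Finset ((ℤ × ℤ) × (ℤ × ℤ))}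

lemma card_exactPair_fiber_le {n Z B : ℕ} (hA : VecFam A n Z) (hn : 0 < n)
    (hT : ∀ x, x ∈ T ↔ (x.1 ∈ 𝒴 ∧ x.2 ∈ A) ∧ ExactPair p M x.1 x.2)
    (h𝒴 : ∀ y ∈ 𝒴, InBox B y) (ρ : ℤ) :
    ((T.filter fun x => cross x.1 x.2 / (p ^ M : ℕ) = ρ).card : ℝ) ≤
      (n : ℝ) ^ 2 * (2 * B * Z / n + 1) := by
  classical
  have hcross : ∀ x ∈ T, cross x.1 x.2 / (p ^ M : ℕ) = ρ → cross x.1 x.2 = (p ^ M : ℕ) * ρ := by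
    intro x hx h
    rw [← h, Int.mul_ediv_cancel' ((hT x).mp hx).2.1]
  have h1 : (T.filter fun x => cross x.1 x.2 / (p ^ M : ℕ) = ρ).card ≤
      ∑ u ∈ A, (𝒴.filter fun y => cross y u = (p ^ M : ℕ) * ρ).card := by
    rw [← Finset.card_sigma]
    refine Finset.card_le_card_of_injOn (fun x => ⟨x.2, x.1⟩) ?_ ?_
    · intro x hx
      have hx := Finset.mem_filter.mp hx
      have h2 := (hT x).mp hx.1
      rw [Finset.mem_coe, Finset.mem_sigma, Finset.mem_filter]
      exact ⟨h2.1.2, h2.1.1, hcross x hx.1 hx.2⟩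
    · rintro ⟨a, b⟩ _ ⟨c, d⟩ _ h
      simp only [Sigma.mk.injEq, heq_eq_eq] at h
      rw [h.1, h.2]
  have h2 : ((∑ u ∈ A, (𝒴.filter fun y => cross y u = (p ^ M : ℕ) * ρ).card : ℕ) : ℝ) ≤
      A.card * (2 * B * Z / n + 1) := by
    push_cast
    rw [← nsmul_eq_mul, ← Finset.sum_const]
    refine Finset.sum_le_sum fun u hu => hA.card_box_cross_eq_le hu hn ((p ^ M : ℕ) * ρ) _ ?_
    intro y hy
    obtain ⟨h3, h4⟩ := Finset.mem_filter.mp hy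
    exact ⟨h𝒴 y h3, by exact_mod_cast h4⟩
  have h3 : (A.card : ℝ) ≤ (n : ℝ) ^ 2 := by exact_mod_cast hA.card_le_sq
  calc ((T.filter fun x => cross x.1 x.2 / (p ^ M : ℕ) = ρ).card : ℝ) ≤ _ := by exact_mod_cast h1
    _ ≤ _ := h2
    _ ≤ _ := by gcongr

lemma abs_cross_le {B n : ℕ} {y u : ℤ × ℤ} (hy : InBox B y) (hu : InBox n u) :
    |cross y u| ≤ (2 * B * n : ℕ) := by
  have h1 := abs_sub (y.1 * u.2) (y.2 * u.1)
  rw [abs_mul, abs_mul] at h1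
  have h2 := mul_le_mul hy.1 hu.2 (abs_nonneg _) (by positivity)
  have h3 := mul_le_mul hy.2 hu.1 (abs_nonneg _) (by positivity)
  unfold cross
  push_cast
  linarith

lemma card_exactPair_image_le (hp : p.Prime) {n Z B : ℕ} (hA : VecFam A n Z)
    (hT : ∀ x, x ∈ T ↔ (x.1 ∈ 𝒴 ∧ x.2 ∈ A) ∧ ExactPair p M x.1 x.2)
    (h𝒴 : ∀ y ∈ 𝒴, InBox B y) :
    ((T.image fun x => cross x.1 x.2 / (p ^ M : ℕ)).card : ℝ) ≤
      4 * B * n / (p : ℝ) ^ M := by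
  classical
  have h1 : (T.image fun x => cross x.1 x.2 / (p ^ M : ℕ)) =
      (T.image fun x => cross x.1 x.2).image fun c : ℤ => c / (p ^ M : ℕ) := by
    rw [Finset.image_image]; rfl
  have h2 := card_nonzero_multiples_le (T.image fun x => cross x.1 x.2) (pow_pos hp.pos M)
    (2 * B * n) (by
      intro c hc
      obtain ⟨x, hx, rfl⟩ := Finset.mem_image.mp hc
      obtain ⟨⟨h3, h4⟩, h5⟩ := (hT x).mp hx
      refine ⟨h5.1, abs_cross_le (h𝒴 _ h3) (hA.inBox h4), fun h => h5.2 ?_⟩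
      rw [h]
      exact dvd_zero _)
  rw [h1]
  have h3 : (((2 * B * n) / p ^ M : ℕ) : ℝ) ≤ 2 * B * n / (p : ℝ) ^ M := by
    exact_mod_cast Nat.cast_div_le
  have h4 : (((T.image fun x => cross x.1 x.2).image fun c : ℤ => c / (p ^ M : ℕ)).card : ℝ) ≤
      2 * ((2 * B * n) / p ^ M : ℕ) := by
    exact_mod_cast Finset.card_image_le.trans h2
  calc _ ≤ _ := h4
    _ ≤ 2 * (2 * B * n / (p : ℝ) ^ M) := by gcongr
    _ = _ := by ring

end

lemma card_le_of_inBox {B : ℕ} {s : Finset (ℤ × ℤ)} (hs : ∀ y ∈ s, InBox B y) :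
    s.card ≤ (2 * B + 1) ^ 2 := by
  refine (Finset.card_le_card (t := latBox B) fun y hy => mem_latBox.mpr (hs y hy)).trans ?_
  unfold latBox
  rw [Finset.card_product, Int.card_Icc]
  have : ((B : ℤ) + 1 - -(B : ℤ)).toNat = 2 * B + 1 := by omega
  rw [this, sq]

lemma box_count_le {B n Q Z : ℝ} (hn : 0 < n) (hQ : 0 < Q) (hZ : 91 ≤ Z) (hnB : n ≤ B)
    (hQB : Q ≤ B * n) :
    (4 * (3 * B) * n / Q + 1) * (2 * (3 * B) * Z / n + 1) ≤ B ^ 2 * Z ^ 2 / Q := by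
  have hB : 0 < B := hn.trans_le hnB
  have h1 : 4 * (3 * B) * n / Q + 1 ≤ 13 * (B * n / Q) := by
    have : 1 ≤ B * n / Q := (one_le_div hQ).mpr hQB
    have e : 4 * (3 * B) * n / Q = 12 * (B * n / Q) := by ring
    linarith
  have h2 : 2 * (3 * B) * Z / n + 1 ≤ 7 * (B * Z / n) := by
    have : 1 ≤ B * Z / n := (one_le_div hn).mpr (by nlinarith)
    have e : 2 * (3 * B) * Z / n = 6 * (B * Z / n) := by ring
    linarith
  calc _ ≤ 13 * (B * n / Q) * (7 * (B * Z / n)) := by gcongr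
    _ = B ^ 2 * Z / Q * 91 := by field_simp; norm_num
    _ ≤ B ^ 2 * Z / Q * Z := by gcongr
    _ = _ := by ring

lemma nonprim_count_le {B n Q Z P : ℝ} (hn : 0 < n) (hQ : 0 < Q) (hZ : 91 ≤ Z)
    (hQB : Q ≤ B * n) (hnB : n * Z ^ 640 ≤ B) (hP : Z ^ 210 ≤ P) :
    2 * ((4 * (2 * B / P) * n / (Q / P) + 1) * (2 * (2 * B / P) * Z / n + 1)) ≤
      B ^ 2 * Z ^ 2 / Q * (2 / Z ^ 210) := by
  have hZ0 : 0 < Z := by linarith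
  have hB : 0 < B := (by positivity : 0 < n * Z ^ 640).trans_le hnB
  have hP0 : 0 < P := (by positivity : 0 < Z ^ 210).trans_le hP
  have h1 : 4 * (2 * B / P) * n / (Q / P) + 1 ≤ 9 * (B * n / Q) := by
    have : 1 ≤ B * n / Q := (one_le_div hQ).mpr hQB
    have e : 4 * (2 * B / P) * n / (Q / P) = 8 * (B * n / Q) := by field_simp; norm_num
    linarith
  have h2 : 2 * (2 * B / P) * Z / n + 1 ≤ 4 * (B * Z / n / Z ^ 210) + B * Z / n / Z ^ 210 := by
    have e : 2 * (2 * B / P) * Z / n = 4 * (B * Z / n / P) := by field_simp; norm_num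
    have h3 : 1 ≤ B * Z / n / Z ^ 210 := by
      rw [div_div, one_le_div (by positivity)]
      calc n * Z ^ 210 ≤ n * Z ^ 640 := by gcongr <;> linarith
        _ ≤ B * 1 := by linarith
        _ ≤ B * Z := by gcongr; linarith
    rw [e]
    gcongr
  calc _ ≤ 2 * (9 * (B * n / Q) * (4 * (B * Z / n / Z ^ 210) + B * Z / n / Z ^ 210)) := by gcongr
    _ = B ^ 2 * Z / Q * (2 / Z ^ 210) * 45 := by field_simp; norm_num
    _ ≤ B ^ 2 * Z / Q * (2 / Z ^ 210) * Z := by gcongr; linarith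
    _ = _ := by ring

lemma bracket_le {Z N X H σ δ E : ℝ} (hZ : 91 ≤ Z) (hN : 0 ≤ N)
    (hX : Z ^ 209 ≤ X) (hH : Z ^ 210 ≤ H) (hσ : σ ≤ 1 / Z ^ 210) (hδ : δ ≤ 1 / Z ^ 210)
    (hE : E = N * (2 / Z ^ 210)) :
    2 * N + 2 * Z * (X / H) * (2 * N) + 2 * Z * X * (N * (2 * σ + δ) + E) ≤ N * (X / Z ^ 208) := by
  have hZ0 : 0 < Z := by linarith
  have hX0 : 0 < X := (by positivity : 0 < Z ^ 209).trans_le hX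
  have h1 : 1 ≤ X / Z ^ 209 := (one_le_div (by positivity)).mpr hX
  have h2 : X / H ≤ X / Z ^ 210 := by gcongr
  calc _ ≤ 2 * N * (X / Z ^ 209) + 2 * Z * (X / Z ^ 210) * (2 * N) +
        2 * Z * X * (N * (2 * (1 / Z ^ 210) + 1 / Z ^ 210) + N * (2 / Z ^ 210)) := by
        rw [hE]
        have : 2 * N ≤ 2 * N * (X / Z ^ 209) := le_mul_of_one_le_right (by positivity) h1
        gcongr
    _ = N * (X / Z ^ 209) * 16 := by field_simp; ring
    _ ≤ N * (X / Z ^ 209) * Z := by gcongr; linarith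
    _ = _ := by field_simp

lemma card_nonprim_le {p : ℕ} (hp : p.Prime) {M : ℕ} {B n Z : ℕ} {A : Finset (ℤ × ℤ)}
    (hA : VecFam A n Z) (hn : 0 < n) {u : ℤ × ℤ} (hu : u ∈ A) (s : Finset (ℤ × ℤ))
    (hs : ∀ y ∈ s, InBox (2 * B : ℕ) y ∧ ¬ PrimMod p y ∧ ((p ^ (M + 1) : ℕ) : ℤ) ∣ cross y u) :
    (s.card : ℝ) ≤ (4 * (2 * B / p) * n / ((p : ℝ) ^ (M + 1) / p) + 1) *
      (2 * (2 * B / p) * Z / n + 1) := by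
  classical
  have hpz : (0 : ℤ) < p := by exact_mod_cast hp.pos
  have hpr : (0 : ℝ) < p := by exact_mod_cast hp.pos
  have hdiv : ∀ y ∈ s, ∃ a b : ℤ, y = (p * a, p * b) := by
    intro y hy
    obtain ⟨⟨a, ha⟩, b, hb⟩ := not_not.mp (hs y hy).2.1
    exact ⟨a, b, Prod.ext ha hb⟩
  have hcard : (s.image fun y => (y.1 / (p : ℤ), y.2 / (p : ℤ))).card = s.card := by
    refine Finset.card_image_of_injOn fun y hy y' hy' h => ?_
    obtain ⟨a, b, rfl⟩ := hdiv y hy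
    obtain ⟨a', b', rfl⟩ := hdiv y' hy'
    simpa [hpz.ne'] using h
  have h := hA.card_box_parallel_le hu (pow_pos hp.pos M) hn
    (s.image fun y => (y.1 / (p : ℤ), y.2 / (p : ℤ))) (B := 2 * B / p) (by
      intro w hw
      obtain ⟨y, hy, rfl⟩ := Finset.mem_image.mp hw
      obtain ⟨a, b, rfl⟩ := hdiv y hy
      obtain ⟨⟨h1, h2⟩, -, h3⟩ := hs _ hy
      simp only [abs_mul, abs_of_pos hpz] at h1 h2
      simp only [Int.mul_ediv_cancel_left _ hpz.ne']
      refine ⟨⟨?_, ?_⟩, ?_⟩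
      · push_cast at h1 ⊢
        rw [Int.le_ediv_iff_mul_le hpz]
        linarith
      · push_cast at h2 ⊢
        rw [Int.le_ediv_iff_mul_le hpz]
        linarith
      · have e : cross ((p : ℤ) * a, (p : ℤ) * b) u = p * cross (a, b) u := by
          unfold cross; ring
        rw [e, pow_succ'] at h3
        push_cast at h3 ⊢
        exact (mul_dvd_mul_iff_left hpz.ne').mp h3)
  rw [hcard] at h
  have h1 : ((2 * B / p : ℕ) : ℝ) ≤ 2 * B / p := by exact_mod_cast Nat.cast_div_le
  have h2 : (p : ℝ) ^ (M + 1) / p = (p ^ M : ℕ) := by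
    push_cast
    rw [pow_succ]
    field_simp
  rw [h2]
  have := hp.pos
  refine h.trans ?_
  gcongr

lemma norm_theta_le {p M m j S B n Z : ℕ} [NeZero (p ^ M)] (hp : p.Prime) (hZ : 91 ≤ Z)
    (hn : 0 < n) {A 𝒴 : Finset (ℤ × ℤ)} (hA : VecFam A n Z) (hM : m + j ≤ M)
    (hj : Z ^ 2000 ≤ p ^ (j + 1)) (h𝒴 : ∀ y ∈ 𝒴, InBox B y ∧ PrimMod p y)
    (h1 : n * Z ^ 640 ≤ B) (h2 : p ^ M * Z ^ 209 ≤ n ^ 2) (h3 : p ^ M * Z ^ 422 ≤ S ^ 2)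
    (h4 : 2 * S * n * Z ^ 420 ≤ B) {z : ℤ × ℤ → ℤ × ℤ}
    (hz : ∀ y, PrimMod p y → ((p ^ M : ℕ) : ℤ) ∣ cross y (z y) - 1)
    {ζ : ℤ → ℂ} (hζ : ∀ r, ‖ζ r‖ ≤ 1) {ξ : ℤ} (hξ : ¬ ((p ^ m : ℕ) : ℤ) ∣ ξ) :
    ‖∑ y ∈ 𝒴, ∑ u ∈ A, phaseTerm p M ζ z ξ y u‖ ≤
      3 * (B : ℝ) ^ 2 * (n : ℝ) ^ 2 / ((p : ℝ) ^ M * (Z : ℝ) ^ 103) := by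
  have hZ0 : 0 < Z := by omega
  have hm : 0 < m := by
    rcases Nat.eq_zero_or_pos m with h | h
    · rw [h] at hξ; simp at hξ
    · exact h
  have hB0 : 0 < B := lt_of_lt_of_le (by positivity) h1
  have hQ0 : 0 < p ^ M := pow_pos hp.pos _
  have hS0 : 0 < S := by
    rcases Nat.eq_zero_or_pos S with h | h
    · rw [h, zero_pow two_ne_zero] at h3
      exact absurd h3 (not_le.mpr (by positivity))
    · exact h
  have hnB : n ≤ B := (Nat.le_mul_of_pos_right n (by positivity)).trans h1
  have hQB : p ^ M ≤ B * n := by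
    calc p ^ M ≤ p ^ M * Z ^ 209 := Nat.le_mul_of_pos_right _ (by positivity)
      _ ≤ n ^ 2 := h2
      _ = n * n := sq n
      _ ≤ _ := Nat.mul_le_mul_right _ hnB
  obtain ⟨h, hh⟩ : ∃ h, h = Nat.log p (Z ^ 210) := ⟨_, rfl⟩
  have hh1 : p ^ h ≤ Z ^ 210 := by rw [hh]; exact Nat.pow_log_le_self p (by positivity)
  have hh2 : Z ^ 210 < p ^ (h + 1) := by rw [hh]; exact Nat.lt_pow_succ_log_self hp.one_lt _
  have hhj : h ≤ j := by
    by_contra hlt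
    push Not at hlt
    have : Z ^ 2000 ≤ Z ^ 210 := hj.trans ((Nat.pow_le_pow_right hp.pos hlt).trans hh1)
    exact absurd ((Nat.pow_le_pow_iff_right (by omega)).mp this) (by norm_num)
  have hgap : Z ^ 1790 ≤ p ^ (M + 1 - (m + h)) := by
    have e1 : p ^ (j + 1 - h) * p ^ h = p ^ (j + 1) := by rw [← pow_add]; congr 1; omega
    have e2 : Z ^ 1790 * Z ^ 210 ≤ p ^ (j + 1 - h) * Z ^ 210 := by
      calc Z ^ 1790 * Z ^ 210 = Z ^ 2000 := by rw [← pow_add]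
        _ ≤ p ^ (j + 1 - h) * p ^ h := by rw [e1]; exact hj
        _ ≤ _ := Nat.mul_le_mul_left _ hh1
    exact (Nat.le_of_mul_le_mul_right e2 (by positivity)).trans
      (Nat.pow_le_pow_right hp.pos (by omega))
  have hZr : (91 : ℝ) ≤ Z := by exact_mod_cast hZ
  have hZr0 : (0 : ℝ) < Z := by linarith
  have hnr : (0 : ℝ) < n := by exact_mod_cast hn
  have hQr : (0 : ℝ) < (p : ℝ) ^ M := by exact_mod_cast hQ0
  have hBr : (0 : ℝ) < B := by exact_mod_cast hB0
  have hSr : (0 : ℝ) < S := by exact_mod_cast hS0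
  have hpr : (0 : ℝ) < p := by exact_mod_cast hp.pos
  have r1 : (n : ℝ) * Z ^ 640 ≤ B := by exact_mod_cast h1
  have r2 : (p : ℝ) ^ M * Z ^ 209 ≤ (n : ℝ) ^ 2 := by exact_mod_cast h2
  have r3 : (p : ℝ) ^ M * Z ^ 422 ≤ (S : ℝ) ^ 2 := by exact_mod_cast h3
  have r4 : 2 * (S : ℝ) * n * Z ^ 420 ≤ B := by exact_mod_cast h4
  have rnB : (n : ℝ) ≤ B := by exact_mod_cast hnB
  have rQB : (p : ℝ) ^ M ≤ B * n := by exact_mod_cast hQB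
  have rgap : (Z : ℝ) ^ 1790 ≤ (p : ℝ) ^ (M + 1 - (m + h)) := by exact_mod_cast hgap
  obtain ⟨N, hN⟩ : ∃ N : ℝ, N = (B : ℝ) ^ 2 * Z ^ 2 / (p : ℝ) ^ M := ⟨_, rfl⟩
  have hN0 : 0 ≤ N := by rw [hN]; positivity
  have key : ∀ (b : ℕ) (c : ℤ × ℤ → Prop), p ^ b ≤ Z ^ 210 → p ^ (h + b) ≤ Z ^ 420 →
      (∀ y z : ℤ × ℤ, c (y.1 + (p ^ b : ℕ) * z.1, y.2 + (p ^ b : ℕ) * z.2) ↔ c y) →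
      (∀ y, PrimMod p y → c y) →
      (∀ u ∈ A, ∀ s : Finset (ℤ × ℤ), (∀ y ∈ s, InBox (2 * B : ℕ) y ∧ c y ∧ ¬ PrimMod p y ∧
        ((p ^ M : ℕ) : ℤ) ∣ cross y u) → 2 * (s.card : ℝ) ≤ N * (2 / (Z : ℝ) ^ 210)) →
      ‖∑ y ∈ 𝒴, ∑ u ∈ A, phaseTerm p M ζ z ξ y u‖ ≤
        3 * (B : ℝ) ^ 2 * (n : ℝ) ^ 2 / ((p : ℝ) ^ M * (Z : ℝ) ^ 103) := by
    intro b c hb hhb hc hcp hE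
    have rb : (p : ℝ) ^ b ≤ (Z : ℝ) ^ 210 := by exact_mod_cast hb
    have rhb : (p : ℝ) ^ (h + b) ≤ (Z : ℝ) ^ 420 := by exact_mod_cast hhb
    have hsm : 2 * p ^ b * S * n ≤ B := by
      refine le_trans ?_ h4
      calc 2 * p ^ b * S * n ≤ 2 * Z ^ 210 * S * n := by gcongr
        _ = 2 * S * n * Z ^ 210 := by ring
        _ ≤ _ := by
          gcongr
          all_goals omega
    have hσ : (p : ℝ) ^ (h + b) / √((p : ℝ) ^ (M + 1 - (m + h))) + √((p : ℝ) ^ M) / S ≤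
        1 / (Z : ℝ) ^ 210 := by
      have s1 : (p : ℝ) ^ (h + b) / √((p : ℝ) ^ (M + 1 - (m + h))) ≤ 1 / (2 * (Z : ℝ) ^ 210) := by
        have : 2 * (Z : ℝ) ^ 630 ≤ √((p : ℝ) ^ (M + 1 - (m + h))) := by
          apply Real.le_sqrt_of_sq_le
          refine le_trans ?_ rgap
          calc (2 * (Z : ℝ) ^ 630) ^ 2 = 4 * (Z : ℝ) ^ 1260 := by ring
            _ ≤ (Z : ℝ) * (Z : ℝ) ^ 1260 := by gcongr; linarith
            _ = (Z : ℝ) ^ 1261 := by ring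
            _ ≤ _ := by gcongr <;> linarith
        calc _ ≤ (Z : ℝ) ^ 420 / (2 * (Z : ℝ) ^ 630) := by gcongr
          _ = _ := by field_simp
      have s2 : √((p : ℝ) ^ M) / S ≤ 1 / (2 * (Z : ℝ) ^ 210) := by
        rw [div_le_div_iff₀ hSr (by positivity), one_mul]
        have : √((p : ℝ) ^ M) ≤ S / (Z : ℝ) ^ 211 := by
          apply Real.sqrt_le_iff.mpr ⟨by positivity, ?_⟩
          rw [div_pow, le_div_iff₀ (by positivity)]
          calc _ = (p : ℝ) ^ M * (Z : ℝ) ^ 422 := by ring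
            _ ≤ _ := r3
        calc _ ≤ S / (Z : ℝ) ^ 211 * (2 * (Z : ℝ) ^ 210) := by gcongr
          _ = S * (2 / Z) := by field_simp
          _ ≤ S * 1 := by
            gcongr
            rw [div_le_one hZr0]; linarith
          _ = _ := mul_one _
      calc _ ≤ 1 / (2 * (Z : ℝ) ^ 210) + 1 / (2 * (Z : ℝ) ^ 210) := add_le_add s1 s2
        _ = _ := by field_simp; norm_num
    have hδ : 2 * (p : ℝ) ^ b * S * n / B ≤ 1 / (Z : ℝ) ^ 210 := by
      rw [div_le_div_iff₀ hBr (by positivity), one_mul]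
      calc 2 * (p : ℝ) ^ b * S * n * (Z : ℝ) ^ 210 ≤ 2 * (Z : ℝ) ^ 210 * S * n * (Z : ℝ) ^ 210 := by
            gcongr
        _ = 2 * (S : ℝ) * n * Z ^ 420 := by ring
        _ ≤ _ := r4
    have main := norm_theta_sq_le (M := M) (z := z) (ζ := ζ) (ξ := ξ) hp hA hB0 hS0 (by omega) h𝒴
      hsm c hc hcp hz hζ hξ (σ := 1 / (Z : ℝ) ^ 210) (by positivity) hσ (N := N) (fun u hu => by
        have := hA.card_box_parallel_le hu hQ0 hn
          ((latBox (3 * B)).filter fun y => ((p ^ M : ℕ) : ℤ) ∣ cross y u) (B := 3 * B) (by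
            intro y hy
            obtain ⟨e1, e2⟩ := Finset.mem_filter.mp hy
            exact ⟨mem_latBox.mp e1, e2⟩)
        rw [hN]
        refine this.trans (le_trans (le_of_eq ?_) (box_count_le hnr hQr hZr rnB rQB))
        push_cast
        ring) hE hN0 (by positivity)
    have hcard1 : (𝒴.card : ℝ) ≤ 9 * (B : ℝ) ^ 2 := by
      have : 𝒴.card ≤ 9 * B ^ 2 := (card_le_of_inBox fun y hy => (h𝒴 y hy).1).trans (by nlinarith)
      exact_mod_cast this
    have hcard2 : (A.card : ℝ) ≤ (n : ℝ) ^ 2 := by exact_mod_cast hA.card_le_sq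
    have hbr := bracket_le (N := N) (X := (n : ℝ) ^ 2 / (p : ℝ) ^ M) (H := (p : ℝ) ^ (h + 1))
      (σ := 1 / (Z : ℝ) ^ 210) (δ := 2 * (p : ℝ) ^ b * S * n / B) hZr hN0
      (by rw [le_div_iff₀ hQr]; linarith) (by exact_mod_cast hh2.le) le_rfl hδ rfl
    refine (pow_le_pow_iff_left₀ (norm_nonneg _) (by positivity) two_ne_zero).mp ?_
    calc _ ≤ _ := main
      _ ≤ 9 * (B : ℝ) ^ 2 * ((n : ℝ) ^ 2 * (N * ((n : ℝ) ^ 2 / (p : ℝ) ^ M / (Z : ℝ) ^ 208))) := by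
        gcongr
        refine le_trans (le_of_eq ?_) hbr
        push_cast
        rw [show M + h + 1 = M + (h + 1) by ring, pow_add]
        ring
      _ = _ := by
        rw [hN]
        field_simp
        norm_num
  by_cases hpZ : p ≤ Z ^ 210
  · refine key 1 (PrimMod p) (by simpa using hpZ) ?_ ?_ (fun y h => h) ?_
    · rw [pow_succ]
      calc p ^ h * p ≤ Z ^ 210 * Z ^ 210 := Nat.mul_le_mul hh1 hpZ
        _ = _ := by rw [← pow_add]
    · intro y z
      unfold PrimMod
      simp only [pow_one]
      rw [dvd_add_left (dvd_mul_right _ _), dvd_add_left (dvd_mul_right _ _)]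
    · intro u hu s hs
      have : s = ∅ := Finset.eq_empty_of_forall_notMem fun y hy => (hs y hy).2.2.1 (hs y hy).2.1
      rw [this]
      simp only [Finset.card_empty, Nat.cast_zero, mul_zero]
      positivity
  · push Not at hpZ
    have hh0 : h = 0 := by rw [hh]; exact Nat.log_of_lt hpZ
    refine key 0 (fun _ => True) (by simpa using Nat.one_le_pow _ _ hZ0) ?_ (fun _ _ => Iff.rfl)
      (fun _ _ => trivial) ?_
    · rw [hh0]; simpa using Nat.one_le_pow _ _ hZ0
    · intro u hu s hs
      obtain ⟨M', rfl⟩ : ∃ M', M = M' + 1 := ⟨M - 1, by omega⟩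
      have := card_nonprim_le hp hA hn hu s (M := M') (B := B) fun y hy =>
        ⟨(hs y hy).1, (hs y hy).2.2⟩
      rw [hN]
      refine le_trans ?_ (nonprim_count_le hnr hQr hZr rQB r1 (P := p) (by exact_mod_cast hpZ.le))
      linarith

section
variable {p M N : ℕ} [NeZero (p ^ M)] {z : ℤ × ℤ → ℤ × ℤ}

lemma cheap_pairRes (hp : p.Prime) (hMN : M ≤ N) {x : (ℤ × ℤ) × (ℤ × ℤ)}
    (hx : ExactPair p M x.1 x.2) {Λ : ℝ}
    (h : Cheap Λ ((cross x.2 (z x.1) : ℚ) / cross x.1 x.2)) :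
    ∃ s : ℤ, Cheap Λ ((pairRes p M N z x : ℚ) / (p : ℚ) ^ N +
      (s : ℚ) / ((cross x.1 x.2 / (p ^ M : ℕ) : ℤ) : ℚ)) := by
  obtain ⟨hd, hnd⟩ := (exactPair_iff hp).mp hx
  obtain ⟨ρ, hρ⟩ := hd
  have hP0 : ((p ^ M : ℕ) : ℤ) ≠ 0 := by exact_mod_cast (pow_pos hp.pos M).ne'
  have hdiv : cross x.1 x.2 / (p ^ M : ℕ) = ρ := by rw [hρ, Int.mul_ediv_cancel_left _ hP0]
  rw [hdiv] at hnd
  have hρ0 : (ρ : ℚ) ≠ 0 := by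
    intro h0
    exact hnd (by rw [Int.cast_eq_zero.mp h0]; exact dvd_zero _)
  have hpq : (p : ℚ) ≠ 0 := by exact_mod_cast hp.ne_zero
  obtain ⟨i, hi⟩ : ∃ i : ℕ, i = ((ρ : ZMod (p ^ M))⁻¹).val := ⟨_, rfl⟩
  have hunit : (((p ^ M : ℕ) : ℤ)) ∣ 1 - ρ * i := by
    rw [← ZMod.intCast_zmod_eq_zero_iff_dvd]
    push_cast
    rw [hi, ZMod.natCast_zmod_val, ZMod.mul_inv_of_unit, sub_self]
    have hco : IsCoprime ρ ((p ^ M : ℕ) : ℤ) := by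
      push_cast
      exact (((Nat.prime_iff_prime_int.mp hp).coprime_iff_not_dvd).mpr hnd).symm.pow_right
    obtain ⟨a, b, hab⟩ := hco
    have h1 := congrArg (Int.cast : ℤ → ZMod (p ^ M)) hab
    refine IsUnit.of_mul_eq_one (a : ZMod (p ^ M)) ?_
    rw [Int.cast_add, Int.cast_mul, Int.cast_mul, Int.cast_natCast, ZMod.natCast_self, mul_zero,
      add_zero, Int.cast_one, mul_comm] at h1
    exact h1
  obtain ⟨c, hc⟩ := hunit
  refine ⟨cross x.2 (z x.1) * c, ?_⟩
  rw [hdiv]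
  convert h using 1
  unfold pairRes
  rw [hdiv, ← hi, hρ]
  have hc' : (1 : ℚ) - ρ * i = (p : ℚ) ^ M * c := by exact_mod_cast hc
  have e : (p : ℚ) ^ N = (p : ℚ) ^ (N - M) * (p : ℚ) ^ M := by
    rw [← pow_add, Nat.sub_add_cancel hMN]
  push_cast
  rw [e]
  field_simp
  linear_combination (-(cross x.2 (z x.1) : ℚ)) * hc'

variable [NeZero (p ^ N)]

/-- A spectral gap for the second family yields a cheap representative of `b / p ^ m`. -/
lemma exists_cheap_of_fiberEnergy (hp : p.Prime) {m M₁ r₁ : ℕ} (hm : m ≤ N) (hM₁ : M₁ ≤ N)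
    (hM : M ≤ N) {Λ : ℝ} {T₁ : Finset ℤ} (hT₁ : ∀ τ ∈ T₁, 0 ≤ τ ∧ τ < (p ^ M₁ : ℕ))
    (hc₁ : ∀ τ ∈ T₁, ∃ s : ℤ, Cheap Λ ((τ : ℚ) / (p ^ M₁ : ℕ) + (s : ℚ) / r₁))
    {T : Finset ((ℤ × ℤ) × (ℤ × ℤ))} (hT : ∀ x ∈ T, ExactPair p M x.1 x.2)
    (hc : ∀ x ∈ T, Cheap Λ ((cross x.2 (z x.1) : ℚ) / cross x.1 x.2)) {η : ℝ} (hη0 : 0 ≤ η)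
    (hE0 : 0 < fiberEnergy T (fun x => (pairRes p M N z x : ZMod (p ^ N)))
      (fun x => cross x.1 x.2 / (p ^ M : ℕ)) 0)
    (hη : ∀ ξ : ZMod (p ^ N), ¬ ((p ^ m : ℕ) : ℤ) ∣ (ξ.val : ℤ) →
      fiberEnergy T (fun x => (pairRes p M N z x : ZMod (p ^ N)))
        (fun x => cross x.1 x.2 / (p ^ M : ℕ)) ξ ≤
      η * fiberEnergy T (fun x => (pairRes p M N z x : ZMod (p ^ N)))
        (fun x => cross x.1 x.2 / (p ^ M : ℕ)) 0)
    (hB : η * (p : ℝ) ^ N < T₁.card) (b : ℤ) :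
    ∃ x ∈ T, ∃ s₁ s₃ : ℤ, Cheap (4 * Λ) ((b : ℚ) / (p ^ m : ℕ) + (s₁ : ℚ) / r₁ +
      (s₃ : ℚ) / ((cross x.1 x.2 / (p ^ M : ℕ) : ℤ) : ℚ)) := by
  classical
  have hpq : (p : ℚ) ≠ 0 := by exact_mod_cast hp.ne_zero
  have hpz : (0 : ℤ) < p := by exact_mod_cast hp.pos
  have hcard : (T₁.image fun τ => (((p : ℤ) ^ (N - M₁) * τ : ℤ) : ZMod (p ^ N))).card = T₁.card := by
    refine Finset.card_image_of_injOn fun τ hτ τ' hτ' h => ?_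
    have h2 := (ZMod.intCast_eq_intCast_iff_dvd_sub _ _ _).mp h
    have e : ((p ^ N : ℕ) : ℤ) = (p : ℤ) ^ (N - M₁) * ((p ^ M₁ : ℕ) : ℤ) := by
      push_cast
      rw [← pow_add, Nat.sub_add_cancel hM₁]
    rw [e, ← mul_sub, mul_dvd_mul_iff_left (by positivity)] at h2
    obtain ⟨h3, h4⟩ := hT₁ τ hτ
    obtain ⟨h5, h6⟩ := hT₁ τ' hτ'
    have := Int.eq_zero_of_abs_lt_dvd h2 (by rw [abs_lt]; constructor <;> linarith)
    linarith
  obtain ⟨β, hβ, β', hβ', k, hk, k', hk', hr, heq⟩ := exists_add_sub_eq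
    (T₁.image fun τ => (((p : ℤ) ^ (N - M₁) * τ : ℤ) : ZMod (p ^ N))) T
    (fun x => (pairRes p M N z x : ZMod (p ^ N))) (fun x => cross x.1 x.2 / (p ^ M : ℕ))
    (((p : ℤ) ^ (N - m) * b : ℤ) : ZMod (p ^ N))
    (fun ξ => ((p ^ m : ℕ) : ℤ) ∣ (ξ.val : ℤ)) (by
      rintro ξ ⟨c, hξ⟩
      have e : ξ = ((ξ.val : ℤ) : ZMod (p ^ N)) := by
        rw [Int.cast_natCast, ZMod.natCast_zmod_val]
      rw [e, hξ, ← Int.cast_mul, ZMod.intCast_zmod_eq_zero_iff_dvd]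
      refine ⟨b * c, ?_⟩
      have e2 : (p : ℤ) ^ N = (p : ℤ) ^ (N - m) * (p : ℤ) ^ m := by
        rw [← pow_add, Nat.sub_add_cancel hm]
      push_cast
      rw [e2]
      ring) (by simp) hE0 hη hη0 (by rw [hcard]; exact_mod_cast hB)
  obtain ⟨τ, hτ, rfl⟩ := Finset.mem_image.mp hβ
  obtain ⟨τ', hτ', rfl⟩ := Finset.mem_image.mp hβ'
  obtain ⟨s, hs⟩ := hc₁ τ hτ
  obtain ⟨s', hs'⟩ := hc₁ τ' hτ'
  obtain ⟨a, ha⟩ := cheap_pairRes (N := N) hp hM (hT k hk) (hc k hk)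
  obtain ⟨a', ha'⟩ := cheap_pairRes (N := N) hp hM (hT k' hk') (hc k' hk')
  rw [← Int.cast_sub, ← Int.cast_sub, ← Int.cast_add,
    ZMod.intCast_eq_intCast_iff_dvd_sub] at heq
  obtain ⟨c, hcc⟩ := heq
  refine ⟨k, hk, s - s', a - a', ?_⟩
  have hsum := (((hs.add hs'.neg).add (ha.add ha'.neg)).add_int c)
  have hr' : cross k.1 k.2 / (p ^ M : ℕ) = cross k'.1 k'.2 / (p ^ M : ℕ) := hr
  rw [← hr'] at hsum
  refine Cheap.mono ?_ (le_of_eq (by ring : Λ + Λ + (Λ + Λ) = 4 * Λ))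
  convert hsum using 1
  have e1 : (p : ℚ) ^ N = (p : ℚ) ^ (N - M₁) * (p : ℚ) ^ M₁ := by
    rw [← pow_add, Nat.sub_add_cancel hM₁]
  have e2 : (p : ℚ) ^ N = (p : ℚ) ^ (N - m) * (p : ℚ) ^ m := by
    rw [← pow_add, Nat.sub_add_cancel hm]
  have hcq : ((p : ℚ) ^ (N - m) * b) - ((p : ℚ) ^ (N - M₁) * τ - (p : ℚ) ^ (N - M₁) * τ' +
      (pairRes p M N z k - pairRes p M N z k')) = (p : ℚ) ^ N * c := by exact_mod_cast hcc
  have f1 : ∀ x : ℚ, x / (p : ℚ) ^ M₁ = (p : ℚ) ^ (N - M₁) * x / (p : ℚ) ^ N := by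
    intro x; rw [e1]; field_simp
  have f2 : (b : ℚ) / (p : ℚ) ^ m = (p : ℚ) ^ (N - m) * b / (p : ℚ) ^ N := by
    rw [e2]; field_simp
  push_cast
  rw [f1, f1, f2]
  have f3 : (c : ℚ) = (p : ℚ) ^ N * c / (p : ℚ) ^ N := by field_simp
  rw [f3, ← hcq]
  ring

end

lemma spectral_gap_bound {R Z Q c V E₀ E : ℝ} (hR : 1 ≤ R) (hZ : 91 ≤ Z) (hQ : 0 < Q)
    (hc : R ^ 6 * Z ^ 2080 ≤ 16 * Z ^ 2 * Q * c) (hV : V ≤ 16 * R ^ 3 * Z ^ 1046 / Q)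
    (hE₀ : c ^ 2 ≤ V * E₀) (hE₀' : 0 ≤ E₀)
    (hE : E ≤ 9 * R ^ 3 * Z ^ 1047 * (48 * R ^ 6 * Z ^ 1989 / Q)) :
    E ≤ 1 / Z ^ 70 * E₀ := by
  have hZ0 : 0 < Z := by linarith
  have hR0 : 0 < R := by linarith
  have hc2 : R ^ 6 * Z ^ 2078 / (16 * Q) ≤ c := by
    rw [div_le_iff₀ (by positivity)]
    refine le_of_mul_le_mul_left ?_ (by positivity : 0 < Z ^ 2)
    calc Z ^ 2 * (R ^ 6 * Z ^ 2078) = R ^ 6 * Z ^ 2080 := by ring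
      _ ≤ _ := hc
      _ = _ := by ring
  have h1 : (R ^ 6 * Z ^ 2078 / (16 * Q)) ^ 2 ≤ 16 * R ^ 3 * Z ^ 1046 / Q * E₀ := by
    calc _ ≤ c ^ 2 := by gcongr
      _ ≤ _ := hE₀
      _ ≤ _ := by gcongr
  have h2 : R ^ 9 * Z ^ 3110 / (4096 * Q) ≤ E₀ := by
    refine le_of_mul_le_mul_left ?_ (by positivity : 0 < 16 * R ^ 3 * Z ^ 1046 / Q)
    refine le_trans (le_of_eq ?_) h1
    field_simp
    ring
  calc E ≤ 9 * R ^ 3 * Z ^ 1047 * (48 * R ^ 6 * Z ^ 1989 / Q) := hE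
    _ = 1769472 * (R ^ 9 * Z ^ 3036 / (4096 * Q)) := by field_simp; ring
    _ ≤ Z ^ 4 * (R ^ 9 * Z ^ 3036 / (4096 * Q)) := by
        gcongr
        calc (1769472 : ℝ) ≤ 91 ^ 4 := by norm_num
          _ ≤ _ := by gcongr
    _ = 1 / Z ^ 70 * (R ^ 9 * Z ^ 3110 / (4096 * Q)) := by field_simp
    _ ≤ _ := by gcongr

namespace BlockSystem

variable {K : Finset SLTwo} {Y : ℕ}

lemma exists_cheap_residues_of_scale (hK : BlockSystem K Y) (hY : 0 < Y) {L : ℕ}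
    (hL : ∀ i j k : ℕ, ∀ l ∈ words K i, ∀ l' ∈ words K i, ∀ h ∈ words K j,
      ∀ w ∈ words K (j + k), ∀ u ∈ words K k, Cheap ((L * (2 * i + 2 * (j + k) + 1) : ℕ) : ℝ)
      ((cross (act u (1, 1)) (act (h⁻¹ * l⁻¹ * l' * w) (0, 1)) : ℚ) /
        cross (act (h⁻¹ * l⁻¹ * l' * w) (1, 1)) (act u (1, 1))))
    {p : ℕ} (hp : p.Prime) {M₀ g t Z R : ℕ} (hg : 0 < g) (hZ : Z = Y ^ g) (hR : R = Y ^ (2 * t))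
    (hZ91 : 91 ≤ Z) (hZpow : ∀ k ≤ 10000 * g, 409600 ^ k ≤ Z) (ht : t ≤ 3001 * g)
    (hQ : p ^ M₀ ≤ R ^ 2) (hQ' : R ^ 2 ≤ p ^ M₀ * Z) :
    ∃ (M₁ r : ℕ) (T : Finset ℤ), M₀ ≤ M₁ ∧ 0 < r ∧ r ≤ Z ^ 5 ∧ p ^ M₁ ≤ R ^ 2 * Z ^ 4 ∧
      (∀ τ ∈ T, 0 ≤ τ ∧ τ < (p ^ M₁ : ℕ)) ∧
      (∀ τ ∈ T, ∃ s : ℤ, Cheap ((L * (20000 * g) : ℕ) : ℝ)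
        ((τ : ℚ) / (p ^ M₁ : ℕ) + (s : ℚ) / r)) ∧
      (R : ℝ) ^ 2 ≤ (Z : ℝ) ^ 20 * T.card := by
  have hn : Y ^ (2 * t + 2 * g) = R * Z ^ 2 := by rw [hZ, hR]; ring
  have hA := hK.vecFam_wordVecs hY (hZpow (2 * t + 2 * g) (by omega))
  rw [hn] at hA
  obtain ⟨A, hAd⟩ : ∃ A, A = wordVecs K (2 * t + 2 * g) := ⟨_, rfl⟩
  rw [← hAd] at hA
  have hZ0 : 0 < Z := by omega
  have hR0 : 0 < R := by rw [hR]; exact pow_pos hY _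
  have hdense : R ^ 2 * Z ^ 3 ≤ A.card := by
    refine Nat.le_of_mul_le_mul_left (le_trans (le_of_eq ?_) hA.dense) hZ0
    ring
  have hcard : 4 * p ^ M₀ ≤ A.card := by
    calc 4 * p ^ M₀ ≤ Z ^ 3 * R ^ 2 := by
          gcongr
          calc 4 ≤ Z := by omega
            _ ≤ Z ^ 3 := Nat.le_self_pow (by norm_num) Z
      _ = R ^ 2 * Z ^ 3 := mul_comm _ _
      _ ≤ _ := hdense
  have hcost : ∀ y ∈ A, ∀ u ∈ A, ∃ z, cross y z = 1 ∧
      Cheap ((L * (20000 * g) : ℕ) : ℝ) ((cross u z : ℚ) / cross y u) := by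
    intro y hy u hu
    rw [hAd] at hy hu
    obtain ⟨w, hw, rfl⟩ := Finset.mem_image.mp hy
    obtain ⟨v, hv, rfl⟩ := Finset.mem_image.mp hu
    refine ⟨act w (0, 1), cross_act_one_one_zero_one w, ?_⟩
    have h1 : (1 : SLTwo) ∈ words K 0 := by simp [words]
    have h2 := hL 0 0 (2 * t + 2 * g) 1 h1 1 h1 1 h1 w (by rwa [zero_add]) v hv
    simp only [inv_one, one_mul] at h2
    refine h2.mono ?_
    rw [Nat.cast_le]
    exact Nat.mul_le_mul_left _ (by omega)
  obtain ⟨M₁, r, T, h1, h2, h3, h4, h5, h6⟩ := exists_cheap_residues hp M₀ hA hcard hcost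
  have hP : 0 < p ^ M₁ := pow_pos hp.pos _
  have hPM : p ^ M₀ ≤ p ^ M₁ := Nat.pow_le_pow_right hp.pos h1
  have hn2 : (R * Z ^ 2) ^ 2 ≤ Z ^ 5 * p ^ M₁ := by
    calc (R * Z ^ 2) ^ 2 = R ^ 2 * Z ^ 4 := by ring
      _ ≤ p ^ M₁ * Z * Z ^ 4 := by
          gcongr
          exact hQ'.trans (Nat.mul_le_mul_right _ hPM)
      _ = _ := by ring
  refine ⟨M₁, r, T, h1, h2, Nat.le_of_mul_le_mul_right (h3.trans hn2) hP, ?_, h4, h5, ?_⟩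
  · calc p ^ M₁ ≤ r * p ^ M₁ := Nat.le_mul_of_pos_left _ h2
      _ ≤ _ := h3
      _ = _ := by ring
  · have hZr : (91 : ℝ) ≤ Z := by exact_mod_cast hZ91
    have hZr0 : (0 : ℝ) < Z := by linarith
    have hRr : (0 : ℝ) < R := by exact_mod_cast hR0
    have hPr : (0 : ℝ) < (p : ℝ) ^ M₁ := by exact_mod_cast hP
    have e1 : ((R * Z ^ 2 : ℕ) : ℝ) ^ 2 / (p : ℝ) ^ M₁ ≤ (Z : ℝ) ^ 5 := by
      rw [div_le_iff₀ hPr]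
      exact_mod_cast hn2
    have e2 : (R : ℝ) ^ 2 * (Z : ℝ) ^ 3 ≤ A.card := by exact_mod_cast hdense
    have e3 : 1 ≤ (Z : ℝ) ^ 5 := one_le_pow₀ (by linarith)
    refine le_of_mul_le_mul_left ?_ (by positivity : 0 < (R : ℝ) ^ 2 * (Z : ℝ) ^ 6)
    calc (R : ℝ) ^ 2 * (Z : ℝ) ^ 6 * (R : ℝ) ^ 2 = ((R : ℝ) ^ 2 * (Z : ℝ) ^ 3) ^ 2 := by ring
      _ ≤ (A.card : ℝ) ^ 2 := by gcongr
      _ ≤ _ := h6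
      _ ≤ 8 * ((R * Z ^ 2 : ℕ) : ℝ) ^ 2 * (3 * (Z : ℝ) ^ 5) ^ 4 * T.card := by
          gcongr
          linarith
      _ = 648 * ((R : ℝ) ^ 2 * (Z : ℝ) ^ 24 * T.card) := by push_cast; ring
      _ ≤ (Z : ℝ) ^ 2 * ((R : ℝ) ^ 2 * (Z : ℝ) ^ 24 * T.card) := by
          gcongr
          nlinarith
      _ = _ := by ring

lemma exists_pair_family_of_scale (hK : BlockSystem K Y) (hY : 0 < Y) {L : ℕ}
    (hL : ∀ i j k : ℕ, ∀ l ∈ words K i, ∀ l' ∈ words K i, ∀ h ∈ words K j,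
      ∀ w ∈ words K (j + k), ∀ u ∈ words K k, Cheap ((L * (2 * i + 2 * (j + k) + 1) : ℕ) : ℝ)
      ((cross (act u (1, 1)) (act (h⁻¹ * l⁻¹ * l' * w) (0, 1)) : ℚ) /
        cross (act (h⁻¹ * l⁻¹ * l' * w) (1, 1)) (act u (1, 1))))
    {p : ℕ} (hp : p.Prime) {M₀ g t Z R : ℕ} (hg : 0 < g) (hZ : Z = Y ^ g) (hR : R = Y ^ (2 * t))
    (hZ91 : 91 ≤ Z) (hZpow : ∀ k ≤ 10000 * g, 409600 ^ k ≤ Z) (ht : t ≤ 3001 * g)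
    (hQ : p ^ M₀ ≤ R ^ 2) :
    ∃ (M : ℕ) (A 𝒴 : Finset (ℤ × ℤ)) (z : ℤ × ℤ → ℤ × ℤ) (T : Finset ((ℤ × ℤ) × (ℤ × ℤ))),
      M₀ ≤ M ∧ p ^ M ≤ R ^ 2 * Z ^ 17 ∧ VecFam A (R * Z ^ 200) Z ∧
      (∀ y ∈ 𝒴, InBox (4 * R ^ 2 * Z ^ 846 : ℕ) y ∧ PrimMod p y) ∧
      (∀ y, PrimMod p y → ((p ^ M : ℕ) : ℤ) ∣ cross y (z y) - 1) ∧
      (∀ y ∈ 𝒴, ∀ u ∈ A, Cheap ((L * (20000 * g) : ℕ) : ℝ) ((cross u (z y) : ℚ) / cross y u)) ∧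
      (∀ x, x ∈ T ↔ (x.1 ∈ 𝒴 ∧ x.2 ∈ A) ∧ ExactPair p M x.1 x.2) ∧
      (R : ℝ) ^ 6 * (Z : ℝ) ^ 2080 ≤ 16 * (Z : ℝ) ^ 2 * (p : ℝ) ^ M * T.card := by
  classical
  have hR0 : 0 < R := by rw [hR]; exact pow_pos hY _
  have hi : Y ^ (3 * g) = Z ^ 3 := by rw [hZ]; ring
  have hk : (t + 320 * g) + (2 * t + 200 * g) = 3 * t + 520 * g := by ring
  have hpow : (Y ^ (3 * t + 520 * g)) ^ 4 = R ^ 6 * Z ^ 2080 := by rw [hZ, hR]; ring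
  have hQk : p ^ M₀ ≤ (Y ^ (3 * t + 520 * g)) ^ 2 := by
    refine hQ.trans (Nat.pow_le_pow_left ?_ 2)
    rw [hR]
    exact Nat.pow_le_pow_right hY (by omega)
  obtain ⟨M, hM, hMle, l, hl, l', hl', hne, X, hX, hexact, hXcard⟩ :=
    hK.exists_exact_pairs hY hp M₀ (hZpow (3 * g + (3 * t + 520 * g)) (by omega)) (by omega) hi hQk
  rw [← hk] at hX
  obtain ⟨𝒴, z, T, h𝒴, hcheap, hT, hXT⟩ := hK.exists_pair_family hY hl hl' hne
    (Λ := ((L * (20000 * g) : ℕ) : ℝ)) (by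
      intro h hh w hw u hu
      refine (hL (3 * g) (t + 320 * g) (2 * t + 200 * g) l hl l' hl' h hh w hw u hu).mono ?_
      rw [Nat.cast_le]
      exact Nat.mul_le_mul_left _ (by omega)) X hX hexact
  have hprim : ∀ y ∈ 𝒴, PrimMod p y := fun y hy => primMod_of_isCoprime hp (h𝒴 y hy).2.1
  have hex : ∀ y, ∃ v, (y ∈ 𝒴 → v = z y) ∧ (PrimMod p y → ((p ^ M : ℕ) : ℤ) ∣ cross y v - 1) := by
    intro y
    by_cases hy : y ∈ 𝒴
    · exact ⟨z y, fun _ => rfl, fun _ => by rw [(h𝒴 y hy).2.2, sub_self]; exact dvd_zero _⟩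
    · by_cases hy' : PrimMod p y
      · obtain ⟨v, hv⟩ := exists_cross_sub_one_dvd hp M hy'
        exact ⟨v, fun h => absurd h hy, fun _ => hv⟩
      · exact ⟨y, fun h => absurd h hy, fun h => absurd h hy'⟩
  choose z' hz1 hz2 using hex
  have hA := hK.vecFam_wordVecs hY (hZpow (2 * t + 200 * g) (by omega))
  have hn : Y ^ (2 * t + 200 * g) = R * Z ^ 200 := by rw [hZ, hR]; ring
  rw [hn] at hA
  have hB : 4 * Y ^ (2 * (3 * g) + 2 * (t + 320 * g) + (2 * t + 200 * g)) =
      4 * R ^ 2 * Z ^ 846 := by rw [hZ, hR]; ring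
  rw [hB] at h𝒴
  refine ⟨M, wordVecs K (2 * t + 200 * g), 𝒴, z', T, hM, hMle.trans (Nat.mul_le_mul_right _ hQ),
    hA, fun y hy => ⟨(h𝒴 y hy).1, hprim y hy⟩, hz2, ?_, hT, ?_⟩
  · intro y hy u hu
    rw [hz1 y hy]
    exact hcheap y hy u hu
  · have h1 : ((Y ^ (3 * t + 520 * g) : ℕ) : ℝ) ^ 4 = (R : ℝ) ^ 6 * (Z : ℝ) ^ 2080 := by
      exact_mod_cast hpow
    rw [← h1]
    refine hXcard.trans ?_
    gcongr

/-- Every fraction with denominator `p ^ m` is, up to two fractions with controlled denominators,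
a cheap number. -/
lemma exists_cheap_add_of_scale (hK : BlockSystem K Y) (hY : 0 < Y) {L : ℕ}
    (hL : ∀ i j k : ℕ, ∀ l ∈ words K i, ∀ l' ∈ words K i, ∀ h ∈ words K j,
      ∀ w ∈ words K (j + k), ∀ u ∈ words K k, Cheap ((L * (2 * i + 2 * (j + k) + 1) : ℕ) : ℝ)
      ((cross (act u (1, 1)) (act (h⁻¹ * l⁻¹ * l' * w) (0, 1)) : ℚ) /
        cross (act (h⁻¹ * l⁻¹ * l' * w) (1, 1)) (act u (1, 1))))
    {p : ℕ} (hp : p.Prime) {m j g t Z R : ℕ} (hg : 0 < g) (hZ : Z = Y ^ g) (hR : R = Y ^ (2 * t))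
    (hZ91 : 91 ≤ Z) (hZpow : ∀ k ≤ 10000 * g, 409600 ^ k ≤ Z) (ht : t ≤ 3001 * g)
    (hQ : p ^ (m + j) ≤ R ^ 2) (hQ' : R ^ 2 ≤ p ^ (m + j) * Z) (hj : Z ^ 2000 ≤ p ^ (j + 1))
    (b : ℤ) :
    ∃ (r₁ r₃ : ℕ) (s₁ s₃ : ℤ), 0 < r₁ ∧ 0 < r₃ ∧ r₁ ≤ Z ^ 5 ∧ r₃ ≤ R * Z ^ 1048 ∧
      Cheap (4 * ((L * (20000 * g) : ℕ) : ℝ))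
        ((b : ℚ) / (p ^ m : ℕ) + (s₁ : ℚ) / r₁ + (s₃ : ℚ) / r₃) := by
  obtain ⟨M₁, r₁, T₁, hM₁, hr₁, hr₁Z, hP₁, hT₁, hc₁, hcard₁⟩ :=
    hK.exists_cheap_residues_of_scale hY hL hp hg hZ hR hZ91 hZpow ht hQ hQ'
  obtain ⟨M, A, 𝒴, z, T, hM, hP, hA, h𝒴, hz, hcheap, hT, hcard⟩ :=
    hK.exists_pair_family_of_scale hY hL hp hg hZ hR hZ91 hZpow ht hQ
  have hZ0 : 0 < Z := by omega
  have hR0 : 0 < R := by rw [hR]; exact pow_pos hY _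
  have hn0 : 0 < R * Z ^ 200 := by positivity
  have hRP : R ^ 2 ≤ p ^ M * Z :=
    hQ'.trans (Nat.mul_le_mul_right _ (Nat.pow_le_pow_right hp.pos hM))
  obtain ⟨N, hN⟩ : ∃ N, N = max M₁ M := ⟨_, rfl⟩
  have hMN : M ≤ N := hN ▸ le_max_right _ _
  have hM₁N : M₁ ≤ N := hN ▸ le_max_left _ _
  have hPN : p ^ N ≤ R ^ 2 * Z ^ 17 := by
    rcases max_choice M₁ M with h | h
    · rw [hN, h]
      exact hP₁.trans (Nat.mul_le_mul_left _ (Nat.pow_le_pow_right hZ0 (by norm_num)))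
    · rw [hN, h]; exact hP
  have hi1 : NeZero (p ^ M) := ⟨(pow_pos hp.pos M).ne'⟩
  have hi2 : NeZero (p ^ N) := ⟨(pow_pos hp.pos N).ne'⟩
  have hZr : (91 : ℝ) ≤ Z := by exact_mod_cast hZ91
  have hZr0 : (0 : ℝ) < Z := by linarith
  have hRr : (1 : ℝ) ≤ R := by exact_mod_cast hR0
  have hRr0 : (0 : ℝ) < R := by linarith
  have hPr : (0 : ℝ) < (p : ℝ) ^ M := by exact_mod_cast pow_pos hp.pos M
  obtain ⟨E, hE⟩ : ∃ E : ZMod (p ^ N) → ℝ, E = fiberEnergy T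
    (fun x => (pairRes p M N z x : ZMod (p ^ N))) (fun x => cross x.1 x.2 / (p ^ M : ℕ)) := ⟨_, rfl⟩
  have hV : ((T.image fun x => cross x.1 x.2 / (p ^ M : ℕ)).card : ℝ) ≤
      16 * (R : ℝ) ^ 3 * (Z : ℝ) ^ 1046 / (p : ℝ) ^ M := by
    refine (card_exactPair_image_le hp hA hT fun y hy => (h𝒴 y hy).1).trans (le_of_eq ?_)
    push_cast
    ring
  have hcE : (T.card : ℝ) ^ 2 ≤
      ((T.image fun x => cross x.1 x.2 / (p ^ M : ℕ)).card : ℝ) * E 0 := by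
    rw [hE]
    exact sq_card_le_card_mul_fiberEnergy T _ _
  have hT0 : 0 < (T.card : ℝ) := by
    refine (pos_iff_pos_of_mul_pos (lt_of_lt_of_le (by positivity) hcard)).mp (by positivity)
  have hE0 : 0 < E 0 := by
    refine pos_of_mul_pos_right (lt_of_lt_of_le (by positivity) hcE) (Nat.cast_nonneg _)
  have hfib : ∀ ρ : ℤ, ((T.filter fun x => cross x.1 x.2 / (p ^ M : ℕ) = ρ).card : ℝ) ≤
      9 * (R : ℝ) ^ 3 * (Z : ℝ) ^ 1047 := by
    intro ρ
    refine (card_exactPair_fiber_le hA hn0 hT (fun y hy => (h𝒴 y hy).1) ρ).trans ?_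
    have e1 : (1 : ℝ) ≤ R * Z ^ 647 := one_le_mul_of_one_le_of_one_le hRr (one_le_pow₀ (by linarith))
    push_cast
    calc _ = 8 * (R : ℝ) ^ 3 * (Z : ℝ) ^ 1047 + (R : ℝ) ^ 2 * (Z : ℝ) ^ 400 * 1 := by
          field_simp
          ring
      _ ≤ 8 * (R : ℝ) ^ 3 * (Z : ℝ) ^ 1047 + (R : ℝ) ^ 2 * (Z : ℝ) ^ 400 * (R * Z ^ 647) := by
          gcongr
      _ = _ := by ring
  have hgap : ∀ ξ : ZMod (p ^ N), ¬ ((p ^ m : ℕ) : ℤ) ∣ (ξ.val : ℤ) →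
      E ξ ≤ 1 / (Z : ℝ) ^ 70 * E 0 := by
    intro ξ hξ
    refine spectral_gap_bound hRr hZr hPr hcard hV hcE hE0.le ?_
    rw [hE]
    refine fiberEnergy_le hp hMN hT (by positivity) ξ hfib fun ζ hζ => ?_
    have hθ := norm_theta_le (S := R * Z ^ 220) (B := 4 * R ^ 2 * Z ^ 846) hp hZ91 hn0 hA hM hj h𝒴
      ?_ ?_ ?_ ?_ hz hζ hξ
    · refine hθ.trans (le_of_eq ?_)
      push_cast
      field_simp
      ring
    · calc R * Z ^ 200 * Z ^ 640 = R * Z ^ 840 := by ring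
        _ ≤ (4 * R * Z ^ 6) * (R * Z ^ 840) := Nat.le_mul_of_pos_left _ (by positivity)
        _ = _ := by ring
    · calc p ^ M * Z ^ 209 ≤ R ^ 2 * Z ^ 17 * Z ^ 209 := Nat.mul_le_mul_right _ hP
        _ = R ^ 2 * Z ^ 226 := by ring
        _ ≤ Z ^ 174 * (R ^ 2 * Z ^ 226) := Nat.le_mul_of_pos_left _ (by positivity)
        _ = _ := by ring
    · calc p ^ M * Z ^ 422 ≤ R ^ 2 * Z ^ 17 * Z ^ 422 := Nat.mul_le_mul_right _ hP
        _ = R ^ 2 * Z ^ 439 := by ring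
        _ ≤ Z * (R ^ 2 * Z ^ 439) := Nat.le_mul_of_pos_left _ (by positivity)
        _ = _ := by ring
    · calc 2 * (R * Z ^ 220) * (R * Z ^ 200) * Z ^ 420 = 2 * R ^ 2 * Z ^ 840 := by ring
        _ ≤ (2 * Z ^ 6) * (2 * R ^ 2 * Z ^ 840) := Nat.le_mul_of_pos_left _ (by positivity)
        _ = _ := by ring
  rw [hE] at hE0 hgap
  have hB : 1 / (Z : ℝ) ^ 70 * (p : ℝ) ^ N < T₁.card := by
    have h1 : (p : ℝ) ^ N ≤ (R : ℝ) ^ 2 * (Z : ℝ) ^ 17 := by exact_mod_cast hPN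
    refine lt_of_mul_lt_mul_left ?_ (by positivity : 0 ≤ (Z : ℝ) ^ 20)
    refine lt_of_lt_of_le ?_ hcard₁
    calc _ ≤ (Z : ℝ) ^ 20 * (1 / (Z : ℝ) ^ 70 * ((R : ℝ) ^ 2 * (Z : ℝ) ^ 17)) := by gcongr
      _ = (R : ℝ) ^ 2 / (Z : ℝ) ^ 33 := by field_simp
      _ < _ := div_lt_self (by positivity) (one_lt_pow₀ (by linarith) (by norm_num))
  obtain ⟨x, hx, s₁, s₃, hfin⟩ := exists_cheap_of_fiberEnergy hp (by omega) hM₁N hMN hT₁ hc₁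
    (fun x hx => ((hT x).mp hx).2)
    (fun x hx => hcheap x.1 ((hT x).mp hx).1.1 x.2 ((hT x).mp hx).1.2)
    (by positivity : 0 ≤ 1 / (Z : ℝ) ^ 70) hE0 hgap hB b
  obtain ⟨⟨hx1, hx2⟩, hx3⟩ := (hT x).mp hx
  obtain ⟨ρ, hρ⟩ : ∃ ρ : ℤ, ρ = cross x.1 x.2 / (p ^ M : ℕ) := ⟨_, rfl⟩
  have hρ0 : ρ ≠ 0 := by
    intro h0
    exact ((exactPair_iff hp).mp hx3).2 (by rw [← hρ, h0]; exact dvd_zero _)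
  have hρle : ρ.natAbs ≤ R * Z ^ 1048 := by
    have h1 := abs_cross_le (h𝒴 x.1 hx1).1 (hA.inBox hx2)
    have h2 : cross x.1 x.2 = (p ^ M : ℕ) * ρ := by
      rw [hρ, Int.mul_ediv_cancel' hx3.1]
    rw [h2, abs_mul, Nat.abs_cast, Int.abs_eq_natAbs] at h1
    have h3 : p ^ M * ρ.natAbs ≤ 2 * (4 * R ^ 2 * Z ^ 846) * (R * Z ^ 200) := by exact_mod_cast h1
    refine Nat.le_of_mul_le_mul_left (h3.trans ?_) (pow_pos hp.pos M)
    calc 2 * (4 * R ^ 2 * Z ^ 846) * (R * Z ^ 200) = R ^ 2 * (8 * (R * Z ^ 1046)) := by ring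
      _ ≤ p ^ M * Z * (Z * (R * Z ^ 1046)) := by
          gcongr
          omega
      _ = _ := by ring
  rw [← hρ] at hfin
  refine ⟨r₁, ρ.natAbs, s₁, s₃ * ρ.sign, hr₁, Int.natAbs_pos.mpr hρ0, hr₁Z, hρle, ?_⟩
  convert hfin using 2
  have h1 : (ρ : ℚ) = (ρ.sign : ℚ) * (ρ.natAbs : ℚ) := by
    rw [← Int.cast_natCast, ← Int.cast_mul, Int.sign_mul_natAbs]
  have h2 : (ρ.sign : ℚ) * ρ.sign = 1 := by
    rcases lt_or_gt_of_ne hρ0 with h | h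
    · rw [Int.sign_eq_neg_one_of_neg h]; norm_num
    · rw [Int.sign_eq_one_of_pos h]; norm_num
  have h3 : (ρ.natAbs : ℚ) ≠ 0 := by exact_mod_cast (Int.natAbs_pos.mpr hρ0).ne'
  have h4 : (ρ : ℚ) ≠ 0 := by exact_mod_cast hρ0
  rw [div_eq_div_iff h3 h4, Int.cast_mul, h1]
  linear_combination (s₃ : ℚ) * (ρ.natAbs : ℚ) * h2

end BlockSystem

lemma PrimePowerReduction.of_blockSystem {K : Finset SLTwo} {Y n : ℕ} (hK : BlockSystem K Y)
    (hY : Y = 640 * n) (hn : 409600 ^ 10000 ≤ n) : PrimePowerReduction := by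
  obtain ⟨L, hL⟩ := exists_cheap_words K
  obtain ⟨c, hc⟩ : ∃ c : ℕ, c = 10000 := ⟨_, rfl⟩
  have hc8 : 8214 ≤ c := by omega
  rw [← hc] at hn
  have hn0 : 0 < n := lt_of_lt_of_le (by positivity) hn
  have hY640 : 640 ≤ Y := by omega
  have hnY : 409600 ^ c ≤ Y := hn.trans (by omega)
  have hY0 : 0 < Y := by omega
  refine ⟨Y ^ (c * c), 80000 * L, fun q hq hqY b => ?_⟩
  obtain ⟨p, m, hp, -, rfl⟩ := (isPrimePow_nat_iff q).mp hq
  have hq0 : p ^ m ≠ 0 := (pow_pos hp.pos m).ne'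
  obtain ⟨g, hg⟩ : ∃ g, g = Nat.log Y (p ^ m) / c := ⟨_, rfl⟩
  have hlog : c * c ≤ Nat.log Y (p ^ m) := Nat.le_log_of_pow_le (by omega) hqY
  have hcg : c ≤ g := by rw [hg]; exact (Nat.le_div_iff_mul_le (by omega)).mpr hlog
  have hg1 : c * g ≤ Nat.log Y (p ^ m) := by rw [hg]; exact Nat.mul_div_le _ _
  have hg2 : Nat.log Y (p ^ m) + 1 ≤ c * g + c := by
    have := Nat.lt_mul_div_succ (Nat.log Y (p ^ m)) (by omega : 0 < c)
    rw [← hg, mul_add, mul_one] at this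
    exact this
  obtain ⟨Z, hZ⟩ : ∃ Z, Z = Y ^ g := ⟨_, rfl⟩
  have hYZ : ∀ e ≤ g, Y ^ e ≤ Z := fun e he => hZ ▸ Nat.pow_le_pow_right hY0 he
  have hZ91 : 91 ≤ Z := by
    have := hYZ 1 (by omega)
    rw [pow_one] at this
    omega
  have hZ0 : 0 < Z := by omega
  have hqZ : Z ^ c ≤ p ^ m := by
    rw [hZ, ← pow_mul, mul_comm]
    exact (Nat.pow_le_pow_right hY0 hg1).trans (Nat.pow_log_le_self Y hq0)
  have hqZ' : p ^ m ≤ Z ^ (c + 1) := by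
    rw [hZ, ← pow_mul]
    exact (Nat.lt_pow_succ_log_self (by omega) _).le.trans (Nat.pow_le_pow_right hY0 (by
      rw [mul_add, mul_one, mul_comm g c]
      omega))
  have hZpow : ∀ k ≤ c * g, 409600 ^ k ≤ Z := by
    intro k hk
    calc 409600 ^ k ≤ 409600 ^ (c * g) := Nat.pow_le_pow_right (by norm_num) hk
      _ = (409600 ^ c) ^ g := pow_mul _ _ _
      _ ≤ Y ^ g := Nat.pow_le_pow_left hnY g
      _ = Z := hZ.symm
  obtain ⟨j, hj⟩ : ∃ j, j = Nat.log p (Z ^ 2000) := ⟨_, rfl⟩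
  have hj1 : p ^ j ≤ Z ^ 2000 := by
    rw [hj]; exact Nat.pow_log_le_self p (pow_pos (by omega) _).ne'
  have hj2 : Z ^ 2000 ≤ p ^ (j + 1) := by
    rw [hj]; exact (Nat.lt_pow_succ_log_self hp.one_lt _).le
  have hQ0 : p ^ (m + j) ≠ 0 := (pow_pos hp.pos _).ne'
  have hQZ : p ^ (m + j) ≤ p ^ m * Z ^ 2000 := by
    rw [pow_add]; exact Nat.mul_le_mul_left _ hj1
  obtain ⟨s, hs⟩ : ∃ s, s = Nat.log (Y ^ 4) (p ^ (m + j)) := ⟨_, rfl⟩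
  have hY4 : 1 < Y ^ 4 := Nat.one_lt_pow (by norm_num) (by omega)
  have hs1 : (Y ^ 4) ^ s ≤ p ^ (m + j) := by rw [hs]; exact Nat.pow_log_le_self _ hQ0
  have hs2 : p ^ (m + j) ≤ (Y ^ 4) ^ (s + 1) := by
    rw [hs]; exact (Nat.lt_pow_succ_log_self hY4 _).le
  have hsg : 4 * s ≤ g * (c + 2001) := by
    refine (Nat.pow_le_pow_iff_right (by omega : 1 < Y)).mp ?_
    calc Y ^ (4 * s) = (Y ^ 4) ^ s := pow_mul _ _ _
      _ ≤ p ^ (m + j) := hs1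
      _ ≤ _ := hQZ
      _ ≤ Z ^ (c + 1) * Z ^ 2000 := Nat.mul_le_mul_right _ hqZ'
      _ = _ := by rw [← pow_add, hZ, ← pow_mul]
  obtain ⟨R, hR⟩ : ∃ R, R = Y ^ (2 * (s + 1)) := ⟨_, rfl⟩
  have hR2 : R ^ 2 = (Y ^ 4) ^ (s + 1) := by rw [hR]; ring
  have hQR' : R ^ 2 ≤ p ^ (m + j) * Z := by
    rw [hR2, pow_succ]
    exact Nat.mul_le_mul hs1 (hYZ 4 (by omega))
  obtain ⟨r₁, r₃, s₁, s₃, hr₁, hr₃, hr₁Z, hr₃Z, hcheap⟩ :=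
    hK.exists_cheap_add_of_scale hY0 hL hp (by omega : 0 < g) hZ hR hZ91
      (fun k hk => hZpow k (by rwa [hc])) (t := s + 1) (by subst hc; omega) (hs2.trans_eq hR2.symm)
      hQR' hj2 b
  refine ⟨r₁, r₃, s₁, s₃, hr₁, hr₃, ?_, hcheap.mono ?_⟩
  · have hRq : R ^ 2 ≤ p ^ m * Z ^ 2001 := by
      calc R ^ 2 ≤ p ^ (m + j) * Z := hQR'
        _ ≤ p ^ m * Z ^ 2000 * Z := Nat.mul_le_mul_right _ hQZ
        _ = _ := by ring
    calc (r₁ * r₃) ^ 4 ≤ (Z ^ 5 * (R * Z ^ 1048)) ^ 4 :=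
          Nat.pow_le_pow_left (Nat.mul_le_mul hr₁Z hr₃Z) 4
      _ = (R ^ 2) ^ 2 * Z ^ 4212 := by ring
      _ ≤ (p ^ m * Z ^ 2001) ^ 2 * Z ^ 4212 := Nat.mul_le_mul_right _ (Nat.pow_le_pow_left hRq 2)
      _ = (p ^ m) ^ 2 * Z ^ 8214 := by ring
      _ ≤ (p ^ m) ^ 2 * Z ^ c := Nat.mul_le_mul_left _ (Nat.pow_le_pow_right hZ0 hc8)
      _ ≤ (p ^ m) ^ 2 * p ^ m := Nat.mul_le_mul_left _ hqZ
      _ = _ := (pow_succ _ 2).symm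
  · have hgq : (g : ℝ) ≤ Real.log (p ^ m : ℕ) := by
      rw [Real.le_log_iff_exp_le (by exact_mod_cast Nat.pos_of_ne_zero hq0), ← Real.exp_one_pow]
      have h1 : Real.exp 1 ≤ Y := by
        have h2 := Real.exp_one_lt_d9
        have h3 : (640 : ℝ) ≤ Y := by exact_mod_cast hY640
        linarith
      calc Real.exp 1 ^ g ≤ (Y : ℝ) ^ g := by gcongr
        _ ≤ _ := by
          have h2 : Y ^ g ≤ p ^ m :=
            hZ ▸ (Nat.le_self_pow (by omega : c ≠ 0) Z).trans hqZ
          exact_mod_cast h2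
    push_cast at hgq ⊢
    calc 4 * ((L : ℝ) * (20000 * g)) = 80000 * L * g := by ring
      _ ≤ _ := by gcongr

theorem primePowerReduction : PrimePowerReduction := by
  obtain ⟨K, hK⟩ := exists_blockSystem (409600 ^ 10000) (by positivity)
  exact PrimePowerReduction.of_blockSystem hK rfl le_rfl

/-- Proposition 1 of the paper. There is an absolute constant `C > 0`
such that every rational `b/q ∈ (0,1)` with `gcd(b,q) = 1` admits a representation as a
finite signed sum `b/q = Σ_α ε_α (b_α/q_α)` with total partial-quotient cost
`Σ_α S(b_α/q_α) ≤ C log q`. -/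
theorem statement0 :
    ∃ C : ℝ, 0 < C ∧
      ∀ b q : ℕ, 0 < b → b < q → Nat.Coprime b q →
        ∃ n : ℕ, RepCost ((b : ℚ) / q) n ∧ (n : ℝ) ≤ C * Real.log q :=
  PrimePowerReduction.statement primePowerReduction
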